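/- arXiv:2001.00905 — 3 statements merged into one kernel-verified Lean document; each statement's English description precedes it below -/
import Mathlib

section
/- Let (T_n) be a sequence of nontrivial finite trees that is convergent in metric sampling, i.e., for every integer r ≥ 1 the sampling measures τ_r(T_n) converge weakly in the space of Borel probability measures on M_r. Then there exists a dendron D such that for every r ≥ 1 the measures τ_r(T_n) converge weakly to τ_r(D). -/
open scoped NNReal ENNReal

noncomputable section

/-- `(T,d)` is a real tree: a nonempty complete metric space in which any two distinct
points are joined by an isometric arc all of whose intermediate points separate them. -/
def IsRealTree (T : Type*) [MetricSpace T] : Prop :=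
  Nonempty T ∧ CompleteSpace T ∧
    ∀ p q : T, p ≠ q → ∃ a b : ℝ, a < b ∧ ∃ α : ℝ → T,
      (∀ s ∈ Set.Icc a b, ∀ t ∈ Set.Icc a b, dist (α s) (α t) = |s - t|) ∧
      α a = p ∧ α b = q ∧
      ∀ c : ℝ, a < c → c < b →
        connectedComponentIn ({α c}ᶜ) p ≠ connectedComponentIn ({α c}ᶜ) q

/-- `S` is the segment `[x,y]`. -/
def IsSegment {T : Type*} [MetricSpace T] (x y : T) (S : Set T) : Prop :=
  ∃ a b : ℝ, a ≤ b ∧ ∃ α : ℝ → T,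
    (∀ s ∈ Set.Icc a b, ∀ t ∈ Set.Icc a b, dist (α s) (α t) = |s - t|) ∧
    α a = x ∧ α b = y ∧ S = α '' Set.Icc a b ∧
    ∀ c : ℝ, a < c → c < b →
      connectedComponentIn ({α c}ᶜ) x ≠ connectedComponentIn ({α c}ᶜ) y

/-- `B` is a `p`-branch: a connected component of `T \ {p}`. -/
def IsBranchAt {T : Type*} [MetricSpace T] (p : T) (B : Set T) : Prop :=
  ∃ x : T, x ≠ p ∧ B = connectedComponentIn ({p}ᶜ) x

/-- `B` is a branch of `T`. -/
def IsBranch {T : Type*} [MetricSpace T] (B : Set T) : Prop :=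
  ∃ p : T, IsBranchAt p B

/-- A subtree: a nonempty, closed, connected subset. -/
def IsSubtree {T : Type*} [MetricSpace T] (Y : Set T) : Prop :=
  Y.Nonempty ∧ IsClosed Y ∧ IsPreconnected Y

/-- The sampling map `ρ_r`. -/
def rho {X : Type*} (d : X → X → ℝ) (r : ℕ) (x : Fin r → X) : Fin r → Fin r → ℝ :=
  fun i j => if i = j then 0 else d (x i) (x j)

/-- The sampling measure `τ_r(X,d,μ)`: push-forward of `μ^r` along `ρ_r`. -/
def samplingMeasure {X : Type*} [MeasurableSpace X] (d : X → X → ℝ) (r : ℕ)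
    (μ : MeasureTheory.Measure X) : MeasureTheory.Measure (Fin r → Fin r → ℝ) :=
  MeasureTheory.Measure.map (rho d r) (MeasureTheory.Measure.pi fun _ => μ)

/-- Weak convergence of a sequence of measures. -/
def WeakTendsto {Ω : Type*} [MeasurableSpace Ω] [TopologicalSpace Ω]
    (μ : ℕ → MeasureTheory.Measure Ω) (ν : MeasureTheory.Measure Ω) : Prop :=
  ∀ g : BoundedContinuousFunction Ω ℝ,
    Filter.Tendsto (fun n => ∫ x, g x ∂(μ n)) Filter.atTop (nhds (∫ x, g x ∂ν))

/-- A point `p` is an inner point if no `p`-branch has full measure. -/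
def IsInnerPoint {T : Type*} [MetricSpace T] [MeasurableSpace T]
    (μ : MeasureTheory.Measure T) (p : T) : Prop :=
  ¬ ∃ B : Set T, IsBranchAt p B ∧ μ B = 1

/-- The core: the closure of the set of inner points. -/
def treeCore {T : Type*} [MetricSpace T] [MeasurableSpace T]
    (μ : MeasureTheory.Measure T) : Set T :=
  closure {p : T | IsInnerPoint μ p}

/-- Feathers: the connected components of `T \ Core(T)`. -/
def IsFeather {T : Type*} [MetricSpace T] [MeasurableSpace T]
    (μ : MeasureTheory.Measure T) (F : Set T) : Prop :=
  ∃ x : T, x ∉ treeCore μ ∧ F = connectedComponentIn ((treeCore μ)ᶜ) x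

/-- A long dendron: a real tree together with a Borel probability measure on
`A_D = T × [0,∞)` giving positive mass to `B × [0,∞)` for every branch `B` of `T`. -/
structure LongDendron where
  carrier : Type
  [met : MetricSpace carrier]
  [meas : MeasurableSpace carrier]
  [borelSpace : BorelSpace carrier]
  isRealTree : IsRealTree carrier
  ν : MeasureTheory.Measure (carrier × ℝ≥0)
  isProb : MeasureTheory.IsProbabilityMeasure ν
  branch_pos : ∀ B : Set carrier, IsBranch B → 0 < ν (B ×ˢ Set.univ)

attribute [instance] LongDendron.met LongDendron.meas LongDendron.borelSpace

/-- `d_D((u,a),(v,b)) = d(u,v) + a + b`. -/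
def LongDendron.dD (D : LongDendron) (x y : D.carrier × ℝ≥0) : ℝ :=
  dist x.1 y.1 + (x.2 : ℝ) + (y.2 : ℝ)

/-- `τ_r(D)` for a long dendron `D`. -/
def LongDendron.samp (D : LongDendron) (r : ℕ) :
    MeasureTheory.Measure (Fin r → Fin r → ℝ) :=
  samplingMeasure D.dD r D.ν

/-- A dendron: a long dendron with `d_D ≤ 1` `ν²`-almost surely. -/
def LongDendron.IsDendron (D : LongDendron) : Prop :=
  (D.ν.prod D.ν) {x : (D.carrier × ℝ≥0) × (D.carrier × ℝ≥0) | 1 < D.dD x.1 x.2} = 0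

/-- The (combinatorial) diameter of a finite graph. -/
def graphDiam {V : Type*} [Fintype V] (G : SimpleGraph V) : ℕ :=
  Finset.sup Finset.univ fun p : V × V => G.dist p.1 p.2

/-- The shortest path distance normalized by the diameter. -/
def treeDist {V : Type*} [Fintype V] (G : SimpleGraph V) (u v : V) : ℝ :=
  (G.dist u v : ℝ) / (graphDiam G : ℝ)

/-- `τ_r(T)` for a finite tree: sampling from the uniform measure on the vertex set
with the normalized distance. -/
def treeSamp {V : Type*} [Fintype V] (G : SimpleGraph V) (r : ℕ) :
    MeasureTheory.Measure (Fin r → Fin r → ℝ) :=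
  @samplingMeasure V ⊤ (treeDist G) r
    ((Fintype.card V : ℝ≥0∞)⁻¹ • @MeasureTheory.Measure.count V ⊤)

/-- `(T,d,μ)` is an `A`-tree. -/
def IsATree {T : Type*} [MetricSpace T] [MeasurableSpace T] (n : ℕ)
    (A : Fin n → Fin n → ℝ) (μ : MeasureTheory.Measure T) : Prop :=
  ∃ q : Fin n → T,
    (∀ i j : Fin n, (if i = j then (0 : ℝ) else dist (q i) (q j)) = A i j) ∧
    (∀ Y : Set T, IsSubtree Y → (∀ i, q i ∈ Y) → Y = Set.univ) ∧
    (∀ H : Set T, MeasurableSet H →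
      μ H = ({i : Fin n | q i ∈ H}.ncard : ℝ≥0∞) / (n : ℝ≥0∞))

end

noncomputable section

/-- The associated projection `α(p) = (π(p), d(p, π(p)))` into `Core(T) × [0,∞)`,
for a given nearest-point retraction `π` onto the core. -/
def assocProj {T : Type*} [MetricSpace T] [MeasurableSpace T]
    (μ : MeasureTheory.Measure T) (π : T → T) (hπ : ∀ t, π t ∈ treeCore μ) :
    T → ↥(treeCore μ) × ℝ≥0 :=
  fun p => (⟨π p, hπ p⟩, ⟨dist p (π p), dist_nonneg⟩)

/-- The Borel σ-algebra on `Core(T) × [0,∞)` (the core carrying the restricted metric). -/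
def coreBorel {T : Type*} [MetricSpace T] [MeasurableSpace T]
    (μ : MeasureTheory.Measure T) : MeasurableSpace (↥(treeCore μ) × ℝ≥0) :=
  borel _

/-- The measure of the associated long dendron: push-forward of `μ` along the
associated projection. -/
def assocNu {T : Type*} [MetricSpace T] [MeasurableSpace T]
    (μ : MeasureTheory.Measure T) (π : T → T) (hπ : ∀ t, π t ∈ treeCore μ) :
    @MeasureTheory.Measure (↥(treeCore μ) × ℝ≥0) (coreBorel μ) :=
  letI : MeasurableSpace (↥(treeCore μ) × ℝ≥0) := coreBorel μ
  MeasureTheory.Measure.map (assocProj μ π hπ) μ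

/-- `d_D` for the associated long dendron of a semi-measured real tree. -/
def coreDD {T : Type*} [MetricSpace T] [MeasurableSpace T]
    (μ : MeasureTheory.Measure T) (x y : ↥(treeCore μ) × ℝ≥0) : ℝ :=
  dist (x.1 : T) (y.1 : T) + (x.2 : ℝ) + (y.2 : ℝ)

end

namespace Dnd
open SimpleGraph

lemma path_len {V : Type*} {G : SimpleGraph V} (hG : G.IsTree) {u v : V} (p : G.Walk u v)
    (hp : p.IsPath) : G.dist u v = p.length := by
  obtain ⟨q, hq, hq'⟩ := (hG.connected u v).exists_path_of_dist
  rw [← hq', hG.existsUnique_path u v |>.unique hp hq]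

lemma dist_mem {V : Type*} {G : SimpleGraph V} (hG : G.IsTree) {u v x : V} (p : G.Walk u v)
    (hp : p.IsPath) (hx : x ∈ p.support) : G.dist u x + G.dist x v = G.dist u v := by
  classical
  rw [path_len hG p hp, path_len hG _ (hp.takeUntil hx), path_len hG _ (hp.dropUntil hx),
    ← Walk.length_append, Walk.take_spec]

lemma tree_additive {V : Type*} {G : SimpleGraph V} (hG : G.IsTree) {r w' w y : V}
    (hadj : G.Adj w' w) (h1 : G.dist r w = G.dist r w' + 1)
    (h2 : G.dist y w' = G.dist y w + 1) : G.dist r y = G.dist r w + G.dist w y := by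
  obtain ⟨p, hp, hp'⟩ := (hG.connected r w').exists_path_of_dist
  obtain ⟨q, hq, hq'⟩ := (hG.connected w y).exists_path_of_dist
  have hdisj : ∀ x, x ∈ p.support → x ∈ q.support → False := by
    intro x hx hx'
    have e1 := dist_mem hG p hp hx
    have e2 := dist_mem hG q hq hx'
    have t1 := hG.connected.dist_triangle (u := r) (v := x) (w := w)
    have t2 := hG.connected.dist_triangle (u := y) (v := x) (w := w')
    have c1 := G.dist_comm (u := w) (v := x)
    have c2 := G.dist_comm (u := x) (v := y)
    have c3 := G.dist_comm (u := w) (v := y)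
    omega
  have hpath : (p.append (Walk.cons hadj q)).IsPath := by
    rw [Walk.isPath_def, Walk.support_append, Walk.support_cons, List.tail_cons,
      List.nodup_append]
    refine ⟨hp.support_nodup, hq.support_nodup, ?_⟩
    intro a ha b hb hab
    subst hab
    exact hdisj a ha hb
  rw [path_len hG _ hpath, Walk.length_append, Walk.length_cons, hp', hq', h1]
  ring

/-- Gromov product (doubled) w.r.t. `r`. -/
lemma tree_ultra {V : Type*} {G : SimpleGraph V} (hG : G.IsTree) (r y z : V) : ∀ (k : ℕ) (w : V),
    G.dist r w = k →
    min ((G.dist r y : ℤ) + G.dist r w - G.dist y w) (G.dist r w + G.dist r z - G.dist w z)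
      ≤ (G.dist r y : ℤ) + G.dist r z - G.dist y z := by
  intro k
  induction k with
  | zero =>
    intro w hw
    have := (hG.connected r w).dist_eq_zero_iff.mp hw
    subst this
    have := hG.connected.dist_triangle (u := y) (v := r) (w := z)
    have c1 := G.dist_comm (u := r) (v := y)
    simp
    left
    omega
  | succ k ih =>
    intro w hw
    have : ∃ w', G.Adj w' w ∧ G.dist r w' = k := by
      obtain ⟨p, hp, hp'⟩ := (hG.connected w r).exists_path_of_dist
      have hlen : p.length = k + 1 := by rw [hp', G.dist_comm, hw]
      cases p with
      | nil => simp at hlen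
      | cons h q =>
        refine ⟨_, h.symm, ?_⟩
        rw [G.dist_comm, path_len hG q ((Walk.cons_isPath_iff _ _).1 hp).1]
        simpa using hlen
    obtain ⟨w', hadj, hw'⟩ := this
    have IH := ih w' hw'
    have hy := hG.dist_eq_dist_add_one_of_adj y hadj
    have hz := hG.dist_eq_dist_add_one_of_adj z hadj
    have c1 := G.dist_comm (u := w) (v := z)
    have c2 := G.dist_comm (u := w') (v := z)
    have c3 := G.dist_comm (u := w) (v := y)
    have c4 := G.dist_comm (u := w') (v := y)
    have c5 := G.dist_comm (u := r) (v := y)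
    have t1 := hG.connected.dist_triangle (u := r) (v := w') (w := y)
    have t2 := hG.connected.dist_triangle (u := r) (v := w') (w := z)
    have t3 := hG.connected.dist_triangle (u := y) (v := w) (w := z)
    have t4 := hG.connected.dist_triangle (u := r) (v := y) (w := w')
    have t5 := hG.connected.dist_triangle (u := r) (v := z) (w := w')
    have A : G.dist y w' = G.dist y w + 1 → G.dist r y = G.dist r w + G.dist w y :=
      fun h => tree_additive hG hadj (by omega) h
    have B : G.dist z w' = G.dist z w + 1 → G.dist r z = G.dist r w + G.dist w z :=
      fun h => tree_additive hG hadj (by omega) h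
    rcases hy with hy | hy <;> rcases hz with hz | hz
    · have := A hy; have := B hz; omega
    · have := A hy; omega
    · have := B hz; omega
    · omega
end Dnd

namespace Dnd

/-- truncated similarity -/
noncomputable def sg : ℕ → (ℕ → ℝ) → (ℕ → ℝ) → ℝ
  | 0, _, _ => 0
  | (m+1), s, s' => max (sg m s s') (min (s m) (s' m))

lemma sg_nonneg (m : ℕ) (s s' : ℕ → ℝ) : 0 ≤ sg m s s' := by
  induction m with
  | zero => simp [sg]
  | succ m ih => simp only [sg]; exact le_max_of_le_left ih

lemma sg_mono (s s' : ℕ → ℝ) : Monotone (fun m => sg m s s') :=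
  monotone_nat_of_le_succ fun m => by simp only [sg]; exact le_max_left _ _

lemma le_sg {m j : ℕ} (hj : j < m) (s s' : ℕ → ℝ) : min (s j) (s' j) ≤ sg m s s' :=
  le_trans (by simp only [sg]; exact le_max_right _ _) (sg_mono s s' (Nat.succ_le_of_lt hj))

lemma sg_le {m : ℕ} {s s' : ℕ → ℝ} {c : ℝ} (hc : 0 ≤ c) (h : ∀ j < m, min (s j) (s' j) ≤ c) :
    sg m s s' ≤ c := by
  induction m with
  | zero => simpa [sg]
  | succ m ih =>
    simp only [sg]
    exact max_le (ih fun j hj => h j (by omega)) (h m (by omega))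

lemma sg_cases (m : ℕ) (s s' : ℕ → ℝ) : sg m s s' = 0 ∨ ∃ j < m, sg m s s' = min (s j) (s' j) := by
  induction m with
  | zero => simp [sg]
  | succ m ih =>
    simp only [sg]
    rcases max_choice (sg m s s') (min (s m) (s' m)) with h | h
    · rw [h]
      rcases ih with h0 | ⟨j, hj, h1⟩
      · exact Or.inl h0
      · exact Or.inr ⟨j, by omega, h1⟩
    · rw [h]; exact Or.inr ⟨m, by omega, rfl⟩

lemma sg_comm (m : ℕ) (s s' : ℕ → ℝ) : sg m s s' = sg m s' s := by
  induction m with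
  | zero => simp [sg]
  | succ m ih => simp only [sg, ih, min_comm]

section
variable {V : Type*} (σ : V → V → ℝ)

lemma sg_le_sim (h0 : ∀ x y, 0 ≤ σ x y) (hs : ∀ x y, σ x y = σ y x)
    (hu : ∀ x y z, min (σ x y) (σ y z) ≤ σ x z) (x : ℕ → V) (m : ℕ) (y y' : V) :
    sg m (fun j => σ y (x j)) (fun j => σ y' (x j)) ≤ σ y y' :=
  sg_le (h0 _ _) fun j _ => by
    have := hu y (x j) y'
    rwa [hs (x j) y'] at this

lemma sg_ultra (h0 : ∀ x y, 0 ≤ σ x y) (hs : ∀ x y, σ x y = σ y x)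
    (hu : ∀ x y z, min (σ x y) (σ y z) ≤ σ x z) (x : ℕ → V) (m : ℕ) (y y' y'' : V) :
    min (sg m (fun j => σ y (x j)) (fun j => σ y' (x j)))
      (sg m (fun j => σ y' (x j)) (fun j => σ y'' (x j))) ≤
      sg m (fun j => σ y (x j)) (fun j => σ y'' (x j)) := by
  rcases sg_cases m (fun j => σ y (x j)) (fun j => σ y' (x j)) with h | ⟨j, hj, h⟩
  · rw [h]; exact min_le_of_left_le (sg_nonneg _ _ _)
  have h2 := sg_le_sim σ h0 hs hu x m y' y''
  refine le_trans ?_ (le_sg hj _ _)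
  rw [h]
  have := hu y'' y' (x j)
  rw [hs y'' y'] at this
  refine le_min ?_ ?_
  · exact min_le_of_left_le (min_le_left _ _)
  · refine le_trans ?_ this
    refine le_min ?_ ?_
    · exact (min_le_right _ _).trans h2
    · exact (min_le_left _ _).trans (min_le_right _ _)

lemma greedy [Fintype V] [Nonempty V] (h0 : ∀ x y, 0 ≤ σ x y) (h1 : ∀ x y, σ x y ≤ 1)
    (hs : ∀ x y, σ x y = σ y x)
    (hu : ∀ x y z, min (σ x y) (σ y z) ≤ σ x z) :
    ∃ x : ℕ → V, ∀ m y', ∑ y, (σ y y' - sg m (fun j => σ y (x j)) (fun j => σ y' (x j)))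
      ≤ (Fintype.card V : ℝ) / (m + 1) := by
  classical
  have hp : ∀ t : V → ℝ, ∃ a : V, ∀ b, ∑ y, max (t y) (σ y b) ≤ ∑ y, max (t y) (σ y a) := by
    intro t
    obtain ⟨a, -, ha⟩ := Finset.exists_max_image Finset.univ
      (fun b => ∑ y, max (t y) (σ y b)) Finset.univ_nonempty
    exact ⟨a, fun b => ha b (Finset.mem_univ _)⟩
  choose pick hpick using hp
  let T : ℕ → V → ℝ := fun m => Nat.rec (fun _ => 0) (fun _ t y => max (t y) (σ y (pick t))) m
  let x : ℕ → V := fun m => pick (T m)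
  have T0 : ∀ y, T 0 y = 0 := fun y => rfl
  have TS : ∀ m y, T (m+1) y = max (T m y) (σ y (x m)) := fun m y => rfl
  have Tsg : ∀ m y, T m y = sg m (fun j => σ y (x j)) (fun j => σ y (x j)) := by
    intro m y
    induction m with
    | zero => simp [sg, T0]
    | succ m ih => rw [TS, ih]; simp [sg]
  let g : ℕ → ℝ := fun m => ∑ y, (T (m+1) y - T m y)
  have gmax : ∀ m b, ∑ y, (max (T m y) (σ y b) - T m y) ≤ g m := by
    intro m b
    simp only [g, Finset.sum_sub_distrib, TS]
    linarith [hpick (T m) b]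
  have ganti : Antitone g := by
    refine antitone_nat_of_succ_le fun m => ?_
    refine le_trans ?_ (gmax m (x (m+1)))
    refine Finset.sum_le_sum fun y _ => ?_
    rw [TS (m+1)]
    have : T m y ≤ T (m+1) y := by rw [TS]; exact le_max_left _ _
    rcases max_cases (T (m+1) y) (σ y (x (m+1))) with h | h <;>
    rcases max_cases (T m y) (σ y (x (m+1))) with h' | h' <;> linarith
  have gsum : ∀ m, ∑ i ∈ Finset.range m, g i = ∑ y, T m y := by
    intro m
    induction m with
    | zero => simp [T0]
    | succ m ih => rw [Finset.sum_range_succ, ih]; simp [g, Finset.sum_sub_distrib]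
  have Tle : ∀ m y, T m y ≤ 1 := by
    intro m y
    induction m with
    | zero => simp [T0]
    | succ m ih => rw [TS]; exact max_le ih (h1 _ _)
  have gle : ∀ m, g m ≤ (Fintype.card V : ℝ) / (m+1) := by
    intro m
    rw [le_div_iff₀ (by positivity)]
    have e1 : ∑ i ∈ Finset.range (m+1), g m ≤ ∑ i ∈ Finset.range (m+1), g i :=
      Finset.sum_le_sum fun i hi => ganti (by simpa [Nat.lt_succ_iff] using hi)
    have e2 : ∑ y, T (m+1) y ≤ ∑ y : V, (1:ℝ) := Finset.sum_le_sum fun y _ => Tle (m+1) y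
    rw [gsum] at e1
    simp at e1 e2
    linarith
  refine ⟨x, fun m y' => le_trans (Finset.sum_le_sum fun y _ => ?_) ((gmax m y').trans (gle m))⟩
  have key : min (T m y) (σ y y') ≤ sg m (fun j => σ y (x j)) (fun j => σ y' (x j)) := by
    rcases sg_cases m (fun j => σ y (x j)) (fun j => σ y (x j)) with h | ⟨j, hj, h⟩
    · rw [Tsg, h]; exact min_le_of_left_le (sg_nonneg _ _ _)
    · rw [Tsg, h]
      simp only [min_self]
      refine le_trans ?_ (le_sg hj _ _)
      refine le_min (min_le_left _ _) ?_
      have := hu y' y (x j)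
      rw [hs y' y] at this
      rwa [min_comm]
  rcases max_cases (T m y) (σ y y') with h | h <;>
  rcases min_cases (T m y) (σ y y') with h' | h' <;> linarith
end
end Dnd

namespace Dnd
open Set Filter Topology Metric

def Hyp (T : Type*) [PseudoMetricSpace T] : Prop := ∀ x y z w : T,
  dist x y + dist z w ≤ max (dist x z + dist y w) (dist x w + dist y z)

def Geo (T : Type*) [PseudoMetricSpace T] : Prop := ∀ p q : T, ∀ r : ℝ, 0 ≤ r → r ≤ dist p q →
  ∃ z : T, dist p z = r ∧ dist z q = dist p q - r

lemma geo_of_dense {S T : Type*} [MetricSpace T] [CompleteSpace T] (hT : Hyp T) (ι : S → T)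
    (hι : DenseRange ι)
    (hg : ∀ a b : S, ∀ r : ℝ, 0 ≤ r → r ≤ dist (ι a) (ι b) →
      ∃ z : T, dist (ι a) z = r ∧ dist z (ι b) = dist (ι a) (ι b) - r) : Geo T := by
  intro p q r hr0 hr1
  have happ : ∀ ε > 0, ∃ z : T, dist p z ≤ r + ε ∧ dist z q ≤ dist p q - r + ε := by
    intro ε hε
    obtain ⟨a, ha⟩ := Metric.denseRange_iff.1 hι p (ε/5) (by positivity)
    obtain ⟨b, hb⟩ := Metric.denseRange_iff.1 hι q (ε/5) (by positivity)
    have t1 := dist_triangle4 p (ι a) (ι b) q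
    have t2 := dist_triangle4 (ι a) p q (ι b)
    rw [dist_comm (ι b) q] at t1
    rw [dist_comm (ι a) p] at t2
    obtain ⟨z, hz1, hz2⟩ := hg a b (min r (dist (ι a) (ι b))) (le_min hr0 dist_nonneg)
      (min_le_right _ _)
    refine ⟨z, ?_, ?_⟩
    · have := dist_triangle p (ι a) z
      have := min_le_left r (dist (ι a) (ι b))
      linarith
    · have := dist_triangle z (ι b) q
      rw [dist_comm (ι b) q] at this
      rcases min_cases r (dist (ι a) (ι b)) with h | h <;> linarith
  have happ' : ∀ n : ℕ, ∃ z : T, dist p z ≤ r + 1/((n:ℝ)+1) ∧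
      dist z q ≤ dist p q - r + 1/((n:ℝ)+1) := fun n => happ _ (by positivity)
  choose z hz1 hz2 using happ'
  have hlim : Tendsto (fun n : ℕ => 1/((n:ℝ)+1)) atTop (𝓝 0) :=
    tendsto_one_div_add_atTop_nhds_zero_nat
  have hc : CauchySeq z := by
    refine cauchySeq_of_le_tendsto_0 (fun n : ℕ => 2 * (1/((n:ℝ)+1))) ?_ (by simpa using hlim.const_mul 2)
    intro n m N hn hm
    have e1 : 1/((n:ℝ)+1) ≤ 1/((N:ℝ)+1) := by gcongr
    have e2 : 1/((m:ℝ)+1) ≤ 1/((N:ℝ)+1) := by gcongr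
    have h := hT (z n) (z m) p q
    have a1 := hz1 n
    have a2 := hz1 m
    have a3 := hz2 n
    have a4 := hz2 m
    rw [dist_comm p] at a1 a2
    rcases max_cases (dist (z n) p + dist (z m) q) (dist (z n) q + dist (z m) p) with h' | h' <;> linarith
  obtain ⟨w, hw⟩ := cauchySeq_tendsto_of_complete hc
  have l1 : dist p w ≤ r := by
    have := le_of_tendsto_of_tendsto' (tendsto_const_nhds.dist hw) (hlim.const_add r) hz1
    simpa using this
  have l2 : dist w q ≤ dist p q - r := by
    have := le_of_tendsto_of_tendsto' (hw.dist tendsto_const_nhds) (hlim.const_add (dist p q - r)) hz2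
    simpa using this
  have := dist_triangle p w q
  exact ⟨w, by linarith, by linarith⟩

lemma isRealTree_of {T : Type*} [MetricSpace T] [CompleteSpace T] [Nonempty T] (hT : Hyp T)
    (hg : Geo T) : IsRealTree T := by
  refine ⟨inferInstance, inferInstance, fun p q hpq => ?_⟩
  have hd : 0 < dist p q := dist_pos.2 hpq
  have : ∀ s : ℝ, ∃ z : T, s ∈ Icc 0 (dist p q) → dist p z = s ∧ dist z q = dist p q - s := by
    intro s
    by_cases hs : s ∈ Icc 0 (dist p q)
    · obtain ⟨z, hz⟩ := hg p q s hs.1 hs.2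
      exact ⟨z, fun _ => hz⟩
    · exact ⟨p, fun h => absurd h hs⟩
  choose α hα using this
  refine ⟨0, dist p q, hd, α, ?_, ?_, ?_, ?_⟩
  · intro s hs t ht
    have h := hT (α s) (α t) p q
    obtain ⟨a1, a2⟩ := hα s hs
    obtain ⟨b1, b2⟩ := hα t ht
    have t1 := dist_triangle p (α s) (α t)
    have t2 := dist_triangle p (α t) (α s)
    rw [dist_comm (α t) (α s)] at t2
    rw [dist_comm (α s) p, dist_comm (α t) p] at h
    apply le_antisymm
    · rcases max_cases (dist p (α s) + dist (α t) q) (dist (α s) q + dist p (α t)) with h' | h' <;>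
      rcases abs_cases (s - t) with h'' | h'' <;> linarith
    · rw [abs_le]; constructor <;> linarith
  · have := (hα 0 ⟨le_rfl, hd.le⟩).1
    exact (dist_eq_zero.1 this).symm
  · have := (hα (dist p q) ⟨hd.le, le_rfl⟩).2
    rw [sub_self] at this
    exact dist_eq_zero.1 this
  · intro c hc0 hc1 heq
    obtain ⟨m1, m2⟩ := hα c ⟨hc0.le, hc1.le⟩
    set m := α c
    let U : Set T := {x | 0 < dist x m + dist p m - dist x p}
    let W : Set T := {x | x ≠ m ∧ dist x m + dist p m - dist x p ≤ 0}
    have hU : IsOpen U := isOpen_lt continuous_const (by fun_prop)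
    have hW : IsOpen W := by
      rw [Metric.isOpen_iff]
      rintro x ⟨hx1, hx2⟩
      refine ⟨dist x m, dist_pos.2 hx1, fun y hy => ?_⟩
      rw [Metric.mem_ball] at hy
      refine ⟨?_, ?_⟩
      · rintro rfl
        rw [dist_comm] at hy
        exact lt_irrefl _ hy
      · by_contra hcon
        push Not at hcon
        have h := hT x p y m
        rw [dist_comm p y] at h
        have := dist_comm y x
        have := dist_nonneg (x := y) (y := m)
        rcases max_cases (dist x y + dist p m) (dist x m + dist y p) with h' | h' <;> linarith
    have hpm : p ∈ ({m}ᶜ : Set T) := by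
      intro h; rw [mem_singleton_iff] at h; rw [← h, dist_self] at m1; linarith
    have hqm : q ∈ ({m}ᶜ : Set T) := by
      intro h; rw [mem_singleton_iff] at h; rw [← h, dist_self] at m2; linarith
    have hC : IsPreconnected (connectedComponentIn ({m}ᶜ) p) := isPreconnected_connectedComponentIn
    have hpc := mem_connectedComponentIn hpm
    have hqc := mem_connectedComponentIn hqm
    rw [← heq] at hqc
    obtain ⟨x, -, hx1, hx2⟩ := hC U W hU hW
      (fun x hx => by
        have hxm := connectedComponentIn_subset _ _ hx
        by_cases h : 0 < dist x m + dist p m - dist x p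
        · exact Or.inl h
        · exact Or.inr ⟨hxm, not_lt.1 h⟩)
      ⟨p, hpc, by simp only [U, mem_ofPred_eq, dist_self]; linarith⟩
      ⟨q, hqc, hqm, by rw [dist_comm q m, dist_comm q p]; linarith⟩
    exact absurd hx1 (not_lt.2 hx2.2)

lemma between_of_notMem {T : Type*} [MetricSpace T] (hT : IsRealTree T) {p y z : T} (hz : z ≠ p)
    (hy : y ∉ connectedComponentIn ({p}ᶜ) z) : dist y z = dist y p + dist p z := by
  have hyz : y ≠ z := by
    rintro rfl
    exact hy (mem_connectedComponentIn hz)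
  obtain ⟨a, b, hab, α, hα, rfl, rfl, -⟩ := hT.2.2 y z hyz
  have hcont : ContinuousOn α (Icc a b) := by
    refine LipschitzOnWith.continuousOn (K := 1) ?_
    refine LipschitzOnWith.of_dist_le_mul fun s hs t ht => ?_
    rw [hα s hs t ht, Real.dist_eq]; simp
  by_cases hp : p ∈ α '' Icc a b
  · obtain ⟨c, hc, rfl⟩ := hp
    rw [hα a ⟨le_rfl, hab.le⟩ b ⟨hab.le, le_rfl⟩, hα a ⟨le_rfl, hab.le⟩ c hc, hα c hc b ⟨hab.le, le_rfl⟩]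
    rw [abs_of_nonpos (by linarith), abs_of_nonpos (by linarith [hc.1]), abs_of_nonpos (by linarith [hc.2])]
    ring
  · exfalso
    have hpre : IsPreconnected (α '' Icc a b) := isPreconnected_Icc.image _ hcont
    have := hpre.subset_connectedComponentIn (x := α b) ⟨b, ⟨hab.le, le_rfl⟩, rfl⟩
      (F := {p}ᶜ) (fun x hx h => hp (by rw [mem_singleton_iff] at h; rwa [← h]))
    exact hy (this ⟨a, ⟨le_rfl, hab.le⟩, rfl⟩)

lemma isOpen_comp {T : Type*} [MetricSpace T] (hT : IsRealTree T) (p x : T) :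
    IsOpen (connectedComponentIn ({p}ᶜ) x) := by
  rw [Metric.isOpen_iff]
  intro y hy
  have hyp : y ≠ p := connectedComponentIn_subset _ _ hy
  refine ⟨dist y p, dist_pos.2 hyp, fun z hz => ?_⟩
  by_contra hcon
  rw [connectedComponentIn_eq hy] at hcon
  have := between_of_notMem hT hyp hcon
  rw [Metric.mem_ball] at hz
  have := dist_comm y p
  have := dist_nonneg (x := z) (y := p)
  linarith
end Dnd

namespace Dnd
open Set Filter Topology Metric

structure Sim (X : Type) where
  G : X → X → ℝ
  c : ℝ
  symm : ∀ x y, G x y = G y x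
  le_self : ∀ x y, G x y ≤ G x x
  ultra : ∀ x y z, min (G x y) (G y z) ≤ G x z
  hc : ∀ x y, c ≤ G x y

structure Sim.Pt {X : Type} (S : Sim X) : Type where
  x : X
  t : ℝ
  hc : S.c ≤ t
  hle : t ≤ S.G x x

namespace Sim
variable {X : Type} (S : Sim X)

noncomputable def sim (a b : S.Pt) : ℝ := min (min a.t b.t) (S.G a.x b.x)

lemma sim_comm (a b : S.Pt) : S.sim a b = S.sim b a := by
  unfold sim; rw [min_comm a.t, S.symm]

lemma sim_self (a : S.Pt) : S.sim a a = a.t := by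
  unfold sim; rw [min_self, min_eq_left a.hle]

lemma sim_le_left (a b : S.Pt) : S.sim a b ≤ a.t :=
  (min_le_left _ _).trans (min_le_left _ _)

lemma sim_le_right (a b : S.Pt) : S.sim a b ≤ b.t :=
  (min_le_left _ _).trans (min_le_right _ _)

lemma c_le_sim (a b : S.Pt) : S.c ≤ S.sim a b :=
  le_min (le_min a.hc b.hc) (S.hc _ _)

lemma sim_ultra (a b z : S.Pt) : min (S.sim a z) (S.sim z b) ≤ S.sim a b := by
  refine le_min (le_min ?_ ?_) ?_
  · exact (min_le_left _ _).trans (S.sim_le_left _ _)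
  · exact (min_le_right _ _).trans (S.sim_le_right _ _)
  · refine le_trans ?_ (S.ultra a.x z.x b.x)
    exact min_le_min (min_le_right _ _) (min_le_right _ _)

noncomputable instance : PseudoMetricSpace S.Pt where
  dist a b := a.t + b.t - 2 * S.sim a b
  dist_self a := by rw [sim_self]; ring
  dist_comm a b := by rw [sim_comm]; ring
  dist_triangle a z b := by
    have h := S.sim_ultra a b z
    have h1 := S.sim_le_right a z
    have h2 := S.sim_le_left z b
    rcases min_cases (S.sim a z) (S.sim z b) with h' | h' <;> linarith

lemma dist_def (a b : S.Pt) : dist a b = a.t + b.t - 2 * S.sim a b := rfl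

lemma hyp_pt : Hyp S.Pt := by
  intro x y z w
  simp only [dist_def]
  have h1 := S.sim_ultra x y z
  have h2 := S.sim_ultra x y w
  have h3 := S.sim_ultra z w x
  have h4 := S.sim_ultra z w y
  rw [S.sim_comm z y] at h1
  rw [S.sim_comm w y] at h2
  rw [S.sim_comm z x] at h3
  rw [S.sim_comm z y] at h4
  rw [min_le_iff] at h1 h2 h3 h4
  rw [le_max_iff]
  by_contra hcon
  push Not at hcon
  obtain ⟨k1, k2⟩ := hcon
  rcases h1 with h1 | h1 <;> rcases h2 with h2 | h2 <;> rcases h3 with h3 | h3 <;>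
    rcases h4 with h4 | h4 <;> linarith

lemma geo_pt (a b : S.Pt) (r : ℝ) (h0 : 0 ≤ r) (h1 : r ≤ dist a b) :
    ∃ z : S.Pt, dist a z = r ∧ dist z b = dist a b - r := by
  have key : ∀ (a b : S.Pt) (r : ℝ), 0 ≤ r → r ≤ a.t - S.sim a b →
      ∃ z : S.Pt, dist a z = r ∧ dist z b = dist a b - r := by
    intro a b r h0 h1
    have hc := S.c_le_sim a b
    let w : S.Pt := ⟨a.x, a.t - r, by linarith, by linarith [a.hle]⟩
    refine ⟨w, ?_, ?_⟩
    · rw [dist_def]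
      have : S.sim a w = a.t - r := by
        unfold sim
        simp only [w]
        rw [min_eq_right (by linarith : a.t - r ≤ a.t), min_eq_left (by linarith [a.hle])]
      rw [this]; simp only [w]; ring
    · rw [dist_def, dist_def]
      have : S.sim w b = S.sim a b := by
        unfold sim at h1 ⊢
        simp only [w]
        apply le_antisymm
        · exact min_le_min (min_le_min (by linarith) le_rfl) le_rfl
        · refine le_min (le_min ?_ ?_) (min_le_right _ _)
          · linarith
          · exact (min_le_left _ _).trans (min_le_right _ _)
      rw [this]; simp only [w]; ring
  rcases le_total r (a.t - S.sim a b) with h | h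
  · exact key a b r h0 h
  · obtain ⟨z, hz1, hz2⟩ := key b a (dist a b - r) (by linarith) (by
      rw [dist_def, S.sim_comm b a]; linarith)
    refine ⟨z, ?_, ?_⟩
    · rw [dist_comm, hz2, dist_comm b a]; ring
    · rw [dist_comm, hz1]

abbrev T : Type := UniformSpace.Completion S.Pt

lemma hyp_T : Hyp S.T := by
  intro x y z w
  induction x using UniformSpace.Completion.induction_on with
  | hp => exact isClosed_le (by fun_prop) (by fun_prop)
  | ih x =>
  induction y using UniformSpace.Completion.induction_on with
  | hp => exact isClosed_le (by fun_prop) (by fun_prop)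
  | ih y =>
  induction z using UniformSpace.Completion.induction_on with
  | hp => exact isClosed_le (by fun_prop) (by fun_prop)
  | ih z =>
  induction w using UniformSpace.Completion.induction_on with
  | hp => exact isClosed_le (by fun_prop) (by fun_prop)
  | ih w =>
  simp only [UniformSpace.Completion.dist_eq]
  exact S.hyp_pt x y z w

lemma isRealTree [Nonempty S.Pt] : IsRealTree S.T := by
  haveI : Nonempty S.T := ⟨((Classical.arbitrary S.Pt : S.Pt) : S.T)⟩
  refine isRealTree_of S.hyp_T (geo_of_dense S.hyp_T (fun a : S.Pt => (a : S.T))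
    UniformSpace.Completion.denseRange_coe ?_)
  intro a b r h0 h1
  rw [UniformSpace.Completion.dist_eq] at h1 ⊢
  obtain ⟨z, h⟩ := S.geo_pt a b r h0 h1
  exact ⟨z, by rw [UniformSpace.Completion.dist_eq]; exact h.1,
    by rw [UniformSpace.Completion.dist_eq]; exact h.2⟩

/-- the tip of `x` -/
def tip (x : X) : S.Pt := ⟨x, S.G x x, S.hc x x, le_rfl⟩
def rt (x : X) : S.Pt := ⟨x, S.c, le_rfl, S.hc x x⟩

lemma dist_tip (x y : X) : dist (S.tip x) (S.tip y) = S.G x x + S.G y y - 2 * S.G x y := by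
  rw [dist_def]
  have : S.sim (S.tip x) (S.tip y) = S.G x y := by
    unfold sim tip
    simp only
    rw [min_eq_right]
    exact le_min (S.le_self _ _) (by rw [S.symm]; exact S.le_self _ _)
  rw [this]; simp [tip]

lemma dist_rt (x : X) (a : S.Pt) : dist (S.rt x) a = a.t - S.c := by
  rw [dist_def]
  have : S.sim (S.rt x) a = S.c :=
    le_antisymm (S.sim_le_left _ _) (S.c_le_sim _ _)
  rw [this]; simp [rt]; ring

end Sim
end Dnd

namespace Dnd
open Set Filter Topology Metric MeasureTheory
open scoped NNReal ENNReal
namespace Sim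
variable {X : Type} (S : Sim X)

lemma sim_ge {a b : S.Pt} {q : ℝ} (h1 : q ≤ a.t) (h2 : q ≤ b.t) (h3 : q ≤ S.G a.x b.x) :
    q ≤ S.sim a b := le_min (le_min h1 h2) h3

lemma separable [Nonempty X] (s : X → ℕ → ℝ)
    (hs1 : ∀ f f' j q, q < s f j → q < s f' j → q ≤ S.G f f')
    (hs2 : ∀ f q, S.c ≤ q → q < S.G f f → ∃ j, q < s f j) :
    TopologicalSpace.SeparableSpace S.Pt := by
  classical
  let x0 : X := Classical.arbitrary X
  let P : ℕ × ℚ → S.Pt → Prop := fun i a => a.t = (i.2 : ℝ) ∧ (i.2 : ℝ) < s a.x i.1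
  let F : ℕ × ℚ → S.Pt := fun i => if hi : ∃ a, P i a then hi.choose else S.rt x0
  refine ⟨⟨insert (S.rt x0) (range F), (countable_range F).insert _, ?_⟩⟩
  rw [Metric.dense_iff]
  intro a r hr
  rcases a.hc.eq_or_lt with h | h
  · refine ⟨S.rt x0, ?_, mem_insert _ _⟩
    rw [mem_ball, dist_rt, ← h]; simpa using hr
  · obtain ⟨q, hq1, hq2⟩ := exists_rat_btwn (max_lt h (by linarith : a.t - r < a.t))
    have hcq : S.c < q := (le_max_left _ _).trans_lt hq1
    have hrq : a.t - r < q := (le_max_right _ _).trans_lt hq1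
    obtain ⟨j, hj⟩ := hs2 a.x q hcq.le (hq2.trans_le a.hle)
    let b : S.Pt := ⟨a.x, q, hcq.le, hq2.le.trans a.hle⟩
    have hi : ∃ a, P (j, q) a := ⟨b, rfl, hj⟩
    refine ⟨F (j, q), ?_, mem_insert_of_mem _ (mem_range_self _)⟩
    have hF : P (j, q) (F (j, q)) := by
      simp only [F, dif_pos hi]; exact hi.choose_spec
    obtain ⟨h1, h2⟩ := hF
    simp only at h1 h2
    have := S.sim_ge (a := F (j,q)) (b := a) (q := q) h1.ge hq2.le (hs1 _ _ _ _ h2 hj)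
    rw [mem_ball, dist_def]
    linarith

lemma dist_tip_pt (f : X) (a : S.Pt) :
    dist (S.tip f) a = S.G f f + a.t - 2 * min (min (S.G f f) a.t) (S.G f a.x) := rfl

lemma measurable_of_dist {X T : Type} [MeasurableSpace X] [MetricSpace T]
    [TopologicalSpace.SeparableSpace T] [MeasurableSpace T] [BorelSpace T] (D : Set T) (hD : Dense D)
    (u : X → T) (hu : ∀ a ∈ D, Measurable fun x => dist (u x) a) : Measurable u := by
  refine measurable_of_isOpen fun O hO => ?_
  have : SecondCountableTopology T := UniformSpace.secondCountable_of_separable T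
  -- dist to every point is measurable
  have hall : ∀ a : T, Measurable fun x => dist (u x) a := by
    intro a
    obtain ⟨v, hv, hlim⟩ := mem_closure_iff_seq_limit.1 (hD a)
    exact measurable_of_tendsto_metrizable (fun n => hu _ (hv n))
      (tendsto_pi_nhds.2 fun x => tendsto_const_nhds.dist hlim)
  rcases Set.eq_empty_or_nonempty Oᶜ with h | h
  · have : O = univ := by simpa using h
    simp [this]
  have : u ⁻¹' O = (fun x => infDist (u x) Oᶜ) ⁻¹' (Ioi 0) := by
    ext x
    simp only [mem_preimage, mem_Ioi]
    rw [← hO.isClosed_compl.notMem_iff_infDist_pos h]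
    simp
  rw [this]
  obtain ⟨C, hC1, hC2, hC3⟩ := TopologicalSpace.IsSeparable.exists_countable_dense_subset (s := Oᶜ)
    (TopologicalSpace.IsSeparable.of_separableSpace _)
  have hCne : C.Nonempty := by
    by_contra hcon
    rw [Set.not_nonempty_iff_eq_empty] at hcon
    rw [hcon, closure_empty] at hC3
    exact h.ne_empty (subset_eq_empty hC3 rfl)
  have hcl : closure C = closure (Oᶜ) :=
    subset_antisymm (closure_mono hC1) (closure_minimal hC3 isClosed_closure)
  have e : (fun x => infDist (u x) Oᶜ) = fun x => ⨅ a : C, dist (u x) a := by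
    funext x
    rw [← infDist_closure, ← hcl, infDist_closure, infDist_eq_iInf]
  rw [e]
  have := hC2.to_subtype
  have hm : Measurable (fun x => ⨅ a : C, dist (u x) a) := Measurable.iInf fun a : C => hall a
  exact hm measurableSet_Ioi

end Sim
end Dnd

namespace Dnd
open Set Filter Topology Metric MeasureTheory
open scoped NNReal ENNReal
namespace Sim
variable {X : Type} (S : Sim X)

lemma branch [MeasurableSpace X] (π : Measure X) [IsProbabilityMeasure π]
    (mG : Measurable (fun p : X × X => S.G p.1 p.2)) (s : X → ℕ → ℝ)
    (hs1 : ∀ f f' j q, q < s f j → q < s f' j → q ≤ S.G f f')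
    (hs2 : ∀ f q, S.c ≤ q → q < S.G f f → ∃ j, q < s f j)
    (hpos : ∀ f j q, q < s f j → 0 < π {f' | q < s f' j})
    (hess : ∀ τ, (∀ᵐ p ∂(π.prod π), τ ≤ S.G p.1 p.2) → τ ≤ S.c)
    (f0 : X) (B : Set S.T) (hB : IsBranch B) : 0 < π {f | ((S.tip f : S.Pt) : S.T) ∈ B} := by
  have : Nonempty S.Pt := ⟨S.rt f0⟩
  have hT := S.isRealTree
  obtain ⟨p, x, hxp, rfl⟩ := hB
  have hop := isOpen_comp hT p x
  have drt : ∀ a : S.Pt, dist ((S.rt f0 : S.Pt) : S.T) (a : S.T) = a.t - S.c := fun a => by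
    rw [UniformSpace.Completion.dist_eq, dist_rt]
  set R : S.T := ((S.rt f0 : S.Pt) : S.T) with hR
  by_cases hroot : R ∈ connectedComponentIn ({p}ᶜ) x
  · rw [pos_iff_ne_zero]
    intro h0
    have hRp : R ≠ p := connectedComponentIn_subset _ _ hroot
    have hae : ∀ᵐ f ∂π, ((S.tip f : S.Pt) : S.T) ∉ connectedComponentIn ({p}ᶜ) R := by
      rw [ae_iff, ← connectedComponentIn_eq hroot]; simpa using h0
    have hbt : ∀ᵐ f ∂π, S.G f f - S.c = dist ((S.tip f : S.Pt) : S.T) p + dist p R := by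
      filter_upwards [hae] with f hf
      rw [← between_of_notMem hT hRp hf, dist_comm, drt]; rfl
    have h1 : ∀ᵐ q ∂(π.prod π), S.G q.1 q.1 - S.c = dist ((S.tip q.1 : S.Pt) : S.T) p + dist p R :=
      Measure.quasiMeasurePreserving_fst.ae hbt
    have h2 : ∀ᵐ q ∂(π.prod π), S.G q.2 q.2 - S.c = dist ((S.tip q.2 : S.Pt) : S.T) p + dist p R :=
      Measure.quasiMeasurePreserving_snd.ae hbt
    have := hess (S.c + dist p R) (by
      filter_upwards [h1, h2] with q h1 h2
      have := dist_triangle_right ((S.tip q.1 : S.Pt) : S.T) ((S.tip q.2 : S.Pt) : S.T) p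
      rw [UniformSpace.Completion.dist_eq, dist_tip] at this
      linarith)
    have := dist_pos.2 hRp
    rw [dist_comm] at this
    linarith
  · obtain ⟨z', ⟨hz', a, rfl⟩⟩ := UniformSpace.Completion.denseRange_coe.inter_open_nonempty _ hop
      ⟨x, mem_connectedComponentIn hxp⟩
    have hac : S.c < a.t := by
      rcases a.hc.eq_or_lt with h | h
      · exfalso; apply hroot
        have := drt a
        rw [← h, sub_self, dist_eq_zero] at this
        rwa [this]
      · exact h
    obtain ⟨ε, hε, hball⟩ := Metric.isOpen_iff.1 hop _ hz'
    obtain ⟨q, hq1, hq2⟩ := exists_between (max_lt hac (by linarith : a.t - ε < a.t))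
    have hcq : S.c < q := (le_max_left _ _).trans_lt hq1
    have hrq : a.t - ε < q := (le_max_right _ _).trans_lt hq1
    obtain ⟨j, hj⟩ := hs2 a.x q hcq.le (hq2.trans_le a.hle)
    let z : S.Pt := ⟨a.x, q, hcq.le, hq2.le.trans a.hle⟩
    have hzB : (z : S.T) ∈ connectedComponentIn ({p}ᶜ) x := by
      apply hball
      rw [mem_ball, UniformSpace.Completion.dist_eq, dist_def]
      have := S.sim_ge (a := z) (b := a) (q := q) le_rfl hq2.le (hq2.le.trans a.hle)
      have e : z.t = q := rfl
      linarith
    have hzp : (z : S.T) ≠ p := connectedComponentIn_subset _ _ hzB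
    refine (hpos _ j q hj).trans_le (measure_mono fun f hf => ?_)
    change (S.tip f : S.T) ∈ connectedComponentIn ({p}ᶜ) x
    by_contra hcon
    rw [connectedComponentIn_eq hzB] at hcon hroot
    have e1 := between_of_notMem hT hzp hcon
    have e2 := between_of_notMem hT hzp hroot
    have hG : q ≤ S.G f a.x := hs1 _ _ _ _ hf hj
    have e3 := S.sim_ge (a := S.tip f) (b := z) (q := q) (hG.trans (S.le_self _ _)) le_rfl hG
    have e4 := drt (S.tip f)
    have e5 := drt z
    have e6 := dist_triangle R p (S.tip f : S.T)
    have e7 : dist (S.tip f : S.T) (z : S.T) ≤ (S.tip f).t - q := by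
      rw [UniformSpace.Completion.dist_eq, dist_def]
      have e : z.t = q := rfl
      linarith
    have e : z.t = q := rfl
    rw [dist_comm p (S.tip f : S.T)] at e6
    have := dist_pos.2 hzp
    rw [dist_comm] at this
    linarith

theorem exists_dendron [MeasurableSpace X] (π : Measure X) [IsProbabilityMeasure π]
    (mG : Measurable (fun p : X × X => S.G p.1 p.2)) (s : X → ℕ → ℝ)
    (hs1 : ∀ f f' j q, q < s f j → q < s f' j → q ≤ S.G f f')
    (hs2 : ∀ f q, S.c ≤ q → q < S.G f f → ∃ j, q < s f j)
    (hpos : ∀ f j q, q < s f j → 0 < π {f' | q < s f' j})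
    (hess : ∀ τ, (∀ᵐ p ∂(π.prod π), τ ≤ S.G p.1 p.2) → τ ≤ S.c)
    (h : X → ℝ) (mh : Measurable h) :
    ∃ (D : LongDendron) (U : X → D.carrier × ℝ≥0), Measurable U ∧ D.ν = π.map U ∧
      (∀ f f', D.dD (U f) (U f') = (S.G f f + S.G f' f' - 2 * S.G f f') + max (h f - S.G f f) 0
        + max (h f' - S.G f' f') 0) ∧ SecondCountableTopology D.carrier := by
  have hne : Nonempty X := by
    by_contra hcon
    rw [not_nonempty_iff] at hcon
    have h1 : π univ = 1 := measure_univ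
    rw [univ_eq_empty_iff.2 hcon, measure_empty] at h1
    exact zero_ne_one h1
  let f0 : X := Classical.arbitrary X
  have : Nonempty S.Pt := ⟨S.rt f0⟩
  have hsep := S.separable s hs1 hs2
  have hsepT : TopologicalSpace.SeparableSpace S.T := inferInstance
  have hsc : SecondCountableTopology S.T := UniformSpace.secondCountable_of_separable _
  let mT : MeasurableSpace S.T := borel _
  have bT : BorelSpace S.T := ⟨rfl⟩
  have mG1 : Measurable fun f => S.G f f := mG.comp (measurable_id.prodMk measurable_id)
  have mtip : Measurable fun f => ((S.tip f : S.Pt) : S.T) := by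
    refine measurable_of_dist (range (fun a : S.Pt => (a : S.T))) UniformSpace.Completion.denseRange_coe _ ?_
    rintro _ ⟨a, rfl⟩
    simp only [UniformSpace.Completion.dist_eq, dist_tip_pt]
    have : Measurable fun f => S.G f a.x := mG.comp (measurable_id.prodMk measurable_const)
    fun_prop
  let U : X → S.T × ℝ≥0 := fun f => (((S.tip f : S.Pt) : S.T), Real.toNNReal (h f - S.G f f))
  have mU : Measurable U := mtip.prodMk (mh.sub mG1).real_toNNReal
  let D : LongDendron :=
    { carrier := S.T
      isRealTree := S.isRealTree
      ν := π.map U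
      isProb := Measure.isProbabilityMeasure_map mU.aemeasurable
      branch_pos := by
        intro B hB
        have hBo : IsOpen B := by
          obtain ⟨p, x, hxp, rfl⟩ := hB
          exact isOpen_comp S.isRealTree p x
        rw [Measure.map_apply mU (hBo.measurableSet.prod MeasurableSet.univ)]
        refine (S.branch π mG s hs1 hs2 hpos hess f0 B hB).trans_le (measure_mono ?_)
        intro f hf
        exact ⟨hf, mem_univ _⟩ }
  refine ⟨D, U, mU, rfl, ?_, hsc⟩
  intro f f'
  change dist ((S.tip f : S.Pt) : S.T) ((S.tip f' : S.Pt) : S.T) + _ + _ = _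
  rw [UniformSpace.Completion.dist_eq, dist_tip]
  simp only [U, Real.coe_toNNReal']
end Sim
end Dnd

namespace Dnd
open Set Filter Topology Metric MeasureTheory
open scoped NNReal ENNReal

noncomputable def sgi (s s' : ℕ → ℝ) : ℝ := ⨆ m, sg m s s'

lemma sg_le_one {s s' : ℕ → ℝ} (h : ∀ j, s j ≤ 1) (m : ℕ) : sg m s s' ≤ 1 :=
  sg_le zero_le_one fun j _ => (min_le_left _ _).trans (h j)

lemma sgi_bdd {s : ℕ → ℝ} (h : ∀ j, s j ≤ 1) (s' : ℕ → ℝ) : BddAbove (range fun m => sg m s s') :=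
  ⟨1, by rintro _ ⟨m, rfl⟩; exact sg_le_one h m⟩

lemma sg_le_sgi {s : ℕ → ℝ} (h : ∀ j, s j ≤ 1) (s' : ℕ → ℝ) (m : ℕ) : sg m s s' ≤ sgi s s' :=
  le_ciSup (sgi_bdd h s') m

lemma tendsto_sgi {s : ℕ → ℝ} (h : ∀ j, s j ≤ 1) (s' : ℕ → ℝ) :
    Tendsto (fun m => sg m s s') atTop (𝓝 (sgi s s')) :=
  tendsto_atTop_ciSup (sg_mono s s') (sgi_bdd h s')

lemma sgi_comm (s s' : ℕ → ℝ) : sgi s s' = sgi s' s := by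
  unfold sgi; simp_rw [sg_comm _ s s']

lemma sgi_nonneg {s : ℕ → ℝ} (h : ∀ j, s j ≤ 1) (s' : ℕ → ℝ) : 0 ≤ sgi s s' :=
  (sg_nonneg 0 s s').trans (sg_le_sgi h s' 0)

lemma sgi_le {s s' : ℕ → ℝ} {c : ℝ} (hc : 0 ≤ c) (h : ∀ j, min (s j) (s' j) ≤ c) : sgi s s' ≤ c :=
  ciSup_le fun _ => sg_le hc fun j _ => h j

lemma min_le_sgi {s : ℕ → ℝ} (h : ∀ j, s j ≤ 1) (s' : ℕ → ℝ) (j : ℕ) : min (s j) (s' j) ≤ sgi s s' :=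
  (le_sg (Nat.lt_succ_self j) s s').trans (sg_le_sgi h s' _)

lemma sgi_le_self {s : ℕ → ℝ} (h : ∀ j, s j ≤ 1) (s' : ℕ → ℝ) : sgi s s' ≤ sgi s s :=
  sgi_le (sgi_nonneg h s) fun j => (min_le_left _ _).trans (by simpa using min_le_sgi h s j)

lemma measurable_sg {Y : Type*} [MeasurableSpace Y] {s s' : Y → ℕ → ℝ} (h : ∀ j, Measurable fun y => s y j)
    (h' : ∀ j, Measurable fun y => s' y j) (m : ℕ) : Measurable fun y => sg m (s y) (s' y) := by
  induction m with
  | zero => simp only [sg]; fun_prop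
  | succ m ih =>
    simp only [sg]
    exact ih.max ((h m).min (h' m))

theorem dendron_sg {X : Type} [MeasurableSpace X] (π : Measure X) [IsProbabilityMeasure π]
    (s : X → ℕ → ℝ) (h : X → ℝ) (ms : ∀ j, Measurable fun f => s f j) (mh : Measurable h)
    (s0 : ∀ f j, 0 ≤ s f j) (s1 : ∀ f j, s f j ≤ 1) (sh : ∀ f j, s f j ≤ h f)
    (hu : ∀ m f f' f'', min (sg m (s f) (s f')) (sg m (s f') (s f'')) ≤ sg m (s f) (s f''))
    (hpos : ∀ f j t, t < s f j → 0 < π {f' | t < s f' j}) :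
    ∃ (D : LongDendron) (U : X → D.carrier × ℝ≥0), Measurable U ∧ D.ν = π.map U ∧
      (∀ᵐ p ∂(π.prod π), D.dD (U p.1) (U p.2) = h p.1 + h p.2 - 2 * sgi (s p.1) (s p.2)) ∧
      SecondCountableTopology D.carrier := by
  let G : X → X → ℝ := fun f f' => sgi (s f) (s f')
  have mG : Measurable (fun p : X × X => G p.1 p.2) :=
    measurable_of_tendsto_metrizable
      (f := fun m (p : X × X) => sg m (s p.1) (s p.2))
      (fun m => measurable_sg (s := fun p : X × X => s p.1) (s' := fun p : X × X => s p.2)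
        (fun j => (ms j).comp measurable_fst) (fun j => (ms j).comp measurable_snd) m)
      (tendsto_pi_nhds.2 fun p => tendsto_sgi (s1 p.1) _)
  have G0 : ∀ f f', 0 ≤ G f f' := fun f f' => sgi_nonneg (s1 f) _
  have G1 : ∀ f f', G f f' ≤ 1 := fun f f' => ciSup_le fun m => sg_le_one (s1 f) m
  have Gu : ∀ f f' f'', min (G f f') (G f' f'') ≤ G f f'' := fun f f' f'' =>
    le_of_tendsto_of_tendsto' ((tendsto_sgi (s1 f) _).min (tendsto_sgi (s1 f') _))
      (tendsto_sgi (s1 f) _) fun m => hu m f f' f''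
  let g : X × X → ℝ := fun p => G p.1 p.2
  let c : ℝ := essInf g (π.prod π)
  have hb1 : IsBoundedUnder (· ≥ ·) (ae (π.prod π)) g := ⟨0, by
    rw [eventually_map]; exact Eventually.of_forall fun p => G0 _ _⟩
  have hb2 : IsBoundedUnder (· ≤ ·) (ae (π.prod π)) g := ⟨1, by
    rw [eventually_map]; exact Eventually.of_forall fun p => G1 _ _⟩
  have hcle : ∀ᵐ p ∂(π.prod π), c ≤ G p.1 p.2 := ae_essInf_le hb1
  have hmax : ∀ τ, (∀ᵐ p ∂(π.prod π), τ ≤ G p.1 p.2) → τ ≤ c := fun τ hτ =>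
    le_liminf_of_le hb2.isCoboundedUnder_ge hτ
  have hc0 : 0 ≤ c := hmax 0 (Eventually.of_forall fun p => G0 _ _)
  let S : Sim X :=
    { G := fun f f' => max (G f f') c
      c := c
      symm := fun f f' => by simp only [G]; rw [sgi_comm]
      le_self := fun f f' => max_le_max (sgi_le_self (s1 f) _) le_rfl
      ultra := fun f f' f'' => by
        rw [← max_min_distrib_right]
        exact max_le_max (Gu _ _ _) le_rfl
      hc := fun f f' => le_max_right _ _ }
  obtain ⟨D, U, mU, hν, hd, hsc⟩ := S.exists_dendron π (mG.max measurable_const) s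
    (fun f f' j q h1 h2 => (le_min h1.le h2.le).trans ((min_le_sgi (s1 f) _ j).trans (le_max_left _ _)))
    (by
      intro f q hq1 hq2
      have : q < G f f := by
        rcases lt_max_iff.1 hq2 with h | h
        · exact h
        · exact absurd hq1 (not_le.2 h)
      by_contra hcon
      push Not at hcon
      exact absurd (sgi_le (hc0.trans hq1) fun j => (min_le_left _ _).trans (hcon j)) (not_le.2 this))
    hpos
    (by
      intro τ hτ
      by_contra hcon
      push Not at hcon
      refine absurd (hmax τ ?_) (not_le.2 hcon)
      filter_upwards [hτ] with p hp
      rcases le_max_iff.1 hp with h | h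
      · exact h
      · exact absurd h (not_le.2 hcon))
    h mh
  refine ⟨D, U, mU, hν, ?_, hsc⟩
  filter_upwards [hcle] with p hp
  rw [hd]
  have hGh : ∀ f, G f f ≤ h f := fun f =>
    sgi_le ((s0 f 0).trans (sh f 0)) fun j => (min_le_left _ _).trans (sh f j)
  have a1 : G p.1 p.2 ≤ G p.1 p.1 := sgi_le_self (s1 _) _
  have a2 : G p.1 p.2 ≤ G p.2 p.2 := by
    simp only [G]; rw [sgi_comm]; exact sgi_le_self (s1 _) _
  simp only [S]
  rw [max_eq_left hp, max_eq_left (hp.trans a1), max_eq_left (hp.trans a2),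
    max_eq_left (sub_nonneg.2 (hGh _)), max_eq_left (sub_nonneg.2 (hGh _))]
  simp only [G]; ring
end Dnd

namespace Dnd
open Set Filter Topology Metric MeasureTheory
open scoped NNReal ENNReal

lemma pair_mp {Y : Type*} [MeasurableSpace Y] (μ : Measure Y) [IsProbabilityMeasure μ] {r : ℕ}
    {i j : Fin r} (hij : i ≠ j) :
    MeasurePreserving (fun x : Fin r → Y => (x i, x j)) (Measure.pi fun _ => μ) (μ.prod μ) := by
  refine ⟨(measurable_pi_apply i).prodMk (measurable_pi_apply j), ?_⟩
  symm
  refine Measure.prod_eq fun s t hs ht => ?_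
  rw [Measure.map_apply ((measurable_pi_apply i).prodMk (measurable_pi_apply j)) (hs.prod ht)]
  classical
  have : (fun x : Fin r → Y => (x i, x j)) ⁻¹' (s ×ˢ t) =
      Set.pi univ (fun k => if k = i then s else if k = j then t else univ) := by
    ext x
    simp only [mem_preimage, mem_prod, Set.mem_pi, mem_univ, true_implies]
    constructor
    · rintro ⟨h1, h2⟩ k
      split_ifs with hk hk'
      · rwa [hk]
      · rwa [hk']
      · trivial
    · intro h
      have h1 := h i
      have h2 := h j
      simp [hij.symm] at h1 h2
      exact ⟨h1, h2⟩
  rw [this, Measure.pi_pi]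
  rw [← Finset.mul_prod_erase _ _ (Finset.mem_univ i),
    ← Finset.mul_prod_erase _ _ (Finset.mem_erase.2 ⟨hij.symm, Finset.mem_univ j⟩)]
  rw [Finset.prod_eq_one]
  · simp [hij.symm]
  · intro k hk
    simp only [Finset.mem_erase] at hk
    simp [hk.1, hk.2.1]

lemma measurable_rho {Y : Type*} [MeasurableSpace Y] {d : Y → Y → ℝ}
    (hd : Measurable fun p : Y × Y => d p.1 p.2) (r : ℕ) : Measurable (rho d r) := by
  refine measurable_pi_iff.2 fun i => measurable_pi_iff.2 fun j => ?_
  unfold rho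
  by_cases h : i = j
  · simp [h]
  · simp only [h, if_false]
    have e : Measurable (fun x : Fin r → Y => (x i, x j)) :=
      (measurable_pi_apply i).prodMk (measurable_pi_apply j)
    exact hd.comp e

lemma samp_map {X Y : Type*} [MeasurableSpace X] [MeasurableSpace Y] (μ : Measure X)
    [IsProbabilityMeasure μ] {f : X → Y} (hf : Measurable f) {d : Y → Y → ℝ}
    (hd : Measurable fun p : Y × Y => d p.1 p.2) (r : ℕ) :
    samplingMeasure d r (μ.map f) = samplingMeasure (fun x x' => d (f x) (f x')) r μ := by
  have : IsProbabilityMeasure (μ.map f) := Measure.isProbabilityMeasure_map hf.aemeasurable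
  unfold samplingMeasure
  rw [← Measure.pi_map_pi (fun _ => hf.aemeasurable), Measure.map_map (measurable_rho hd r)]
  · rfl
  · fun_prop

lemma samp_congr {X : Type*} [MeasurableSpace X] (μ : Measure X)
    [IsProbabilityMeasure μ] {d d' : X → X → ℝ}
    (h : ∀ᵐ p ∂(μ.prod μ), d p.1 p.2 = d' p.1 p.2) (r : ℕ) :
    samplingMeasure d r μ = samplingMeasure d' r μ := by
  unfold samplingMeasure
  apply Measure.map_congr
  have : ∀ i j : Fin r, ∀ᵐ x ∂(Measure.pi fun _ : Fin r => μ), i ≠ j → d (x i) (x j) = d' (x i) (x j) := by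
    intro i j
    by_cases hij : i = j
    · simp [hij]
    · have := (pair_mp μ hij).quasiMeasurePreserving.ae h
      filter_upwards [this] with x hx _ using hx
  filter_upwards [ae_all_iff.2 fun i => ae_all_iff.2 (this i)] with x hx
  funext i j
  unfold rho
  split_ifs with hij
  · rfl
  · exact hx i j hij

lemma modulus {r : ℕ} (g : BoundedContinuousFunction (Fin r → Fin r → ℝ) ℝ) {ε : ℝ} (hε : 0 < ε) :
    ∃ C : ℝ, 0 ≤ C ∧ ∀ A B : Fin r → Fin r → ℝ, (∀ i j, |A i j| ≤ 2) → (∀ i j, |B i j| ≤ 2) →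
      |g A - g B| ≤ ε + C * ∑ i, ∑ j, |A i j - B i j| := by
  have hK : IsCompact (closedBall (0 : Fin r → Fin r → ℝ) 2) := isCompact_closedBall _ _
  have huc := hK.uniformContinuousOn_of_continuous g.continuous.continuousOn
  rw [Metric.uniformContinuousOn_iff] at huc
  obtain ⟨δ, hδ, h⟩ := huc ε hε
  have hmem : ∀ A : Fin r → Fin r → ℝ, (∀ i j, |A i j| ≤ 2) → A ∈ closedBall (0 : Fin r → Fin r → ℝ) 2 := by
    intro A hA
    rw [mem_closedBall, dist_pi_le_iff (by norm_num)]
    intro i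
    rw [dist_pi_le_iff (by norm_num)]
    intro j
    simpa [Real.dist_eq] using hA i j
  refine ⟨2 * ‖g‖ / δ, by positivity, fun A B hA hB => ?_⟩
  have hs0 : 0 ≤ ∑ i, ∑ j, |A i j - B i j| :=
    Finset.sum_nonneg fun i _ => Finset.sum_nonneg fun j _ => abs_nonneg _
  have hdl : dist A B ≤ ∑ i, ∑ j, |A i j - B i j| := by
    rw [dist_pi_le_iff hs0]
    intro i
    rw [dist_pi_le_iff hs0]
    intro j
    rw [Real.dist_eq]
    refine le_trans ?_ (Finset.single_le_sum (f := fun i => ∑ j, |A i j - B i j|)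
      (fun i _ => Finset.sum_nonneg fun j _ => abs_nonneg _) (Finset.mem_univ i))
    exact Finset.single_le_sum (f := fun j => |A i j - B i j|)
      (fun j _ => abs_nonneg _) (Finset.mem_univ j)
  rcases lt_or_ge (dist A B) δ with hd | hd
  · have := h A (hmem A hA) B (hmem B hB) hd
    rw [Real.dist_eq] at this
    have h2 : 0 ≤ 2 * ‖g‖ / δ * ∑ i, ∑ j, |A i j - B i j| := by positivity
    linarith
  · have h1 : |g A - g B| ≤ 2 * ‖g‖ := by
      have := g.dist_le_two_norm A B
      rwa [Real.dist_eq] at this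
    have h2 : 2 * ‖g‖ ≤ 2 * ‖g‖ / δ * ∑ i, ∑ j, |A i j - B i j| := by
      rw [div_mul_eq_mul_div, le_div_iff₀ hδ]
      gcongr
      exact hd.trans hdl
    linarith

lemma integral_samp {Y : Type*} [MeasurableSpace Y] (μ : Measure Y) {d : Y → Y → ℝ}
    (hd : Measurable fun p : Y × Y => d p.1 p.2) {r : ℕ}
    (g : BoundedContinuousFunction (Fin r → Fin r → ℝ) ℝ) :
    ∫ A, g A ∂(samplingMeasure d r μ) = ∫ x, g (rho d r x) ∂(Measure.pi fun _ => μ) := by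
  unfold samplingMeasure
  rw [integral_map (measurable_rho hd r).aemeasurable
    g.continuous.measurable.aestronglyMeasurable]

lemma compare {r : ℕ} (g : BoundedContinuousFunction (Fin r → Fin r → ℝ) ℝ) {ε : ℝ} (hε : 0 < ε) :
    ∃ C : ℝ, 0 ≤ C ∧ ∀ (Y : Type) [MeasurableSpace Y] (μ : Measure Y) [IsProbabilityMeasure μ]
      (d d' : Y → Y → ℝ), Measurable (fun p : Y × Y => d p.1 p.2) →
      Measurable (fun p : Y × Y => d' p.1 p.2) → (∀ x y, |d x y| ≤ 2) → (∀ x y, |d' x y| ≤ 2) →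
      ∀ η, ∫ p, |d p.1 p.2 - d' p.1 p.2| ∂(μ.prod μ) ≤ η → 0 ≤ η →
      |∫ A, g A ∂(samplingMeasure d r μ) - ∫ A, g A ∂(samplingMeasure d' r μ)| ≤ ε + C * η := by
  obtain ⟨C, hC, h⟩ := modulus g hε
  refine ⟨C * (r * r), by positivity, ?_⟩
  intro Y _ μ _ d d' md md' hd hd' η hη hη0
  rw [integral_samp μ md, integral_samp μ md']
  have hint : ∀ d : Y → Y → ℝ, Measurable (fun p : Y × Y => d p.1 p.2) →
      Integrable (fun x => g (rho d r x)) (Measure.pi fun _ : Fin r => μ) := fun d md =>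
    Integrable.of_bound (g.continuous.measurable.comp (measurable_rho md r)).aestronglyMeasurable ‖g‖
      (Eventually.of_forall fun x => g.norm_coe_le_norm _)
  rw [← integral_sub (hint d md) (hint d' md')]
  have hb : ∀ d : Y → Y → ℝ, (∀ x y, |d x y| ≤ 2) → ∀ x i j, |rho d r x i j| ≤ 2 := by
    intro d hd x i j
    unfold rho
    split_ifs
    · simp
    · exact hd _ _
  have hI : ∀ i j : Fin r, Integrable (fun x => |rho d r x i j - rho d' r x i j|)
      (Measure.pi fun _ : Fin r => μ) := fun i j => by
    refine Integrable.of_bound ?_ 4 (Eventually.of_forall fun x => ?_)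
    · have h1 := measurable_pi_iff.1 (measurable_pi_iff.1 (measurable_rho md r) i) j
      have h2 := measurable_pi_iff.1 (measurable_pi_iff.1 (measurable_rho md' r) i) j
      exact (continuous_abs.measurable.comp (h1.sub h2)).aestronglyMeasurable
    · rw [Real.norm_eq_abs, abs_abs]
      refine (abs_sub _ _).trans ?_
      linarith [hb d hd x i j, hb d' hd' x i j]
  have hE : ∀ i j : Fin r, ∫ x, |rho d r x i j - rho d' r x i j| ∂(Measure.pi fun _ : Fin r => μ) ≤ η := by
    intro i j
    by_cases hij : i = j
    · simpa [rho, hij] using hη0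
    · refine le_trans (le_of_eq ?_) hη
      rw [← (pair_mp μ hij).map_eq, integral_map (pair_mp μ hij).measurable.aemeasurable]
      · simp [rho, hij]
      · exact (continuous_abs.measurable.comp (md.sub md')).aestronglyMeasurable
  refine (abs_integral_le_integral_abs).trans ?_
  have hsumI : Integrable (fun x => ∑ i, ∑ j, |rho d r x i j - rho d' r x i j|)
      (Measure.pi fun _ : Fin r => μ) :=
    integrable_finsetSum _ fun i _ => integrable_finsetSum _ fun j _ => hI i j
  calc ∫ x, |g (rho d r x) - g (rho d' r x)| ∂(Measure.pi fun _ : Fin r => μ)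
      ≤ ∫ x, (ε + C * ∑ i, ∑ j, |rho d r x i j - rho d' r x i j|) ∂(Measure.pi fun _ : Fin r => μ) := by
        refine integral_mono ((hint d md).sub (hint d' md')).abs
          ((integrable_const _).add (hsumI.const_mul C)) fun x => ?_
        exact h _ _ (hb d hd x) (hb d' hd' x)
    _ = ε + C * ∑ i, ∑ j, ∫ x, |rho d r x i j - rho d' r x i j| ∂(Measure.pi fun _ : Fin r => μ) := by
        rw [integral_add (integrable_const _) (hsumI.const_mul C), integral_const_mul,
          integral_finsetSum _ fun i _ => integrable_finsetSum _ fun j _ => hI i j]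
        congr 1
        · simp
        · congr 1
          refine Finset.sum_congr rfl fun i _ => ?_
          rw [integral_finsetSum _ fun j _ => hI i j]
    _ ≤ ε + C * ∑ i : Fin r, ∑ j : Fin r, η := by
        gcongr with i _ j _
        exact hE i j
    _ = ε + C * (r * r) * η := by simp; ring
end Dnd

namespace Dnd
open Set Filter Topology Metric MeasureTheory
open scoped NNReal ENNReal

abbrev K : Type := ℕ → unitInterval

noncomputable def sK (k : K) (j : ℕ) : ℝ := (k (j+1) : ℝ)
noncomputable def hK (k : K) : ℝ := (k 0 : ℝ)
noncomputable def dK (m : ℕ) (k k' : K) : ℝ := hK k + hK k' - 2 * sg m (sK k) (sK k')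
noncomputable def dI (k k' : K) : ℝ := hK k + hK k' - 2 * sgi (sK k) (sK k')

lemma sK0 (k : K) (j : ℕ) : 0 ≤ sK k j := (k (j+1)).2.1
lemma sK1 (k : K) (j : ℕ) : sK k j ≤ 1 := (k (j+1)).2.2
lemma hK0 (k : K) : 0 ≤ hK k := (k 0).2.1
lemma hK1 (k : K) : hK k ≤ 1 := (k 0).2.2

lemma cont_sK (j : ℕ) : Continuous fun k : K => sK k j := by unfold sK; fun_prop
lemma cont_hK : Continuous hK := by unfold hK; fun_prop

lemma cont_sg (m : ℕ) : Continuous fun p : K × K => sg m (sK p.1) (sK p.2) := by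
  induction m with
  | zero => simp only [sg]; fun_prop
  | succ m ih =>
    simp only [sg]
    exact ih.max (((cont_sK m).comp continuous_fst).min ((cont_sK m).comp continuous_snd))

lemma cont_dK (m : ℕ) : Continuous fun p : K × K => dK m p.1 p.2 := by
  unfold dK
  exact ((cont_hK.comp continuous_fst).add (cont_hK.comp continuous_snd)).sub ((cont_sg m).const_mul 2)

lemma tendsto_dK (k k' : K) : Tendsto (fun m => dK m k k') atTop (𝓝 (dI k k')) := by
  unfold dK dI
  exact ((tendsto_sgi (sK1 k) (sK k')).const_mul 2).const_sub _

lemma meas_dI : Measurable fun p : K × K => dI p.1 p.2 :=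
  measurable_of_tendsto_metrizable (f := fun m (p : K × K) => dK m p.1 p.2)
    (fun m => (cont_dK m).measurable) (tendsto_pi_nhds.2 fun p => tendsto_dK _ _)

lemma dK_bd (m : ℕ) (k k' : K) : |dK m k k'| ≤ 2 := by
  unfold dK
  have a1 := hK0 k; have a2 := hK0 k'; have a3 := hK1 k; have a4 := hK1 k'
  have a5 := sg_nonneg m (sK k) (sK k')
  have a6 : sg m (sK k) (sK k') ≤ 1 := sg_le_one (sK1 k) m
  rw [abs_le]; constructor <;> linarith

theorem limit_exists (πs : ℕ → ProbabilityMeasure K) (R : ℕ → Set K)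
    (hR : ∀ n, (πs n : Measure K) (R n)ᶜ = 0)
    (hsh : ∀ n, ∀ k ∈ R n, ∀ j, sK k j ≤ hK k)
    (hu : ∀ n, ∀ k ∈ R n, ∀ k' ∈ R n, ∀ k'' ∈ R n, ∀ m,
      min (sg m (sK k) (sK k')) (sg m (sK k') (sK k'')) ≤ sg m (sK k) (sK k'')) :
    ∃ (π : ProbabilityMeasure K) (D : LongDendron),
      Tendsto πs (hyperfilter ℕ : Filter ℕ) (𝓝 π) ∧ IsProbabilityMeasure D.ν ∧
      (∀ r, D.samp r = samplingMeasure dI r (π : Measure K)) ∧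
      SecondCountableTopology D.carrier := by
  obtain ⟨π, -, hπ⟩ := isCompact_univ.ultrafilter_le_nhds' ((hyperfilter ℕ).map πs) Filter.univ_mem
  have hlim : Tendsto πs (hyperfilter ℕ : Filter ℕ) (𝓝 π) := hπ
  have key : ∀ f ∈ (π : Measure K).support, ∀ O ∈ 𝓝 f, ∀ᶠ n in (hyperfilter ℕ : Filter ℕ),
      ∃ k ∈ R n, k ∈ O := by
    intro f hf O hO
    have hO' : interior O ∈ 𝓝 f := interior_mem_nhds.2 hO
    have h1 : 0 < (π : Measure K) (interior O) := (Measure.mem_support_iff_forall f).1 hf _ hO'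
    have h2 := ProbabilityMeasure.le_liminf_measure_open_of_tendsto hlim (isOpen_interior (s := O))
    have h3 := eventually_lt_of_lt_liminf (h1.trans_le h2)
    filter_upwards [h3] with n hn
    by_contra hcon
    push Not at hcon
    have : interior O ⊆ (R n)ᶜ := fun k hk hkR => hcon k hkR (interior_subset hk)
    exact absurd (measure_mono_null this (hR n)) hn.ne'
  have sup_sh : ∀ f ∈ (π : Measure K).support, ∀ j, sK f j ≤ hK f := by
    intro f hf j
    have hcl : IsClosed {k : K | sK k j ≤ hK k} := isClosed_le (cont_sK j) cont_hK
    have : f ∈ closure {k : K | sK k j ≤ hK k} := by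
      rw [mem_closure_iff_nhds]
      intro t ht
      obtain ⟨n, k, hk, hkt⟩ := (key f hf t ht).exists
      exact ⟨k, hkt, hsh n k hk j⟩
    rwa [hcl.closure_eq] at this
  have sup_u : ∀ f ∈ (π : Measure K).support, ∀ f' ∈ (π : Measure K).support,
      ∀ f'' ∈ (π : Measure K).support, ∀ m,
      min (sg m (sK f) (sK f')) (sg m (sK f') (sK f'')) ≤ sg m (sK f) (sK f'') := by
    intro f hf f' hf' f'' hf'' m
    let C : Set (K × K × K) := {p | min (sg m (sK p.1) (sK p.2.1)) (sg m (sK p.2.1) (sK p.2.2)) ≤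
      sg m (sK p.1) (sK p.2.2)}
    have c1 : Continuous fun p : K × K × K => sg m (sK p.1) (sK p.2.1) :=
      (cont_sg m).comp (continuous_fst.prodMk (continuous_fst.comp continuous_snd))
    have c2 : Continuous fun p : K × K × K => sg m (sK p.2.1) (sK p.2.2) :=
      (cont_sg m).comp continuous_snd
    have c3 : Continuous fun p : K × K × K => sg m (sK p.1) (sK p.2.2) :=
      (cont_sg m).comp (continuous_fst.prodMk (continuous_snd.comp continuous_snd))
    have hcl : IsClosed C := isClosed_le (c1.min c2) c3
    have : (f, f', f'') ∈ closure C := by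
      rw [mem_closure_iff_nhds]
      intro t ht
      obtain ⟨u, hu1, v, hv1, huv⟩ := mem_nhds_prod_iff.1 ht
      obtain ⟨v1, hv2, v2, hv3, hvv⟩ := mem_nhds_prod_iff.1 hv1
      obtain ⟨n, ⟨k, hk, hkt⟩, ⟨k', hk', hkt'⟩, ⟨k'', hk'', hkt''⟩⟩ :=
        ((key f hf u hu1).and ((key f' hf' v1 hv2).and (key f'' hf'' v2 hv3))).exists
      exact ⟨(k, k', k''), huv ⟨hkt, hvv ⟨hkt', hkt''⟩⟩, hu n k hk k' hk' k'' hk'' m⟩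
    rwa [hcl.closure_eq] at this
  -- the support as a measure space
  let X : Type := (π : Measure K).support
  have mS : MeasurableSet (π : Measure K).support := Measure.isClosed_support.measurableSet
  let P : Measure X := Measure.comap Subtype.val (π : Measure K)
  have hmap : P.map Subtype.val = (π : Measure K) := by
    rw [map_comap_subtype_coe mS]
    exact Measure.restrict_eq_self_of_ae_mem Measure.support_mem_ae
  have mv : Measurable (Subtype.val : X → K) := measurable_subtype_coe
  have hP : IsProbabilityMeasure P := by
    constructor
    rw [← preimage_univ (f := (Subtype.val : X → K)), ← Measure.map_apply mv MeasurableSet.univ, hmap]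
    exact measure_univ
  obtain ⟨D, U, mU, hν, hd, hsc⟩ := dendron_sg P (fun x => sK x.1) (fun x => hK x.1)
    (fun j => (cont_sK j).measurable.comp mv) (cont_hK.measurable.comp mv)
    (fun x => sK0 _) (fun x => sK1 _) (fun x => sup_sh _ x.2)
    (fun m f f' f'' => sup_u _ f.2 _ f'.2 _ f''.2 m)
    (by
      intro f j t ht
      have ho : IsOpen {k : K | t < sK k j} := isOpen_lt continuous_const (cont_sK j)
      have := (Measure.mem_support_iff_forall f.1).1 f.2 _ (ho.mem_nhds ht)
      rw [← hmap, Measure.map_apply mv ho.measurableSet] at this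
      exact this)
  refine ⟨π, D, hlim, D.isProb, fun r => ?_, hsc⟩
  have mdD : Measurable fun p : (D.carrier × ℝ≥0) × (D.carrier × ℝ≥0) => D.dD p.1 p.2 := by
    unfold LongDendron.dD
    fun_prop
  unfold LongDendron.samp
  rw [hν, samp_map P mU mdD r, samp_congr P (d' := fun x x' => dI x.1 x'.1) hd r]
  conv_rhs => rw [← hmap]
  rw [samp_map P mv meas_dI r]
end Dnd

namespace Dnd
open Set Filter Topology Metric MeasureTheory
open scoped NNReal ENNReal

section
variable {V : Type} [Fintype V] (G : SimpleGraph V)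

lemma td_nonneg (u v : V) : 0 ≤ treeDist G u v := by unfold treeDist; positivity

lemma td_le_one (u v : V) : treeDist G u v ≤ 1 := by
  unfold treeDist
  refine div_le_one_of_le₀ ?_ (by positivity)
  have : G.dist u v ≤ graphDiam G :=
    Finset.le_sup (f := fun p : V × V => G.dist p.1 p.2) (Finset.mem_univ (u, v))
  exact_mod_cast this

lemma td_self (u : V) : treeDist G u u = 0 := by simp [treeDist]

lemma td_comm (u v : V) : treeDist G u v = treeDist G v u := by
  simp [treeDist, SimpleGraph.dist_comm]

lemma td_triangle (hG : G.IsTree) (u v w : V) : treeDist G u w ≤ treeDist G u v + treeDist G v w := by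
  unfold treeDist
  rw [← add_div]
  gcongr
  exact_mod_cast hG.connected.dist_triangle

noncomputable def sgm (x₀ y y' : V) : ℝ := (treeDist G x₀ y + treeDist G x₀ y' - treeDist G y y') / 2

variable {G}
lemma sgm_nonneg (hG : G.IsTree) (x₀ y y' : V) : 0 ≤ sgm G x₀ y y' := by
  have := td_triangle G hG y x₀ y'
  rw [td_comm G y x₀] at this
  unfold sgm; linarith

lemma sgm_comm (x₀ y y' : V) : sgm G x₀ y y' = sgm G x₀ y' y := by
  unfold sgm; rw [td_comm G y y']; ring

lemma sgm_le (hG : G.IsTree) (x₀ y y' : V) : sgm G x₀ y y' ≤ treeDist G x₀ y := by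
  have := td_triangle G hG x₀ y y'
  unfold sgm; linarith

lemma sgm_ultra (hG : G.IsTree) (x₀ y w z : V) :
    min (sgm G x₀ y w) (sgm G x₀ w z) ≤ sgm G x₀ y z := by
  have h := tree_ultra hG x₀ y z _ w rfl
  rw [min_le_iff] at h ⊢
  unfold sgm treeDist
  rw [← add_div, ← sub_div, ← add_div, ← sub_div, ← add_div, ← sub_div]
  refine h.imp (fun h => ?_) (fun h => ?_)
  · have : ((G.dist x₀ y : ℝ) + G.dist x₀ w - G.dist y w) ≤ G.dist x₀ y + G.dist x₀ z - G.dist y z := by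
      exact_mod_cast h
    gcongr
  · have : ((G.dist x₀ w : ℝ) + G.dist x₀ z - G.dist w z) ≤ G.dist x₀ y + G.dist x₀ z - G.dist y z := by
      exact_mod_cast h
    gcongr

variable (G) in
noncomputable def Phi (x₀ : V) (hG : G.IsTree) (x : ℕ → V) (y : V) : K
  | 0 => ⟨treeDist G x₀ y, td_nonneg G _ _, td_le_one G _ _⟩
  | (j+1) => ⟨sgm G x₀ y (x j), sgm_nonneg hG _ _ _, (sgm_le hG _ _ _).trans (td_le_one G _ _)⟩

lemma exists_coding (hG : G.IsTree) [MeasurableSpace V] [MeasurableSingletonClass V] (μ : Measure V)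
    (hμ : μ = (Fintype.card V : ℝ≥0∞)⁻¹ • Measure.count) :
    ∃ Φ : V → K, (∀ y j, sK (Φ y) j ≤ hK (Φ y)) ∧
      (∀ y y' y'' m, min (sg m (sK (Φ y)) (sK (Φ y'))) (sg m (sK (Φ y')) (sK (Φ y''))) ≤
        sg m (sK (Φ y)) (sK (Φ y''))) ∧
      ∀ m : ℕ, ∫ p, |treeDist G p.1 p.2 - dK m (Φ p.1) (Φ p.2)| ∂(μ.prod μ) ≤ 2 / (m + 1) := by
  have hne : Nonempty V := hG.connected.nonempty
  let x₀ : V := Classical.arbitrary V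
  obtain ⟨x, hx⟩ := greedy (sgm G x₀) (sgm_nonneg hG x₀)
    (fun y y' => (sgm_le hG _ _ _).trans (td_le_one G _ _)) (sgm_comm x₀) (sgm_ultra hG x₀)
  have hs : ∀ y, sK (Phi G x₀ hG x y) = fun j => sgm G x₀ y (x j) := fun y => rfl
  have hh : ∀ y, hK (Phi G x₀ hG x y) = treeDist G x₀ y := fun y => rfl
  have hprob : IsProbabilityMeasure μ := by
    constructor
    rw [hμ, Measure.smul_apply, Measure.count_univ, smul_eq_mul, ENat.card_eq_coe_fintype_card]
    refine ENNReal.inv_mul_cancel ?_ ?_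
    · simp
    · simp
  refine ⟨Phi G x₀ hG x, ?_, ?_, ?_⟩
  · intro y j
    rw [hs, hh]
    exact sgm_le hG _ _ _
  · intro y y' y'' m
    simp only [hs]
    exact sg_ultra (sgm G x₀) (sgm_nonneg hG x₀) (sgm_comm x₀) (sgm_ultra hG x₀) x m y y' y''
  · intro m
    have e : ∀ p : V × V, |treeDist G p.1 p.2 - dK m (Phi G x₀ hG x p.1) (Phi G x₀ hG x p.2)| =
        2 * (sgm G x₀ p.1 p.2 - sg m (fun j => sgm G x₀ p.1 (x j)) (fun j => sgm G x₀ p.2 (x j))) := by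
      intro p
      have h1 := sg_le_sim (sgm G x₀) (sgm_nonneg hG x₀) (sgm_comm x₀) (sgm_ultra hG x₀) x m p.1 p.2
      have h2 : treeDist G p.1 p.2 = treeDist G x₀ p.1 + treeDist G x₀ p.2 - 2 * sgm G x₀ p.1 p.2 := by
        unfold sgm; ring
      unfold dK
      rw [hs, hs, hh, hh, h2, abs_of_nonpos (by linarith)]
      ring
    simp_rw [e]
    have hc : (0:ℝ) < Fintype.card V := by exact_mod_cast Fintype.card_pos
    have hint : ∀ f : V → ℝ, ∫ y, f y ∂μ = (Fintype.card V : ℝ)⁻¹ * ∑ y, f y := by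
      intro f
      rw [hμ, integral_smul_measure, integral_count]
      simp
    rw [integral_prod_symm _ (Integrable.of_finite)]
    simp_rw [hint, ← Finset.mul_sum]
    calc _ ≤ (Fintype.card V : ℝ)⁻¹ * ((Fintype.card V : ℝ)⁻¹ * (∑ y' : V, 2 * ((Fintype.card V : ℝ) / (m + 1)))) := by
          refine mul_le_mul_of_nonneg_left ?_ (by positivity)
          refine mul_le_mul_of_nonneg_left ?_ (by positivity)
          rw [← Finset.mul_sum]
          refine mul_le_mul_of_nonneg_left ?_ (by positivity)
          exact Finset.sum_le_sum fun y' _ => hx m y'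
      _ = 2 / (m+1) := by
          simp only [Finset.sum_const, Finset.card_univ, nsmul_eq_mul]
          field_simp
end
end Dnd

namespace Dnd
open Set Filter Topology Metric MeasureTheory
open scoped NNReal ENNReal

lemma cont_rho (m r : ℕ) : Continuous (rho (dK m) r) := by
  refine continuous_pi fun i => continuous_pi fun j => ?_
  unfold rho
  by_cases h : i = j
  · simp only [h, if_true]; fun_prop
  · simp only [h, if_false]
    have e : Continuous (fun x : Fin r → K => (x i, x j)) := by fun_prop
    exact (cont_dK m).comp e

lemma weak_dK {L : Filter ℕ} {πs : ℕ → ProbabilityMeasure K} {π : ProbabilityMeasure K}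
    (h : Tendsto πs L (𝓝 π)) (m r : ℕ) (g : BoundedContinuousFunction (Fin r → Fin r → ℝ) ℝ) :
    Tendsto (fun n => ∫ A, g A ∂(samplingMeasure (dK m) r (πs n : Measure K))) L
      (𝓝 (∫ A, g A ∂(samplingMeasure (dK m) r (π : Measure K)))) := by
  simp_rw [integral_samp _ (cont_dK m).measurable g]
  have hc : Continuous fun p : ProbabilityMeasure K => (fun _ : Fin r => p) := by fun_prop
  have h1 : Tendsto (fun n => ProbabilityMeasure.pi (fun _ : Fin r => πs n)) L
      (𝓝 (ProbabilityMeasure.pi (fun _ : Fin r => π))) :=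
    ((ProbabilityMeasure.continuous_pi.comp hc).tendsto π).comp h
  rw [ProbabilityMeasure.tendsto_iff_forall_integral_tendsto] at h1
  exact h1 (g.compContinuous ⟨rho (dK m) r, cont_rho m r⟩)

lemma lim_dK (π : ProbabilityMeasure K) (r : ℕ) (g : BoundedContinuousFunction (Fin r → Fin r → ℝ) ℝ) :
    Tendsto (fun m => ∫ A, g A ∂(samplingMeasure (dK m) r (π : Measure K))) atTop
      (𝓝 (∫ A, g A ∂(samplingMeasure dI r (π : Measure K)))) := by
  simp_rw [fun m => integral_samp (π : Measure K) (cont_dK m).measurable g]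
  rw [integral_samp _ meas_dI g]
  refine tendsto_integral_of_dominated_convergence (fun _ => ‖g‖) ?_ (integrable_const _) ?_ ?_
  · intro m
    exact (g.continuous.comp (cont_rho m r)).measurable.aestronglyMeasurable
  · intro m
    exact Eventually.of_forall fun x => g.norm_coe_le_norm _
  · refine Eventually.of_forall fun x => ?_
    refine (g.continuous.tendsto _).comp ?_
    refine tendsto_pi_nhds.2 fun i => tendsto_pi_nhds.2 fun j => ?_
    unfold rho
    by_cases h : i = j
    · simp [h]
    · simp only [h, if_false]
      exact tendsto_dK _ _

theorem main
    (V : ℕ → Type) [instF : ∀ n, Fintype (V n)]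
    (G : ∀ n, SimpleGraph (V n))
    (htree : ∀ n, (G n).IsTree)
    (hconv : ∀ r : ℕ, 1 ≤ r → ∃ μ : Measure (Fin r → Fin r → ℝ),
      IsProbabilityMeasure μ ∧ WeakTendsto (fun n => treeSamp (G n) r) μ) :
    ∃ D : LongDendron, D.IsDendron ∧
      ∀ r : ℕ, 1 ≤ r → WeakTendsto (fun n => treeSamp (G n) r) (D.samp r) := by
  let inst : ∀ n, MeasurableSpace (V n) := fun _ => ⊤
  have inst2 : ∀ n, MeasurableSingletonClass (V n) := fun n => ⟨fun _ => trivial⟩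
  let μ : ∀ n, Measure (V n) := fun n => (Fintype.card (V n) : ℝ≥0∞)⁻¹ • Measure.count
  have hprob : ∀ n, IsProbabilityMeasure (μ n) := by
    intro n
    have hne : Nonempty (V n) := (htree n).connected.nonempty
    constructor
    simp only [μ]
    rw [Measure.smul_apply, Measure.count_univ, smul_eq_mul, ENat.card_eq_coe_fintype_card]
    refine ENNReal.inv_mul_cancel ?_ ?_
    · simp
    · simp
  have hts : ∀ n r, treeSamp (G n) r = samplingMeasure (treeDist (G n)) r (μ n) := fun n r => rfl
  have hcod := fun n => exists_coding (htree n) (μ n) rfl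
  choose Φ hsh hu hE using hcod
  have mΦ : ∀ n, Measurable (Φ n) := fun n => measurable_of_finite _
  let πs : ℕ → ProbabilityMeasure K := fun n =>
    ⟨(μ n).map (Φ n), Measure.isProbabilityMeasure_map (mΦ n).aemeasurable⟩
  have hπs : ∀ n, (πs n : Measure K) = (μ n).map (Φ n) := fun n => rfl
  obtain ⟨π, D, hlim, hDp, hsamp, hsc⟩ := limit_exists πs (fun n => range (Φ n))
    (by
      intro n
      rw [hπs, Measure.map_apply (mΦ n) (finite_range (Φ n)).measurableSet.compl]
      convert measure_empty (μ := μ n)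
      ext y; simp)
    (by rintro n _ ⟨y, rfl⟩ j; exact hsh n y j)
    (by rintro n _ ⟨y, rfl⟩ _ ⟨y', rfl⟩ _ ⟨y'', rfl⟩ m; exact hu n y y' y'' m)
  have mtd : ∀ n, Measurable fun p : V n × V n => treeDist (G n) p.1 p.2 := fun n => measurable_of_finite _
  have hweak : ∀ r : ℕ, 1 ≤ r → WeakTendsto (fun n => treeSamp (G n) r) (D.samp r) := by
    intro r hr g
    obtain ⟨μr, -, hμr⟩ := hconv r hr
    have hL := hμr g
    set L := ∫ x, g x ∂μr
    suffices L = ∫ x, g x ∂(D.samp r) by rwa [← this]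
    rw [hsamp]
    set b := ∫ x, g x ∂(samplingMeasure dI r (π : Measure K))
    have hLU : Tendsto (fun n => ∫ x, g x ∂(treeSamp (G n) r)) (hyperfilter ℕ : Filter ℕ) (𝓝 L) :=
      hL.mono_left Nat.hyperfilter_le_atTop
    have hle : ∀ ε > 0, |L - b| ≤ ε := by
      intro ε hε
      obtain ⟨C, hC, hcmp⟩ := compare g hε
      have h1 : ∀ m : ℕ, |L - ∫ A, g A ∂(samplingMeasure (dK m) r (π : Measure K))| ≤ ε + C * (2 / ((m:ℝ) + 1)) := by
        intro m
        refine le_of_tendsto ((hLU.sub (weak_dK hlim m r g)).abs) (Eventually.of_forall fun n => ?_)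
        rw [hts, hπs, samp_map (μ n) (mΦ n) (cont_dK m).measurable r]
        refine hcmp (V n) (μ n) _ _ (mtd n) (measurable_of_finite _) ?_ (fun _ _ => dK_bd _ _ _) _
          (hE n m) (by positivity)
        intro y y'
        rw [abs_of_nonneg (td_nonneg _ _ _)]
        linarith [td_le_one (G n) y y']
      have h2 : Tendsto (fun m : ℕ => ε + C * (2 / ((m:ℝ) + 1))) atTop (𝓝 (ε + C * 0)) := by
        refine ((?_ : Tendsto (fun m : ℕ => 2 / ((m:ℝ) + 1)) atTop (𝓝 0)).const_mul C).const_add ε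
        have := (tendsto_one_div_add_atTop_nhds_zero_nat (𝕜 := ℝ)).const_mul 2
        simpa [div_eq_mul_inv] using this
      have := le_of_tendsto_of_tendsto' ((lim_dK π r g).const_sub L).abs h2 h1
      simpa using this
    have : |L - b| ≤ 0 := le_of_forall_pos_le_add fun ε hε => by simpa using hle ε hε
    exact sub_eq_zero.1 (abs_nonpos_iff.1 this)
  refine ⟨D, ?_, hweak⟩
  -- dendron
  have mdD : Measurable fun p : (D.carrier × ℝ≥0) × (D.carrier × ℝ≥0) => D.dD p.1 p.2 := by
    unfold LongDendron.dD
    fun_prop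
  let φ : (Fin 2 → Fin 2 → ℝ) → ℝ := fun A => min 1 (max 0 (A 0 1 - 1))
  have hφc : Continuous φ := by fun_prop
  have hφ0 : ∀ A, 0 ≤ φ A := fun A => le_min zero_le_one (le_max_left _ _)
  have hφ1 : ∀ A, φ A ≤ 1 := fun A => min_le_left _ _
  let g : BoundedContinuousFunction (Fin 2 → Fin 2 → ℝ) ℝ :=
    BoundedContinuousFunction.ofNormedAddCommGroup φ hφc 1 (fun A => by
      rw [Real.norm_eq_abs, abs_of_nonneg (hφ0 A)]; exact hφ1 A)
  have h0 : ∀ n, ∫ A, g A ∂(treeSamp (G n) 2) = 0 := by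
    intro n
    rw [hts, integral_samp _ (mtd n) g]
    have : ∀ x, g (rho (treeDist (G n)) 2 x) = 0 := by
      intro x
      change min 1 (max 0 (rho (treeDist (G n)) 2 x 0 1 - 1)) = 0
      have : rho (treeDist (G n)) 2 x 0 1 ≤ 1 := by
        simp only [rho]
        exact td_le_one _ _ _
      rw [max_eq_left (by linarith)]; simp
    simp [this]
  have h1 : ∫ A, g A ∂(D.samp 2) = 0 := by
    have := hweak 2 (by norm_num) g
    simp_rw [h0] at this
    exact (tendsto_nhds_unique this tendsto_const_nhds)
  unfold LongDendron.samp at h1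
  rw [integral_samp _ mdD g, integral_eq_zero_iff_of_nonneg (f := fun x => g (rho D.dD 2 x)) (fun x => hφ0 _)] at h1
  · have hmp := pair_mp D.ν (show (0 : Fin 2) ≠ 1 by decide)
    unfold LongDendron.IsDendron
    have hms : MeasurableSet {x : (D.carrier × ℝ≥0) × (D.carrier × ℝ≥0) | 1 < D.dD x.1 x.2} :=
      measurableSet_lt measurable_const mdD
    rw [← hmp.map_eq, Measure.map_apply hmp.measurable hms]
    refine measure_mono_null ?_ (ae_iff.1 h1)
    intro x hx
    change 1 < D.dD (x 0) (x 1) at hx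
    change ¬ (min 1 (max 0 (rho D.dD 2 x 0 1 - 1)) = 0)
    have e : rho D.dD 2 x 0 1 = D.dD (x 0) (x 1) := by simp [rho]
    rw [e]
    exact (lt_min one_pos (lt_max_of_lt_right (by linarith))).ne'
  · refine Integrable.of_bound
      (g.continuous.measurable.comp (measurable_rho mdD 2)).aestronglyMeasurable ‖g‖
      (Eventually.of_forall fun x => g.norm_coe_le_norm _)
end Dnd

open MeasureTheory Metric Filter Topology Set
open scoped NNReal ENNReal

noncomputable section

/-- **Theorem 1 (Elek–Tardos).** Every sequence of nontrivial finite trees that is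
convergent in metric sampling has a dendron as sampling limit. -/
theorem statement0
    (V : ℕ → Type) [instF : ∀ n, Fintype (V n)]
    (G : ∀ n, SimpleGraph (V n))
    (htree : ∀ n, (G n).IsTree)
    (hnontriv : ∀ n, 1 < Fintype.card (V n))
    (hconv : ∀ r : ℕ, 1 ≤ r → ∃ μ : Measure (Fin r → Fin r → ℝ),
      IsProbabilityMeasure μ ∧ WeakTendsto (fun n => treeSamp (G n) r) μ) :
    ∃ D : LongDendron, D.IsDendron ∧
      ∀ r : ℕ, 1 ≤ r → WeakTendsto (fun n => treeSamp (G n) r) (D.samp r) := by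
  exact Dnd.main V G htree hconv

end
end

section
/- For every dendron D there exists a sequence (T_n) of nontrivial finite trees such that for every integer r ≥ 1 the sampling measures τ_r(T_n) converge weakly to τ_r(D) in the space of Borel probability measures on M_r. -/
open scoped NNReal ENNReal

open MeasureTheory Metric Filter Topology Set
open scoped NNReal ENNReal

noncomputable section



namespace FT
variable {I : Type} 

/-- combinatorial distance -/
def dd (g : I → I → ℕ) (p q : I × ℕ) : ℕ :=
  (p.2 - min p.2 (min q.2 (g p.1 q.1))) + (q.2 - min p.2 (min q.2 (g p.1 q.1)))

theorem dd_comm (g : I → I → ℕ) (hs : ∀ i j, g i j = g j i) (p q : I × ℕ) :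
    dd g p q = dd g q p := by
  unfold dd; rw [hs q.1 p.1]; omega

theorem dd_tri (g : I → I → ℕ) 
    (hu : ∀ i l j, min (g i l) (g l j) ≤ g i j) (p q r : I × ℕ) :
    dd g p r ≤ dd g p q + dd g q r := by
  unfold dd; have := hu p.1 q.1 r.1; omega

theorem exists_tree [Fintype I] [Nonempty I] (h : I → ℕ) (g : I → I → ℕ)
    (hs : ∀ i j, g i j = g j i) (hd : ∀ i, g i i = h i) (hle : ∀ i j, g i j ≤ h i)
    (hu : ∀ i l j, min (g i l) (g l j) ≤ g i j) :
    ∃ (V : Type) (_ : Fintype V) (G : SimpleGraph V) (f : I → ℕ → V), G.IsTree ∧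
      (∀ v, ∃ i t, t ≤ h i ∧ f i t = v) ∧
      ∀ i j s t, s ≤ h i → t ≤ h j → G.dist (f i s) (f j t) = dd g (i, s) (j, t) := by
  classical
  let rep : I × ℕ → I × ℕ := fun p => (Classical.epsilon (fun j => p.2 ≤ g p.1 j), p.2)
  have rep_g : ∀ p : I × ℕ, p.2 ≤ h p.1 → p.2 ≤ g p.1 (rep p).1 := by
    intro p hp
    exact Classical.epsilon_spec (p := fun j => p.2 ≤ g p.1 j) ⟨p.1, by rw [hd]; exact hp⟩
  have rep_h : ∀ p : I × ℕ, p.2 ≤ h p.1 → p.2 ≤ h (rep p).1 := by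
    intro p hp
    have := rep_g p hp
    rw [hs] at this
    exact this.trans (hle _ _)
  have rep_eq : ∀ p q : I × ℕ, p.2 = q.2 → p.2 ≤ g p.1 q.1 → rep p = rep q := by
    rintro ⟨i, s⟩ ⟨j, t⟩ h1 h2
    simp only at h1 h2
    subst h1
    have : (fun l => s ≤ g i l) = (fun l => s ≤ g j l) := by
      funext l
      have a := hu i j l
      have b := hu j i l
      have c := hs i j
      apply propext
      constructor <;> intro <;> omega
    simp only [rep, this]
  have rep_rep : ∀ p : I × ℕ, p.2 ≤ h p.1 → rep (rep p) = rep p := by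
    intro p hp
    exact (rep_eq p (rep p) rfl (rep_g p hp)).symm
  let V := {p : I × ℕ // p.2 ≤ h p.1 ∧ rep p = p}
  have hfin : Finite V := by
    let F : V → I × Fin (Finset.univ.sup h + 1) := fun v => (v.1.1, ⟨v.1.2,
      Nat.lt_succ_of_le (v.2.1.trans (Finset.le_sup (f := h) (Finset.mem_univ _)))⟩)
    apply Finite.of_injective F
    rintro ⟨⟨i, s⟩, h1⟩ ⟨⟨j, t⟩, h2⟩ h3
    simp only [F, Prod.mk.injEq, Fin.mk.injEq] at h3
    obtain ⟨rfl, rfl⟩ := h3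
    rfl
  let mk : ∀ p : I × ℕ, p.2 ≤ h p.1 → V := fun p hp => ⟨rep p, rep_h p hp, rep_rep p hp⟩
  have mk_val : ∀ (v : V), mk v.1 v.2.1 = v := fun v => Subtype.ext v.2.2
  let D : V → V → ℕ := fun u v => dd g u.1 v.1
  have Dcomm : ∀ u v, D u v = D v u := fun u v => dd_comm g hs _ _
  have Dtri : ∀ u v w, D u w ≤ D u v + D v w := fun u v w => dd_tri g hu _ _ _
  have dd_self : ∀ p : I × ℕ, p.2 ≤ h p.1 → dd g p p = 0 := by
    intro p hp; unfold dd; have := hd p.1; omega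
  have dd_rep : ∀ p : I × ℕ, p.2 ≤ h p.1 → dd g p (rep p) = 0 := by
    intro p hp
    have := rep_g p hp
    have h2 : (rep p).2 = p.2 := rfl
    unfold dd; omega
  have Dmk : ∀ p q hp hq, D (mk p hp) (mk q hq) = dd g p q := by
    intro p q hp hq
    have a := dd_rep p hp
    have b := dd_rep q hq
    have a' := dd_comm g hs p (rep p)
    have b' := dd_comm g hs q (rep q)
    have e1 := dd_tri g hu p (rep p) q
    have e2 := dd_tri g hu (rep p) (rep q) q
    have e3 := dd_tri g hu (rep p) p (rep q)
    have e4 := dd_tri g hu p q (rep q)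
    change dd g (rep p) (rep q) = _
    omega
  have D0 : ∀ u v, D u v = 0 → u = v := by
    intro u v huv
    rw [← mk_val u, ← mk_val v]
    apply Subtype.ext
    simp only [D, dd] at huv
    exact rep_eq _ _ (by omega) (by omega)
  have Dself : ∀ u, D u u = 0 := fun u => dd_self _ u.2.1
  let par : V → V := fun v => mk (v.1.1, v.1.2 - 1) (by have := v.2.1; simp only; omega)
  have Dpar : ∀ v : V, v.1.2 ≠ 0 → D v (par v) = 1 := by
    intro v hv
    have h1 : D v (par v) = dd g v.1 (v.1.1, v.1.2 - 1) := by
      have := Dmk v.1 (v.1.1, v.1.2 - 1) v.2.1 (by have := v.2.1; simp only; omega)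
      rw [mk_val v] at this
      exact this
    rw [h1]
    have := hd v.1.1
    have := v.2.1
    simp only [dd]; omega
  let G : SimpleGraph V :=
    { Adj := fun u v => D u v = 1
      symm := ⟨fun u v huv => by rw [Dcomm]; exact huv⟩
      loopless := ⟨fun u huu => by rw [Dself] at huu; omega⟩ }
  have adj_iff : ∀ u v, G.Adj u v ↔ D u v = 1 := fun u v => Iff.rfl
  have adj_par : ∀ u v, G.Adj u v → (u.1.2 ≠ 0 ∧ v = par u) ∨ (v.1.2 ≠ 0 ∧ u = par v) := by
    have key : ∀ u v, D u v = 1 → v.1.2 < u.1.2 → (u.1.2 ≠ 0 ∧ v = par u) := by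
      intro u v huv hlt
      refine ⟨by omega, ?_⟩
      rw [← mk_val v]
      apply Subtype.ext
      simp only [D, dd] at huv
      refine rep_eq _ _ ?_ ?_
      · simp only; omega
      · simp only; rw [hs]; omega
    intro u v huv
    rw [adj_iff] at huv
    by_cases hlt : v.1.2 < u.1.2
    · exact Or.inl (key u v huv hlt)
    · by_cases hlt' : u.1.2 < v.1.2
      · exact Or.inr (key v u (by rw [Dcomm]; exact huv) hlt')
      · exfalso
        simp only [D, dd] at huv
        omega
  have lower : ∀ (u v : V) (p : G.Walk u v), D u v ≤ p.length := by
    intro u v p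
    induction p with
    | nil => rw [Dself]; simp
    | cons hadj p ih =>
      rename_i a b c
      have h1 := Dtri a b c
      rw [adj_iff] at hadj
      simp only [SimpleGraph.Walk.length_cons]
      omega
  have upper : ∀ n (u v : V), D u v = n → ∃ p : G.Walk u v, p.length = n := by
    intro n
    induction n with
    | zero => intro u v huv; obtain rfl := D0 u v huv; exact ⟨.nil, rfl⟩
    | succ n ih =>
      have key : ∀ u v, D u v = n + 1 → min v.1.2 (g u.1.1 v.1.1) < u.1.2 →
          ∃ p : G.Walk u v, p.length = n + 1 := by
        intro u v huv hlt
        have h0 : u.1.2 ≠ 0 := by omega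
        have h1 : D (par u) v = dd g (u.1.1, u.1.2 - 1) v.1 := by
          have := Dmk (u.1.1, u.1.2 - 1) v.1 (by have := u.2.1; simp only; omega) v.2.1
          rw [mk_val v] at this
          exact this
        have h2 : D (par u) v = n := by
          rw [h1]
          simp only [D, dd] at huv ⊢
          omega
        obtain ⟨p, hp⟩ := ih _ _ h2
        exact ⟨.cons ((adj_iff _ _).2 (Dpar u h0)) p, by simp [hp]⟩
      intro u v huv
      by_cases hlt : min v.1.2 (g u.1.1 v.1.1) < u.1.2
      · exact key u v huv hlt
      · obtain ⟨p, hp⟩ := key v u (by rw [Dcomm]; exact huv) (by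
          have := hs u.1.1 v.1.1
          simp only [D, dd] at huv
          omega)
        exact ⟨p.reverse, by simp [hp]⟩
  have hpre : G.Preconnected := fun u v => by
    obtain ⟨p, _⟩ := upper _ u v rfl
    exact ⟨p⟩
  have hne : Nonempty V := ⟨mk (Classical.arbitrary I, 0) (Nat.zero_le _)⟩
  have hconn : G.Connected := ⟨hpre⟩
  have hdist : ∀ u v, G.dist u v = D u v := by
    intro u v
    apply le_antisymm
    · obtain ⟨p, hp⟩ := upper _ u v rfl
      rw [← hp]; exact SimpleGraph.dist_le p
    · obtain ⟨p, hp⟩ := hconn.exists_walk_length_eq_dist u v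
      rw [← hp]; exact lower u v p
  let root : V := mk (Classical.arbitrary I, 0) (Nat.zero_le _)
  refine ⟨V, Fintype.ofFinite V, G, fun i t => if ht : t ≤ h i then mk (i, t) ht else root,
    ?_, ?_, ?_⟩
  · rw [SimpleGraph.isTree_iff_connected_and_card]
    refine ⟨hconn, le_antisymm ?_ hconn.card_vert_le_card_edgeSet_add_one⟩
    let E : G.edgeSet → {v : V // v ≠ root} → Prop := fun e v => e.1 = s(v.1, par v.1)
    have hE : ∀ e : G.edgeSet, ∃ v, E e v := by
      rintro ⟨e, he⟩
      induction e with
      | _ u v =>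
      rw [SimpleGraph.mem_edgeSet] at he
      rcases adj_par u v he with ⟨h1, h2⟩ | ⟨h1, h2⟩
      · exact ⟨⟨u, fun hh => h1 (by rw [hh])⟩, by simp only [E]; rw [h2]⟩
      · exact ⟨⟨v, fun hh => h1 (by rw [hh])⟩, by simp only [E]; rw [h2]; exact Sym2.eq_swap⟩
    choose F hF using hE
    have hinj : Function.Injective F := by
      intro e e' hee
      apply Subtype.ext
      have h1 := hF e
      have h2 := hF e'
      simp only [E] at h1 h2
      rw [h1, h2, hee]
    have h3 := Nat.card_le_card_of_injective F hinj
    have h4 : Nat.card {v : V // v ≠ root} + 1 = Nat.card V := by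
      have : Fintype V := Fintype.ofFinite V
      rw [Nat.card_eq_fintype_card, Nat.card_eq_fintype_card, Fintype.card_subtype_compl,
        Fintype.card_subtype_eq]
      have := Fintype.card_pos (α := V)
      omega
    omega
  · intro v
    refine ⟨v.1.1, v.1.2, v.2.1, ?_⟩
    beta_reduce
    rw [dif_pos v.2.1]
    exact mk_val v
  · intro i j s t hi hj
    beta_reduce
    rw [dif_pos hi, dif_pos hj, hdist]
    exact Dmk (i, s) (j, t) hi hj
end FT


namespace RT
variable {T : Type} [MetricSpace T]

theorem through (hT : IsRealTree T) {c x w : T} (hx : x ≠ c) (hw : w ≠ c)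
    (hne : connectedComponentIn ({c}ᶜ) x ≠ connectedComponentIn ({c}ᶜ) w) :
    dist w x = dist w c + dist c x := by
  have hxw : x ≠ w := fun h => hne (by rw [h])
  obtain ⟨a, b, hab, α, hα, ha, hb, -⟩ := hT.2.2 x w hxw
  have hc : c ∈ α '' Icc a b := by
    by_contra hc
    have hcont : ContinuousOn α (Icc a b) := by
      have : LipschitzOnWith 1 α (Icc a b) :=
        LipschitzOnWith.of_dist_le_mul fun s hs t ht => by
          rw [hα s hs t ht, NNReal.coe_one, one_mul, Real.dist_eq]
      exact this.continuousOn
    have hpre : IsPreconnected (α '' Icc a b) := isPreconnected_Icc.image α hcont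
    have hsub : α '' Icc a b ⊆ {c}ᶜ := by
      intro y hy hyc
      rw [mem_singleton_iff] at hyc
      exact hc (hyc ▸ hy)
    have hxm : x ∈ α '' Icc a b := ⟨a, left_mem_Icc.2 hab.le, ha⟩
    have hwm : w ∈ α '' Icc a b := ⟨b, right_mem_Icc.2 hab.le, hb⟩
    have := hpre.subset_connectedComponentIn hxm hsub
    exact hne (connectedComponentIn_eq (this hwm))
  obtain ⟨t, ht, rfl⟩ := hc
  have h1 := hα b (right_mem_Icc.2 hab.le) a (left_mem_Icc.2 hab.le)
  have h2 := hα b (right_mem_Icc.2 hab.le) t ht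
  have h3 := hα t ht a (left_mem_Icc.2 hab.le)
  rw [ha, hb] at h1
  rw [hb] at h2
  rw [ha] at h3
  rw [h1, h2, h3, abs_of_nonneg (by linarith), abs_of_nonneg (by linarith [ht.2]),
    abs_of_nonneg (by linarith [ht.1])]
  ring

theorem between (hT : IsRealTree T) (x z : T) (t : ℝ) (h0 : 0 ≤ t) (h1 : t ≤ dist x z) :
    ∃ c, dist x c = t ∧ dist c z = dist x z - t ∧
      (0 < t → t < dist x z →
        connectedComponentIn ({c}ᶜ) x ≠ connectedComponentIn ({c}ᶜ) z) := by
  rcases eq_or_ne x z with rfl | hxz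
  · rw [dist_self] at h1
    obtain rfl : t = 0 := le_antisymm h1 h0
    exact ⟨x, by simp, by simp, fun h => absurd h (lt_irrefl _)⟩
  · obtain ⟨a, b, hab, α, hα, ha, hb, hsep⟩ := hT.2.2 x z hxz
    have h2 := hα a (left_mem_Icc.2 hab.le) b (right_mem_Icc.2 hab.le)
    rw [ha, hb, abs_of_nonpos (by linarith)] at h2
    have hm : a + t ∈ Icc a b := ⟨by linarith, by linarith⟩
    have h3 := hα a (left_mem_Icc.2 hab.le) _ hm
    have h4 := hα _ hm b (right_mem_Icc.2 hab.le)
    rw [ha, abs_of_nonpos (by linarith)] at h3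
    rw [hb, abs_of_nonpos (by linarith)] at h4
    refine ⟨α (a + t), by rw [h3]; ring, by rw [h4, h2]; ring, fun h5 h6 => ?_⟩
    exact hsep _ (by linarith) (by linarith)

theorem side (hT : IsRealTree T) (x z : T) (t : ℝ) (h0 : 0 ≤ t) (h1 : t ≤ dist x z) :
    ∃ c, dist x c = t ∧ dist c z = dist x z - t ∧
      ∀ w, dist w x = dist w c + t ∨ dist w z = dist w c + (dist x z - t) := by
  obtain ⟨c, hc1, hc2, hc3⟩ := between hT x z t h0 h1
  refine ⟨c, hc1, hc2, fun w => ?_⟩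
  rcases h0.eq_or_lt with h0 | h0
  · have : x = c := by rw [← dist_eq_zero, hc1, h0]
    left; rw [this, ← h0, add_zero]
  rcases h1.eq_or_lt with h1 | h1
  · have : c = z := by rw [← dist_eq_zero, hc2, h1, sub_self]
    right; rw [this, h1]; ring
  have hxc : x ≠ c := by rw [← dist_pos, hc1]; exact h0
  have hzc : z ≠ c := by rw [ne_comm, ← dist_pos, hc2]; linarith
  rcases eq_or_ne w c with rfl | hwc
  · left; rw [dist_comm, hc1]; simp
  by_cases hh : connectedComponentIn ({c}ᶜ) x = connectedComponentIn ({c}ᶜ) w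
  · right
    rw [← hc2]
    exact through hT hzc hwc (by rw [← hh]; exact (hc3 h0 h1).symm)
  · left
    rw [← hc1, dist_comm x c]
    exact through hT hxc hwc hh

theorem four_point (hT : IsRealTree T) (o y x z : T) :
    dist o y + dist x z ≤ max (dist o x + dist y z) (dist o z + dist x y) := by
  obtain ⟨c, hc1, hc2, hc3⟩ := side hT x z ((dist x o + dist x z - dist o z) / 2)
    (by have := dist_triangle o x z; rw [dist_comm o x] at this; linarith)
    (by have := dist_triangle x z o; rw [dist_comm z o] at this; linarith)
  have ho := hc3 o
  rw [dist_comm o x] at *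
  have ho1 : dist x o = dist o c + ((dist x o + dist x z - dist o z) / 2) := by
    rcases ho with h | h <;> linarith
  have htri := dist_triangle o c y
  rw [dist_comm c y] at htri
  rcases hc3 y with h | h
  · apply le_max_of_le_right
    rw [dist_comm x y]
    linarith
  · apply le_max_of_le_left
    linarith

/-- Gromov product -/
def gp (o x y : T) : ℝ := (dist o x + dist o y - dist x y) / 2

theorem gp_ultra (hT : IsRealTree T) (o x y z : T) : min (gp o x y) (gp o y z) ≤ gp o x z := by
  have := four_point hT o y x z
  unfold gp
  rcases le_max_iff.1 this with h | h
  · apply min_le_of_right_le; linarith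
  · apply min_le_of_left_le; linarith

theorem isOpen_comp (hT : IsRealTree T) (c x : T) :
    IsOpen (connectedComponentIn ({c}ᶜ) x) := by
  rw [Metric.isOpen_iff]
  intro w hw
  have hwc : w ≠ c := connectedComponentIn_subset _ _ hw
  refine ⟨dist w c, dist_pos.2 hwc, fun v hv => ?_⟩
  have hvc : v ≠ c := by
    rintro rfl
    rw [mem_ball, dist_comm] at hv
    exact lt_irrefl _ hv
  rw [connectedComponentIn_eq hw]
  by_contra hcon
  have hne : connectedComponentIn ({c}ᶜ) w ≠ connectedComponentIn ({c}ᶜ) v := by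
    intro h
    exact hcon (h ▸ mem_connectedComponentIn (show v ∈ ({c}ᶜ : Set T) from hvc))
  have h1 := through hT hwc hvc hne
  rw [mem_ball] at hv
  have := dist_nonneg (x := v) (y := c)
  rw [dist_comm c w] at h1
  linarith

theorem separable (D : LongDendron) : TopologicalSpace.SeparableSpace D.carrier := by
  have hT := D.isRealTree
  have := D.isProb
  obtain ⟨o⟩ := hT.1
  let S : ℝ → Set D.carrier := fun t => {x | dist o x = t ∧ o ≠ x ∧ ∃ y, y ≠ x ∧
    connectedComponentIn ({x}ᶜ) o ≠ connectedComponentIn ({x}ᶜ) y}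
  have hS : ∀ t, (S t).Countable := by
    intro t
    have hex : ∀ x : S t, ∃ y, y ≠ x.1 ∧
      connectedComponentIn ({x.1}ᶜ) o ≠ connectedComponentIn ({x.1}ᶜ) y := fun x => x.2.2.2
    choose y hy1 hy2 using hex
    let A : S t → Set (D.carrier × ℝ≥0) := fun x =>
      connectedComponentIn ({x.1}ᶜ) (y x) ×ˢ univ
    have hA : ∀ x, MeasurableSet (A x) := fun x =>
      ((isOpen_comp hT _ _).measurableSet).prod MeasurableSet.univ
    have hdist : ∀ x : S t, ∀ w ∈ connectedComponentIn ({x.1}ᶜ) (y x),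
        dist w o = dist w x.1 + t := by
      intro x w hw
      have h1 := through hT (c := x.1) (x := o) (w := w) x.2.2.1
        (connectedComponentIn_subset _ _ hw)
        (by rw [← connectedComponentIn_eq hw]; exact hy2 x)
      rw [h1, dist_comm x.1 o, x.2.1]
    have hdisj : Pairwise (Function.onFun Disjoint A) := by
      intro x x' hxx
      rw [Function.onFun, Set.disjoint_left]
      rintro ⟨w, s⟩ ⟨hw, -⟩ ⟨hw', -⟩
      apply hxx
      apply Subtype.ext
      rw [← dist_eq_zero]
      apply le_antisymm _ dist_nonneg
      have e1 := hdist x w hw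
      have e2 := hdist x' w hw'
      have e3 := four_point hT o w x.1 x'.1
      have e4 := x.2.1
      have e5 := x'.2.1
      rw [dist_comm o w, e4, e5, dist_comm x.1 w] at e3
      rcases le_max_iff.1 e3 with h | h <;> linarith
    have hc := Measure.countable_meas_pos_of_disjoint_iUnion (μ := D.ν) hA hdisj
    have hall : {i | 0 < D.ν (A i)} = univ := by
      ext x
      simp only [mem_ofPred_eq, mem_univ, iff_true]
      exact D.branch_pos _ ⟨x.1, y x, hy1 x, rfl⟩
    rw [hall] at hc
    exact Set.countable_coe_iff.1 (Set.countable_univ_iff.1 hc)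
  refine ⟨insert o (⋃ q : ℚ, S (q : ℝ)), (Set.countable_iUnion fun q : ℚ => hS (q : ℝ)).insert o, ?_⟩
  rw [Metric.dense_iff]
  intro y r hr
  rcases eq_or_ne o y with rfl | hoy
  · exact ⟨o, mem_ball_self hr, mem_insert _ _⟩
  have hpos := dist_pos.2 hoy
  obtain ⟨q, hq1, hq2⟩ := exists_rat_btwn (show max 0 (dist o y - r) < dist o y from
    max_lt hpos (by linarith))
  rw [max_lt_iff] at hq1
  obtain ⟨c, hc1, hc2, hc3⟩ := between hT o y q hq1.1.le hq2.le
  refine ⟨c, ?_, mem_insert_of_mem _ (mem_iUnion.2 ⟨q, hc1, ?_, y, ?_, hc3 hq1.1 hq2⟩)⟩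
  · rw [mem_ball, hc2]; linarith
  · rw [← dist_pos, hc1]; exact hq1.1
  · rw [ne_comm, ← dist_pos, hc2]; linarith
end RT


theorem nat_tree (k N : ℕ) (hk : 0 < k) (H : Fin k → ℕ) (γ : Fin k → Fin k → ℕ)
    (hs : ∀ i j, γ i j = γ j i) (hle : ∀ i j, γ i j ≤ H i)
    (hu : ∀ i l j, min (γ i l) (γ l j) ≤ γ i j) (hN : ∀ i, H i ≤ N)
    (hd : ∀ i j, i ≠ j → H i + H j ≤ N + 2 * γ i j + 2) :
    ∃ (V : Type) (_ : Fintype V) (G : SimpleGraph V) (blk : V → Option (Fin k)) (m : ℕ),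
      G.IsTree ∧ 1 < Fintype.card V ∧ graphDiam G = N + 4 ∧
      (∀ i j u v, i ≠ j → blk u = some i → blk v = some j →
        G.dist u v + 2 * γ i j = H i + H j + 2) ∧
      (∀ i, Nat.card {v // blk v = some i} = m) ∧
      Nat.card {v // blk v = none} * k ≤ m := by
  classical
  let m := (k + 1) * (N + 5) * k
  have hm : 0 < m := by positivity
  let Hm := Finset.univ.sup H + 1
  have hHm : ∀ i, H i + 1 ≤ Hm := fun i =>
    Nat.succ_le_succ (Finset.le_sup (f := H) (Finset.mem_univ i))
  have hHmN : Hm ≤ N + 1 := Nat.succ_le_succ (Finset.sup_le fun i _ => hN i)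
  obtain ⟨i0, hi0⟩ : ∃ i, Hm = H i + 1 := by
    obtain ⟨i, -, hi⟩ := Finset.exists_mem_eq_sup (Finset.univ : Finset (Fin k))
      ⟨⟨0, hk⟩, Finset.mem_univ _⟩ H
    exact ⟨i, by simp only [Hm, hi]⟩
  let L := N + 4 - Hm
  have hL : L + Hm = N + 4 := by simp only [L]; omega
  let I := Option (Fin k × Fin m)
  let h : I → ℕ := fun x => match x with
    | none => L
    | some p => H p.1 + 1
  let g : I → I → ℕ := fun x y => match x, y with
    | none, none => L
    | none, some _ => 0
    | some _, none => 0
    | some p, some q => if p.1 = q.1 then (if p.2 = q.2 then H p.1 + 1 else H p.1) else γ p.1 q.1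
  have gs : ∀ i j, g i j = g j i := by
    rintro (_ | ⟨i, a⟩) (_ | ⟨j, b⟩) <;> simp only [g]
    by_cases hij : i = j
    · subst hij
      simp only [if_true, eq_comm]
    · rw [if_neg hij, if_neg (Ne.symm hij), hs]
  have gd : ∀ i, g i i = h i := by
    rintro (_ | ⟨i, a⟩) <;> simp [g, h]
  have gle : ∀ i j, g i j ≤ h i := by
    rintro (_ | ⟨i, a⟩) (_ | ⟨j, b⟩) <;> simp only [g, h] <;> try omega
    have := hle i j
    split_ifs <;> omega
  have gu : ∀ i l j, min (g i l) (g l j) ≤ g i j := by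
    rintro (_ | ⟨i, a⟩) (_ | ⟨l, c⟩) (_ | ⟨j, b⟩) <;> simp only [g] <;> try omega
    have e1 := hu i l j
    have e2 := hle i l
    by_cases h1 : i = j
    · subst h1
      by_cases h2 : i = l
      · subst h2
        simp only [if_true]
        by_cases h3 : a = c
        · subst h3; split_ifs <;> omega
        · rw [if_neg h3]; split_ifs <;> omega
      · rw [if_neg h2]; simp only [if_true]; split_ifs <;> omega
    · rw [if_neg h1]
      by_cases h2 : i = l
      · subst h2; rw [if_neg h1]; omega
      · by_cases h3 : l = j
        · subst h3; rw [if_neg h2]; omega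
        · rw [if_neg h2, if_neg h3]; omega
  obtain ⟨V, _, G, f, hG, hf, hdist⟩ := FT.exists_tree h g gs gd gle gu
  have feq : ∀ i j s, s ≤ h i → s ≤ h j → s ≤ g i j → f i s = f j s := by
    intro i j s h1 h2 h3
    rw [← hG.connected.dist_eq_zero_iff, hdist _ _ _ _ h1 h2]
    simp only [FT.dd]; omega
  have feq' : ∀ i j s t, s ≤ h i → t ≤ h j → f i s = f j t → s = t ∧ s ≤ g i j := by
    intro i j s t h1 h2 h3
    rw [← hG.connected.dist_eq_zero_iff, hdist _ _ _ _ h1 h2] at h3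
    simp only [FT.dd] at h3; omega
  let lf : Fin k → Fin m → V := fun i a => f (some (i, a)) (H i + 1)
  have lf_inj : ∀ i a j b, lf i a = lf j b → i = j ∧ a = b := by
    intro i a j b hab
    have := feq' (some (i, a)) (some (j, b)) (H i + 1) (H j + 1) le_rfl le_rfl hab
    have e1 := hle i j
    simp only [g] at this
    by_cases hij : i = j
    · refine ⟨hij, ?_⟩
      by_contra hne
      rw [if_pos hij, if_neg hne] at this
      omega
    · rw [if_neg hij] at this; omega
  let blk : V → Option (Fin k) := fun v =>
    if hv : ∃ i, ∃ a, v = lf i a then some hv.choose else none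
  have blk_lf : ∀ i a, blk (lf i a) = some i := by
    intro i a
    have hv : ∃ i', ∃ a', lf i a = lf i' a' := ⟨i, a, rfl⟩
    simp only [blk]
    rw [dif_pos hv]
    obtain ⟨a', ha'⟩ := hv.choose_spec
    exact congrArg some (lf_inj _ _ _ _ ha').1.symm
  have blk_some : ∀ v i, blk v = some i → ∃ a, v = lf i a := by
    intro v i hvi
    by_cases hv : ∃ i, ∃ a, v = lf i a
    · obtain ⟨j, a, rfl⟩ := hv
      rw [blk_lf] at hvi
      obtain rfl := Option.some.inj hvi
      exact ⟨a, rfl⟩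
    · simp only [blk] at hvi
      rw [dif_neg hv] at hvi
      cases hvi
  have blk_none : ∀ v, blk v = none → ∀ i a, v ≠ lf i a := by
    rintro v hv i a rfl
    rw [blk_lf] at hv
    cases hv
  have hdiam : graphDiam G = N + 4 := by
    apply le_antisymm
    · apply Finset.sup_le
      rintro ⟨u, v⟩ -
      obtain ⟨i, s, hs1, rfl⟩ := hf u
      obtain ⟨j, t, ht1, rfl⟩ := hf v
      simp only
      rw [hdist _ _ _ _ hs1 ht1]
      rcases i with _ | ⟨i, a⟩ <;> rcases j with _ | ⟨j, b⟩ <;> simp only [h, g, FT.dd] at *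
      · omega
      · have := hHm j; omega
      · have := hHm i; omega
      · have := hHm i
        have := hHm j
        have := hN i
        by_cases hij : i = j
        · rw [if_pos hij]; subst hij; split_ifs <;> omega
        · rw [if_neg hij]; have := hd i j hij; omega
    · have h1 := hdist none (some (i0, ⟨0, hm⟩)) L (H i0 + 1) le_rfl le_rfl
      have h2 : N + 4 = G.dist (f none L) (f (some (i0, ⟨0, hm⟩)) (H i0 + 1)) := by
        rw [h1]; simp only [FT.dd, g]; omega
      rw [h2]
      exact Finset.le_sup (f := fun p : V × V => G.dist p.1 p.2)
        (Finset.mem_univ (f none L, f (some (i0, ⟨0, hm⟩)) (H i0 + 1)))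
  refine ⟨V, _, G, blk, m, hG, ?_, hdiam, ?_, ?_, ?_⟩
  · by_contra hcard
    have hsub : Subsingleton V := Fintype.card_le_one_iff_subsingleton.1 (by omega)
    have : graphDiam G = 0 := by
      apply Nat.le_zero.1
      apply Finset.sup_le
      rintro ⟨u, v⟩ -
      rw [Subsingleton.elim u v]
      simp
    omega
  · intro i j u v hij hu' hv'
    obtain ⟨a, rfl⟩ := blk_some u i hu'
    obtain ⟨b, rfl⟩ := blk_some v j hv'
    have h1 := hdist (some (i, a)) (some (j, b)) (H i + 1) (H j + 1) le_rfl le_rfl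
    simp only [lf]
    rw [h1]
    have e1 := hle i j
    have e2 := hle j i
    have e3 := hs i j
    simp only [FT.dd, g]
    rw [if_neg hij]
    omega
  · intro i
    let F : Fin m → {v // blk v = some i} := fun a => ⟨lf i a, blk_lf i a⟩
    have hF : Function.Bijective F := by
      constructor
      · intro a b hab
        exact (lf_inj _ _ _ _ (congrArg Subtype.val hab)).2
      · rintro ⟨v, hv⟩
        obtain ⟨a, rfl⟩ := blk_some v i hv
        exact ⟨a, rfl⟩
    rw [← Nat.card_eq_of_bijective F hF, Nat.card_fin]
  · have hex : ∀ v : {v // blk v = none}, ∃ p : Option (Fin k) × Fin (N + 5),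
        v.1 = f (p.1.map fun i => (i, (⟨0, hm⟩ : Fin m))) p.2 := by
      rintro ⟨v, hv⟩
      obtain ⟨i, t, ht, rfl⟩ := hf v
      rcases i with _ | ⟨i, a⟩
      · have : t < N + 5 := by simp only [h] at ht; omega
        exact ⟨(none, ⟨t, this⟩), rfl⟩
      · have h1 : t ≠ H i + 1 := by
          rintro rfl
          exact blk_none _ hv i a rfl
        have h2 : t ≤ H i := by simp only [h] at ht; omega
        have h3 := hN i
        refine ⟨(some i, ⟨t, by omega⟩), ?_⟩
        refine feq _ _ _ ht ?_ ?_
        · simp only [h, Option.map]; omega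
        · simp only [g, Option.map, if_true]; split_ifs <;> omega
    choose F hF using hex
    have hinj : Function.Injective F := by
      intro v w hvw
      apply Subtype.ext
      rw [hF v, hF w, hvw]
    have h1 := Nat.card_le_card_of_injective F hinj
    have h2 : Nat.card (Option (Fin k) × Fin (N + 5)) = (k + 1) * (N + 5) := by
      simp
    rw [h2] at h1
    exact Nat.mul_le_mul_right k h1

theorem tree_for_points (D : LongDendron) (n : ℕ) (x : Fin (n + 1) → D.carrier × ℝ≥0)
    (hx : ∀ i j, D.dD (x i) (x j) ≤ 1) :
    ∃ (V : Type) (_ : Fintype V) (G : SimpleGraph V) (blk : V → Option (Fin (n + 1))) (m : ℕ),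
      G.IsTree ∧ 1 < Fintype.card V ∧
      (∀ i j u v, i ≠ j → blk u = some i → blk v = some j →
        |treeDist G u v - D.dD (x i) (x j)| ≤ 8 / ((n : ℝ) + 1)) ∧
      (∀ i, Nat.card {v // blk v = some i} = m) ∧
      Nat.card {v // blk v = none} * (n + 1) ≤ m := by
  have hT := D.isRealTree
  set o := (x 0).1 with ho
  obtain ⟨N, hNdef⟩ : ∃ N : ℕ, N = n + 1 := ⟨_, rfl⟩
  have hNpos : (0 : ℝ) < N := by rw [hNdef]; positivity
  have hgp0 : ∀ i j, 0 ≤ RT.gp o (x i).1 (x j).1 := by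
    intro i j
    have := dist_triangle (x i).1 o (x j).1
    rw [dist_comm (x i).1 o] at this
    unfold RT.gp
    linarith
  have hgps : ∀ i j, RT.gp o (x i).1 (x j).1 = RT.gp o (x j).1 (x i).1 := by
    intro i j
    unfold RT.gp
    rw [dist_comm (x i).1 (x j).1]; ring
  have hgple : ∀ i j, RT.gp o (x i).1 (x j).1 ≤ dist o (x i).1 := by
    intro i j
    have := dist_triangle o (x i).1 (x j).1
    unfold RT.gp
    linarith
  have hH1 : ∀ i, dist o (x i).1 + ((x i).2 : ℝ) ≤ 1 := by
    intro i
    have := hx 0 i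
    unfold LongDendron.dD at this
    have h2 : (0 : ℝ) ≤ (x 0).2 := NNReal.coe_nonneg _
    linarith
  have hdD : ∀ i j, D.dD (x i) (x j) = (dist o (x i).1 + ((x i).2 : ℝ)) +
      (dist o (x j).1 + ((x j).2 : ℝ)) - 2 * RT.gp o (x i).1 (x j).1 := by
    intro i j
    unfold LongDendron.dD RT.gp; ring
  let H : Fin (n + 1) → ℕ := fun i => ⌊(N : ℝ) * (dist o (x i).1 + ((x i).2 : ℝ))⌋₊
  let γ : Fin (n + 1) → Fin (n + 1) → ℕ := fun i j => ⌊(N : ℝ) * RT.gp o (x i).1 (x j).1⌋₊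
  have hHlo : ∀ i, (H i : ℝ) ≤ N * (dist o (x i).1 + ((x i).2 : ℝ)) := fun i =>
    Nat.floor_le (by positivity)
  have hHhi : ∀ i, N * (dist o (x i).1 + ((x i).2 : ℝ)) < H i + 1 := fun i =>
    Nat.lt_floor_add_one _
  have hγlo : ∀ i j, (γ i j : ℝ) ≤ N * RT.gp o (x i).1 (x j).1 := fun i j =>
    Nat.floor_le (mul_nonneg hNpos.le (hgp0 i j))
  have hγhi : ∀ i j, N * RT.gp o (x i).1 (x j).1 < γ i j + 1 := fun i j =>
    Nat.lt_floor_add_one _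
  have hmulD : ∀ i j, N * D.dD (x i) (x j) = N * (dist o (x i).1 + ((x i).2 : ℝ)) +
      N * (dist o (x j).1 + ((x j).2 : ℝ)) - 2 * (N * RT.gp o (x i).1 (x j).1) := by
    intro i j; rw [hdD]; ring
  have hND : ∀ i j, N * D.dD (x i) (x j) ≤ N := fun i j => by
    have := mul_le_mul_of_nonneg_left (hx i j) hNpos.le
    linarith
  obtain ⟨V, iV, G, blk, m, hG, hcard, hdiam, hdist, hc1, hc2⟩ :=
    nat_tree (n + 1) N (Nat.succ_pos n) H γ
      (fun i j => by simp only [γ]; rw [hgps])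
      (fun i j => by
        apply Nat.floor_mono
        apply mul_le_mul_of_nonneg_left _ hNpos.le
        have := hgple i j
        have h2 : (0 : ℝ) ≤ (x i).2 := NNReal.coe_nonneg _
        linarith)
      (fun i l j => by
        have hmono : Monotone fun t : ℝ => ⌊(N : ℝ) * t⌋₊ := fun s t hst =>
          Nat.floor_mono (mul_le_mul_of_nonneg_left hst hNpos.le)
        have := hmono (RT.gp_ultra hT o (x i).1 (x l).1 (x j).1)
        have h2 := hmono.map_min (a := RT.gp o (x i).1 (x l).1) (b := RT.gp o (x l).1 (x j).1)
        exact h2.symm.le.trans this)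
      (fun i => by
        have := hHlo i
        have h2 := mul_le_mul_of_nonneg_left (hH1 i) hNpos.le
        have h3 : (H i : ℝ) ≤ N := by linarith
        exact_mod_cast h3)
      (fun i j _ => by
        have h1 : ((H i + H j : ℕ) : ℝ) ≤ ((N + 2 * γ i j + 2 : ℕ) : ℝ) := by
          push_cast
          have := hHlo i
          have := hHlo j
          have := hγhi i j
          have := hND i j
          have := hmulD i j
          linarith
        exact_mod_cast h1)
  refine ⟨V, iV, G, blk, m, hG, hcard, ?_, hc1, hc2⟩
  intro i j u v hij hu hv
  have h1 := hdist i j u v hij hu hv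
  have h2 : (G.dist u v : ℝ) = H i + H j + 2 - 2 * γ i j := by
    have : ((G.dist u v + 2 * γ i j : ℕ) : ℝ) = ((H i + H j + 2 : ℕ) : ℝ) := by rw [h1]
    push_cast at this
    linarith
  unfold treeDist
  rw [hdiam]
  have hd0 : 0 ≤ D.dD (x i) (x j) := by unfold LongDendron.dD; positivity
  have hd1 := hx i j
  have hN1 : ((n : ℝ) + 1) = N := by rw [hNdef]; push_cast; ring
  rw [hN1]
  have e1 := hHlo i
  have e2 := hHlo j
  have e3 := hHhi i
  have e4 := hHhi j
  have e5 := hγlo i j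
  have e6 := hγhi i j
  have e7 := hmulD i j
  have hpos4 : (0 : ℝ) < ((N + 4 : ℕ) : ℝ) := by positivity
  have h3 : (G.dist u v : ℝ) / ((N + 4 : ℕ) : ℝ) - D.dD (x i) (x j) =
      ((G.dist u v : ℝ) - N * D.dD (x i) (x j) - 4 * D.dD (x i) (x j)) / ((N + 4 : ℕ) : ℝ) := by
    field_simp
    push_cast
    ring
  rw [h3, abs_div, abs_of_pos hpos4]
  apply div_le_div₀ (by norm_num) _ hNpos (by push_cast; linarith)
  rw [abs_le]
  constructor <;> linarith


theorem exists_seq {A : Type} [MeasurableSpace A] (ν : Measure A) [IsProbabilityMeasure ν]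
    (S : Set (Set A)) (hS : S.Countable) (hSm : ∀ s ∈ S, MeasurableSet s)
    (Q : A → Prop) (hQ : ∀ᵐ x ∂ν, Q x) :
    ∃ ω : ℕ → A, (∀ i, Q (ω i)) ∧ ∀ s ∈ S, Tendsto (fun n : ℕ =>
      (∑ i ∈ Finset.range n, s.indicator (fun _ => (1 : ℝ)) (ω i)) / n) atTop (𝓝 (ν.real s)) := by
  let P : Measure (ℕ → A) := Measure.infinitePi fun _ => ν
  have hmp : ∀ i, MeasurePreserving (fun ω : ℕ → A => ω i) P ν := fun i =>
    measurePreserving_eval_infinitePi (fun _ => ν) i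
  have h1 : ∀ᵐ ω ∂P, ∀ i, Q (ω i) := by
    rw [ae_all_iff]
    intro i
    exact (hmp i).quasiMeasurePreserving.ae hQ
  have h2 : ∀ᵐ ω ∂P, ∀ s ∈ S, Tendsto (fun n : ℕ =>
      (∑ i ∈ Finset.range n, s.indicator (fun _ => (1 : ℝ)) (ω i)) / n)
      atTop (𝓝 (ν.real s)) := by
    rw [ae_ball_iff hS]
    intro s hs
    have hsm := hSm s hs
    have hmeas : Measurable (s.indicator fun _ => (1 : ℝ)) := measurable_const.indicator hsm
    have hind : ProbabilityTheory.iIndepFun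
        (fun (i : ℕ) (ω : ℕ → A) => s.indicator (fun _ => (1 : ℝ)) (ω i)) P :=
      ProbabilityTheory.iIndepFun_infinitePi
        (X := fun _ => s.indicator fun _ => (1 : ℝ)) (fun _ => hmeas)
    have hident : ∀ i, ProbabilityTheory.IdentDistrib
        (fun ω : ℕ → A => s.indicator (fun _ => (1 : ℝ)) (ω i))
        (fun ω : ℕ → A => s.indicator (fun _ => (1 : ℝ)) (ω 0)) P P := by
      intro i
      have : ProbabilityTheory.IdentDistrib (fun ω : ℕ → A => ω i) (fun ω : ℕ → A => ω 0) P P :=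
        ⟨(hmp i).aemeasurable, (hmp 0).aemeasurable, by rw [(hmp i).map_eq, (hmp 0).map_eq]⟩
      exact this.comp hmeas
    have hint : Integrable (fun ω : ℕ → A => s.indicator (fun _ => (1 : ℝ)) (ω 0)) P := by
      have : Integrable (s.indicator fun _ => (1 : ℝ)) ν := (integrable_const 1).indicator hsm
      exact (hmp 0).integrable_comp_of_integrable this
    have := ProbabilityTheory.strong_law_ae_real
      (fun (i : ℕ) (ω : ℕ → A) => s.indicator (fun _ => (1 : ℝ)) (ω i)) hint
      (fun i j hij => hind.indepFun hij) hident
    have hE : ∫ ω, s.indicator (fun _ => (1 : ℝ)) (ω 0) ∂P = ν.real s := by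
      have e1 := integral_map (μ := P) (φ := fun ω : ℕ → A => ω 0) (hmp 0).aemeasurable
        (f := s.indicator fun _ => (1 : ℝ)) hmeas.aestronglyMeasurable
      rw [(hmp 0).map_eq] at e1
      rw [← e1, integral_indicator hsm]
      simp
    rw [hE] at this
    exact this
  obtain ⟨ω, h3, h4⟩ := (h1.and h2).exists
  exact ⟨ω, h3, h4⟩

theorem stepC {V : Type} [MeasurableSpace V] [DiscreteMeasurableSpace V] [Finite V]
    (P : Measure V) [IsProbabilityMeasure P] (k : ℕ) (hk : 0 < k) (blk : V → Option (Fin k))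
    (e e' : V → V → ℝ) (δ : ℝ) (hδ : 0 ≤ δ)
    (h : ∀ i j u v, i ≠ j → blk u = some i → blk v = some j → |e u v - e' u v| ≤ δ)
    (hnone : P.real {v | blk v = none} ≤ 1 / k)
    (hsome : ∀ i, P.real {v | blk v = some i} ≤ 1 / k) (r : ℕ)
    (f : (Fin r → Fin r → ℝ) → ℝ) (C : ℝ) (hC : ∀ x y, dist (f x) (f y) ≤ C) (L : ℝ≥0)
    (hL : LipschitzWith L f) :
    |∫ v, f (rho e r v) ∂(Measure.pi fun _ : Fin r => P) -
      ∫ v, f (rho e' r v) ∂(Measure.pi fun _ : Fin r => P)| ≤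
      L * δ + C * (r * r * (3 / k)) := by
  classical
  have hk' : (0 : ℝ) < k := by exact_mod_cast hk
  have hC0 : 0 ≤ C := by have := hC 0 0; rwa [dist_self] at this
  set M : Measure (Fin r → V) := Measure.pi fun _ : Fin r => P with hM
  let bad : V → V → Prop := fun u v => blk u = none ∨ blk v = none ∨
    ∃ b, blk u = some b ∧ blk v = some b
  let B : Fin r → Fin r → Set (Fin r → V) := fun i j => {v | i ≠ j ∧ bad (v i) (v j)}
  have hmp : ∀ i, MeasurePreserving (fun v : Fin r → V => v i) M P := fun i =>
    measurePreserving_eval (fun _ => P) i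
  have hev : ∀ (i : Fin r) (s : Set V), M.real {v | v i ∈ s} = P.real s := by
    intro i s
    exact congrArg ENNReal.toReal ((hmp i).measure_preimage (MeasurableSet.of_discrete).nullMeasurableSet)
  have hB : ∀ i j, M.real (B i j) ≤ 3 / k := by
    intro i j
    by_cases hij : i = j
    · have : B i j = ∅ := by
        ext v; simp [B, hij]
      rw [this]; simp; positivity
    have hsub : B i j ⊆ ({v | v i ∈ {u | blk u = none}} ∪ {v | v j ∈ {u | blk u = none}}) ∪
        ⋃ b : Fin k, ({v | v i ∈ {u | blk u = some b}} ∩ {v | v j ∈ {u | blk u = some b}}) := by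
      rintro v ⟨-, h1 | h1 | ⟨b, h1, h2⟩⟩
      · exact Or.inl (Or.inl h1)
      · exact Or.inl (Or.inr h1)
      · exact Or.inr (mem_iUnion.2 ⟨b, h1, h2⟩)
    have hind : ProbabilityTheory.IndepFun (fun v : Fin r → V => v i) (fun v => v j) M :=
      (ProbabilityTheory.iIndepFun_pi (μ := fun _ : Fin r => P) (X := fun _ v => v)
        (fun _ => aemeasurable_id)).indepFun hij
    have hinter : ∀ b : Fin k, M.real ({v | v i ∈ {u | blk u = some b}} ∩
        {v | v j ∈ {u | blk u = some b}}) ≤ 1 / k * (1 / k) := by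
      intro b
      have := hind.measure_inter_preimage_eq_mul {u | blk u = some b} {u | blk u = some b}
        MeasurableSet.of_discrete MeasurableSet.of_discrete
      have e1 : M.real ({v | v i ∈ {u | blk u = some b}} ∩ {v | v j ∈ {u | blk u = some b}}) =
          M.real {v | v i ∈ {u | blk u = some b}} * M.real {v | v j ∈ {u | blk u = some b}} := by
        have e2 := congrArg ENNReal.toReal this
        rw [ENNReal.toReal_mul] at e2
        exact e2
      rw [e1, hev, hev]
      exact mul_le_mul (hsome b) (hsome b) measureReal_nonneg (by positivity)
    calc M.real (B i j) ≤ _ := measureReal_mono hsub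
      _ ≤ (M.real {v | v i ∈ {u | blk u = none}} + M.real {v | v j ∈ {u | blk u = none}}) +
          ∑ b : Fin k, M.real ({v | v i ∈ {u | blk u = some b}} ∩
            {v | v j ∈ {u | blk u = some b}}) :=
        (measureReal_union_le _ _).trans
          (add_le_add (measureReal_union_le _ _) (measureReal_iUnion_fintype_le _))
      _ ≤ (1 / k + 1 / k) + ∑ b : Fin k, 1 / (k : ℝ) * (1 / k) := by
        rw [hev, hev]
        exact add_le_add (add_le_add hnone hnone) (Finset.sum_le_sum fun b _ => hinter b)
      _ = 3 / k := by
        rw [Finset.sum_const, Finset.card_univ, Fintype.card_fin, nsmul_eq_mul]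
        field_simp
        norm_num
  have hpt : ∀ v, ‖f (rho e r v) - f (rho e' r v)‖ ≤
      L * δ + C * ∑ i, ∑ j, (B i j).indicator (fun _ => (1 : ℝ)) v := by
    intro v
    have hnn : ∀ i j, 0 ≤ (B i j).indicator (fun _ => (1 : ℝ)) v := fun i j =>
      indicator_nonneg (fun _ _ => zero_le_one) _
    by_cases hbad : ∃ i j, v ∈ B i j
    · obtain ⟨i, j, hv⟩ := hbad
      have h1 : (1 : ℝ) ≤ ∑ i, ∑ j, (B i j).indicator (fun _ => (1 : ℝ)) v := by
        calc (1 : ℝ) = (B i j).indicator (fun _ => (1 : ℝ)) v := by rw [indicator_of_mem hv]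
          _ ≤ ∑ j, (B i j).indicator (fun _ => (1 : ℝ)) v :=
            Finset.single_le_sum (f := fun j => (B i j).indicator (fun _ => (1 : ℝ)) v)
              (fun j _ => hnn i j) (Finset.mem_univ j)
          _ ≤ _ := Finset.single_le_sum
              (f := fun i => ∑ j, (B i j).indicator (fun _ => (1 : ℝ)) v)
              (fun i _ => Finset.sum_nonneg fun j _ => hnn i j) (Finset.mem_univ i)
      have h2 := hC (rho e r v) (rho e' r v)
      rw [dist_eq_norm] at h2
      have h3 : 0 ≤ L * δ := mul_nonneg L.2 hδ
      nlinarith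
    · push Not at hbad
      have h1 : dist (rho e r v) (rho e' r v) ≤ δ := by
        rw [dist_pi_le_iff hδ]
        intro i
        rw [dist_pi_le_iff hδ]
        intro j
        rw [Real.dist_eq]
        unfold rho
        by_cases hij : i = j
        · simp [hij, hδ]
        · rw [if_neg hij, if_neg hij]
          have hb : ¬ bad (v i) (v j) := fun hb => hbad i j ⟨hij, hb⟩
          simp only [bad] at hb
          push Not at hb
          obtain ⟨a, ha⟩ := Option.ne_none_iff_exists'.1 hb.1
          obtain ⟨b, hb'⟩ := Option.ne_none_iff_exists'.1 hb.2.1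
          refine h a b _ _ ?_ ha hb'
          rintro rfl
          exact hb.2.2 a ha hb'
      have h2 := hL.dist_le_mul (rho e r v) (rho e' r v)
      rw [dist_eq_norm] at h2
      have h3 : (L : ℝ) * dist (rho e r v) (rho e' r v) ≤ L * δ :=
        mul_le_mul_of_nonneg_left h1 L.2
      have h4 : 0 ≤ ∑ i, ∑ j, (B i j).indicator (fun _ => (1 : ℝ)) v :=
        Finset.sum_nonneg fun i _ => Finset.sum_nonneg fun j _ => hnn i j
      have h5 := mul_nonneg hC0 h4
      linarith
  rw [← integral_sub (Integrable.of_finite) (Integrable.of_finite), ← Real.norm_eq_abs]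
  refine (norm_integral_le_of_norm_le (Integrable.of_finite) (ae_of_all _ hpt)).trans ?_
  rw [integral_add (Integrable.of_finite) (Integrable.of_finite), integral_const, integral_const_mul C,
    integral_finsetSum _ (fun i _ => Integrable.of_finite)]
  simp only [probReal_univ, one_smul]
  gcongr
  calc ∑ i, ∫ v, ∑ j, (B i j).indicator (fun _ => (1 : ℝ)) v ∂M
      = ∑ i, ∑ j, M.real (B i j) := by
        refine Finset.sum_congr rfl fun i _ => ?_
        rw [integral_finsetSum _ (fun i _ => Integrable.of_finite)]
        refine Finset.sum_congr rfl fun j _ => ?_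
        rw [integral_indicator MeasurableSet.of_discrete]
        simp
    _ ≤ ∑ i : Fin r, ∑ j : Fin r, 3 / (k : ℝ) :=
        Finset.sum_le_sum fun i _ => Finset.sum_le_sum fun j _ => hB i j
    _ = r * r * (3 / k) := by simp; ring


/-- Uniform measure on a finite type, with the discrete sigma-algebra. -/
def unif (V : Type) [Fintype V] : @Measure V ⊤ :=
  (Fintype.card V : ℝ≥0∞)⁻¹ • @MeasureTheory.Measure.count V ⊤

theorem unif_real (V : Type) [Fintype V] (s : Set V) :
    (@unif V _).real s = (Nat.card s : ℝ) / Fintype.card V := by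
  letI : MeasurableSpace V := ⊤
  classical
  unfold unif Measure.real
  rw [Measure.smul_apply, Measure.count_apply MeasurableSet.of_discrete, smul_eq_mul,
    ENNReal.toReal_mul, ENNReal.toReal_inv, ENNReal.toReal_natCast]
  rw [div_eq_inv_mul]
  congr 1
  rw [Set.encard, ENat.card_eq_coe_natCard]
  simp

theorem unif_prob (V : Type) [Fintype V] (h : 0 < Fintype.card V) :
    IsProbabilityMeasure (unif V) := by
  letI : MeasurableSpace V := ⊤
  constructor
  unfold unif
  rw [Measure.smul_apply, Measure.count_apply MeasurableSet.of_discrete, smul_eq_mul]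
  rw [Set.encard_univ, ENat.card_eq_coe_fintype_card]
  simp only [ENat.toENNReal_coe]
  exact ENNReal.inv_mul_cancel (by exact_mod_cast h.ne') (ENNReal.natCast_ne_top _)

theorem sum_blk {V : Type} [Fintype V] (n m : ℕ) (blk : V → Option (Fin (n+1)))
    (hsome : ∀ i, Nat.card {v // blk v = some i} = m) (g : Option (Fin (n+1)) → ℝ) :
    ∑ v, g (blk v) = (Nat.card {v // blk v = none} : ℝ) * g none + m * ∑ i, g (some i) := by
  classical
  rw [← Finset.sum_fiberwise Finset.univ blk]
  rw [Fintype.sum_option]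
  have key : ∀ o, ∑ v with blk v = o, g (blk v) = (Nat.card {v // blk v = o} : ℝ) * g o := by
    intro o
    rw [Finset.sum_congr rfl (g := fun _ => g o) (fun v hv => by rw [(Finset.mem_filter.1 hv).2])]
    rw [Finset.sum_const, nsmul_eq_mul, Nat.card_eq_fintype_card, Fintype.card_subtype]
  rw [key, Finset.mul_sum]
  congr 1
  refine Finset.sum_congr rfl fun i _ => ?_
  rw [key, hsome]

theorem kappa_est {V A : Type} [Fintype V] (n m : ℕ) (blk : V → Option (Fin (n+1)))
    (hsome : ∀ i, Nat.card {v // blk v = some i} = m)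
    (hnone : Nat.card {v // blk v = none} * (n+1) ≤ m) (hc : 1 < Fintype.card V) :
    (unif V).real {v | blk v = none} ≤ 1 / ((n + 1 : ℕ) : ℝ) ∧
    (∀ i, (unif V).real {v | blk v = some i} ≤ 1 / ((n + 1 : ℕ) : ℝ)) ∧
    ∀ (ω : ℕ → A) (s : Set A),
      |(unif V).real {v | (blk v).elim (ω 0) (fun i => ω i) ∈ s} -
        (∑ i ∈ Finset.range (n+1), s.indicator (fun _ => (1 : ℝ)) (ω i)) / ((n + 1 : ℕ) : ℝ)|
        ≤ 1 / ((n + 1 : ℕ) : ℝ) := by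
  classical
  have hN := sum_blk n m blk hsome (fun _ => 1)
  simp only [Finset.sum_const, Finset.card_univ, nsmul_eq_mul, mul_one, Fintype.card_fin] at hN
  set c := Nat.card {v // blk v = none} with hcdef
  set K : ℝ := ((n + 1 : ℕ) : ℝ) with hK
  have hK1 : 1 ≤ K := by rw [hK]; exact_mod_cast Nat.le_add_left 1 n
  have hK0 : 0 < K := by linarith
  have hc1 : (c : ℝ) * K ≤ m := by rw [hK]; exact_mod_cast hnone
  have hc0 : (0 : ℝ) ≤ c := Nat.cast_nonneg _
  have hNpos : (0 : ℝ) < Fintype.card V := by exact_mod_cast (by omega : 0 < Fintype.card V)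
  have hm0 : (0 : ℝ) ≤ m := Nat.cast_nonneg _
  have hcN : (c : ℝ) * K ≤ Fintype.card V := by rw [hN]; nlinarith
  refine ⟨?_, ?_, ?_⟩
  · rw [unif_real, div_le_div_iff₀ hNpos hK0, one_mul]
    exact hcN
  · intro i
    rw [unif_real, div_le_div_iff₀ hNpos hK0, one_mul]
    have : Nat.card {v | blk v = some i} = m := hsome i
    rw [this, hN]
    linarith
  · intro ω s
    rw [unif_real]
    have h1 := sum_blk n m blk hsome
      (fun o => s.indicator (fun _ => (1 : ℝ)) (o.elim (ω 0) (fun i => ω i)))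
    have h2 : (Nat.card {v | (blk v).elim (ω 0) (fun i => ω i) ∈ s} : ℝ) =
        ∑ v, s.indicator (fun _ => (1 : ℝ)) ((blk v).elim (ω 0) (fun i => ω i)) := by
      simp only [Set.indicator_apply]
      rw [Finset.sum_boole]
      rw [Nat.card_eq_fintype_card, ← Set.toFinset_card]
      congr 2
      ext; simp
    rw [h2, h1, Finset.sum_range]
    simp only [Option.elim]
    set t := s.indicator (fun _ => (1 : ℝ)) (ω 0)
    set Sg := ∑ i : Fin (n+1), s.indicator (fun _ => (1 : ℝ)) (ω i)
    have hi : ∀ a, 0 ≤ s.indicator (fun _ => (1 : ℝ)) a ∧ s.indicator (fun _ => (1 : ℝ)) a ≤ 1 := by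
      intro a
      rw [Set.indicator_apply]
      split_ifs <;> norm_num
    have ht := hi (ω 0)
    have hS0 : 0 ≤ Sg := Finset.sum_nonneg fun i _ => (hi _).1
    have hS1 : Sg ≤ K := by
      calc Sg ≤ ∑ i : Fin (n+1), (1 : ℝ) := Finset.sum_le_sum fun i _ => (hi _).2
        _ = K := by simp [hK]
    have e : (↑c * t + ↑m * Sg) / (Fintype.card V : ℝ) - Sg / K =
        c * (t * K - Sg) / (Fintype.card V * K) := by
      rw [div_sub_div _ _ hNpos.ne' hK0.ne']
      congr 1
      rw [hN]; ring
    rw [e, abs_div, abs_of_pos (mul_pos hNpos hK0), div_le_div_iff₀ (mul_pos hNpos hK0) hK0,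
      abs_mul, abs_of_nonneg hc0, one_mul]
    have h3 : |t * K - Sg| ≤ K := by
      rw [abs_le]; constructor <;> nlinarith [ht.1, ht.2]
    calc (c : ℝ) * |t * K - Sg| * K ≤ c * K * K := by gcongr
      _ ≤ _ := by gcongr


theorem dD_continuous (D : LongDendron) :
    Continuous fun p : (D.carrier × ℝ≥0) × (D.carrier × ℝ≥0) => D.dD p.1 p.2 := by
  unfold LongDendron.dD
  fun_prop

theorem rho_continuous (D : LongDendron) (r : ℕ) : Continuous (rho D.dD r) := by
  unfold rho
  refine continuous_pi fun i => continuous_pi fun j => ?_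
  by_cases h : i = j
  · simp only [h, if_true]; exact continuous_const
  · simp only [h, if_false]
    have h2 : Continuous fun x : Fin r → D.carrier × ℝ≥0 => (x i, x j) :=
      (continuous_apply i).prodMk (continuous_apply j)
    exact (dD_continuous D).comp h2

theorem support_le (D : LongDendron) (hD : D.IsDendron) (x y : D.carrier × ℝ≥0)
    (hx : x ∈ D.ν.support) (hy : y ∈ D.ν.support) : D.dD x y ≤ 1 := by
  haveI := D.isProb
  by_contra hlt
  push Not at hlt
  have hopen : IsOpen {p : (D.carrier × ℝ≥0) × (D.carrier × ℝ≥0) | 1 < D.dD p.1 p.2} :=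
    isOpen_lt continuous_const (dD_continuous D)
  obtain ⟨U, hU, W, hW, hUW⟩ := mem_nhds_prod_iff.1 (hopen.mem_nhds (show (x, y) ∈ _ from hlt))
  have h1 := (Measure.mem_support_iff_forall x).1 hx U hU
  have h2 := (Measure.mem_support_iff_forall y).1 hy W hW
  have h3 : (D.ν.prod D.ν) (U ×ˢ W) = 0 := measure_mono_null hUW hD
  rw [Measure.prod_prod] at h3
  rcases mul_eq_zero.1 h3 with h | h
  · exact h1.ne' h
  · exact h2.ne' h

theorem final (D : LongDendron) (hD : D.IsDendron) :
    ∃ (V : ℕ → Type) (instF : ∀ n, Fintype (V n)) (G : ∀ n, SimpleGraph (V n)),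
      (∀ n, (G n).IsTree ∧ 1 < @Fintype.card (V n) (instF n)) ∧
      ∀ r : ℕ, 1 ≤ r →
        WeakTendsto (fun n => @treeSamp (V n) (instF n) (G n) r) (D.samp r) := by
  haveI := RT.separable D
  haveI := D.isProb
  haveI : SecondCountableTopology D.carrier := UniformSpace.secondCountable_of_separable _
  let S : Set (Set (D.carrier × ℝ≥0)) :=
    (fun F => ⋂₀ F) '' {F | F.Finite ∧ F ⊆ TopologicalSpace.countableBasis (D.carrier × ℝ≥0)}
  have hScount : S.Countable :=
    (Set.countable_ofPred_finite_subset (TopologicalSpace.countable_countableBasis _)).image _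
  have hSopen : ∀ s ∈ S, IsOpen s := by
    rintro _ ⟨F, ⟨hF, hF2⟩, rfl⟩
    exact hF.isOpen_sInter fun t ht => TopologicalSpace.isOpen_of_mem_countableBasis (hF2 ht)
  have hSpi : IsPiSystem S := by
    rintro _ ⟨F, ⟨hF, hF2⟩, rfl⟩ _ ⟨F', ⟨hF', hF2'⟩, rfl⟩ -
    exact ⟨F ∪ F', ⟨hF.union hF', union_subset hF2 hF2'⟩, sInter_union _ _⟩
  have hSm : ∀ s ∈ S, MeasurableSet s := fun s hs => (hSopen s hs).measurableSet
  have hSn : ∀ u : Set (D.carrier × ℝ≥0), IsOpen u → ∀ x ∈ u, ∃ s ∈ S, s ∈ 𝓝 x ∧ s ⊆ u := by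
    intro u hu x hx
    obtain ⟨s, hs, hxs, hsu⟩ :=
      (TopologicalSpace.isBasis_countableBasis _).exists_subset_of_mem_open hx hu
    exact ⟨s, ⟨{s}, ⟨finite_singleton s, by simpa using hs⟩, sInter_singleton s⟩,
      (TopologicalSpace.isOpen_of_mem_countableBasis hs).mem_nhds hxs, hsu⟩
  obtain ⟨ω, hω, hωS⟩ := exists_seq D.ν S hScount hSm (fun x => x ∈ D.ν.support)
    Measure.support_mem_ae
  have htree := fun n => tree_for_points D n (fun i => ω i)
    (fun i j => support_le D hD _ _ (hω i) (hω j))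
  choose V instF G blk m hT hcard hdist hsome hnone using htree
  refine ⟨V, instF, G, fun n => ⟨hT n, hcard n⟩, fun r _ => ?_⟩
  letI : ∀ n, MeasurableSpace (V n) := fun n => ⊤
  haveI : ∀ n, DiscreteMeasurableSpace (V n) := fun n => ⟨fun _ => trivial⟩
  haveI hP : ∀ n, IsProbabilityMeasure (unif (V n)) := fun n =>
    unif_prob (V n) (by have := hcard n; omega)
  have hest := fun n => kappa_est (A := D.carrier × ℝ≥0) n (m n) (blk n) (hsome n) (hnone n) (hcard n)
  let φ : ∀ n, V n → D.carrier × ℝ≥0 := fun n v => (blk n v).elim (ω 0) (fun i => ω i)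
  have hφ : ∀ n, Measurable (φ n) := fun n => Measurable.of_discrete
  let κ : ℕ → ProbabilityMeasure (D.carrier × ℝ≥0) := fun n =>
    ProbabilityMeasure.map (⟨unif (V n), hP n⟩ : ProbabilityMeasure (V n)) (hφ n).aemeasurable
  let νp : ProbabilityMeasure (D.carrier × ℝ≥0) := ⟨D.ν, D.isProb⟩
  have hinv : Tendsto (fun n : ℕ => 1 / ((n + 1 : ℕ) : ℝ)) atTop (𝓝 0) := by
    have := tendsto_one_div_add_atTop_nhds_zero_nat (𝕜 := ℝ)
    simpa using this
  have hκ : Tendsto κ atTop (𝓝 νp) := by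
    refine hSpi.tendsto_probabilityMeasure_of_tendsto_of_mem hSm hSn fun s hs => ?_
    rw [← NNReal.tendsto_coe]
    have h1 := (tendsto_add_atTop_iff_nat 1).2 (hωS s hs)
    have h2 : Tendsto (fun n : ℕ => (unif (V n)).real {v | φ n v ∈ s} -
        (∑ i ∈ Finset.range (n+1), s.indicator (fun _ => (1 : ℝ)) (ω i)) / ((n + 1 : ℕ) : ℝ))
        atTop (𝓝 0) :=
      squeeze_zero_norm (fun n => (hest n).2.2 ω s) hinv
    have h3 := h2.add h1
    simp only [sub_add_cancel, zero_add] at h3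
    refine h3.congr fun n => ?_
    change _ = ((unif (V n)).map (φ n)).real s
    rw [map_measureReal_apply (hφ n) (hSm s hs)]
    rfl
  have hpi : Tendsto (fun n => ProbabilityMeasure.pi fun _ : Fin r => κ n) atTop
      (𝓝 (ProbabilityMeasure.pi fun _ : Fin r => νp)) :=
    (ProbabilityMeasure.continuous_pi.tendsto (fun _ : Fin r => νp)).comp
      (tendsto_pi_nhds.2 fun _ => hκ)
  have hmap := ProbabilityMeasure.tendsto_map_of_tendsto_of_continuous _ _ hpi (rho_continuous D r)
  have hrm : ∀ n, Measurable (rho (treeDist (G n)) r) := fun n => Measurable.of_discrete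
  let τ : ℕ → ProbabilityMeasure (Fin r → Fin r → ℝ) := fun n =>
    (ProbabilityMeasure.pi fun _ : Fin r => (⟨unif (V n), hP n⟩ : ProbabilityMeasure (V n))).map
      (hrm n).aemeasurable
  let σ : ProbabilityMeasure (Fin r → Fin r → ℝ) :=
    (ProbabilityMeasure.pi fun _ : Fin r => νp).map (rho_continuous D r).measurable.aemeasurable
  have hτ : Tendsto τ atTop (𝓝 σ) := by
    rw [tendsto_iff_forall_lipschitz_integral_tendsto] at hmap ⊢
    intro f hC hL
    have h1 := hmap f hC hL
    obtain ⟨C, hC⟩ := hC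
    obtain ⟨L, hL⟩ := hL
    have hfm : Measurable f := hL.continuous.measurable
    have e1 : ∀ n, ∫ x, f x ∂(τ n : Measure (Fin r → Fin r → ℝ)) =
        ∫ v, f (rho (treeDist (G n)) r v) ∂(Measure.pi fun _ : Fin r => unif (V n)) := fun n =>
      integral_map (hrm n).aemeasurable hfm.aestronglyMeasurable
    have e2 : ∀ n, ∫ x, f x ∂(((ProbabilityMeasure.pi fun _ : Fin r => κ n).map
          (rho_continuous D r).measurable.aemeasurable : ProbabilityMeasure _) :
            Measure (Fin r → Fin r → ℝ)) =
        ∫ v, f (rho (fun u v => D.dD (φ n u) (φ n v)) r v)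
          ∂(Measure.pi fun _ : Fin r => unif (V n)) := by
      intro n
      have e3 : ∫ x, f x ∂(((ProbabilityMeasure.pi fun _ : Fin r => κ n).map
          (rho_continuous D r).measurable.aemeasurable : ProbabilityMeasure _) :
            Measure (Fin r → Fin r → ℝ)) = ∫ y, f (rho D.dD r y)
          ∂(Measure.pi fun _ : Fin r => (unif (V n)).map (φ n)) :=
        integral_map (rho_continuous D r).measurable.aemeasurable hfm.aestronglyMeasurable
      haveI : IsProbabilityMeasure ((unif (V n)).map (φ n)) :=
        Measure.isProbabilityMeasure_map (hφ n).aemeasurable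
      rw [e3, ← Measure.pi_map_pi (fun _ => (hφ n).aemeasurable)]
      exact integral_map Measurable.of_discrete.aemeasurable
          (hfm.comp (rho_continuous D r).measurable).aestronglyMeasurable
    have h2 : Tendsto (fun n => (∫ x, f x ∂(τ n : Measure (Fin r → Fin r → ℝ))) -
        ∫ x, f x ∂(((ProbabilityMeasure.pi fun _ : Fin r => κ n).map
          (rho_continuous D r).measurable.aemeasurable : ProbabilityMeasure _) :
            Measure (Fin r → Fin r → ℝ))) atTop (𝓝 0) := by
      have hb : Tendsto (fun n : ℕ => L * (8 * (1 / ((n + 1 : ℕ) : ℝ))) +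
          C * (r * r * (3 * (1 / ((n + 1 : ℕ) : ℝ))))) atTop (𝓝 0) := by
        have := ((hinv.const_mul 8).const_mul (L : ℝ)).add
          (((hinv.const_mul 3).const_mul ((r : ℝ) * r)).const_mul C)
        simpa using this
      refine squeeze_zero_norm (fun n => ?_) hb
      rw [e1, e2, Real.norm_eq_abs]
      have := stepC (unif (V n)) (n+1) (Nat.succ_pos n) (blk n) (treeDist (G n))
        (fun u v => D.dD (φ n u) (φ n v)) (8 / ((n : ℝ) + 1)) (by positivity)
        (fun i j u v hij hu hv => by
          have := hdist n i j u v hij hu hv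
          simp only [φ, hu, hv, Option.elim]
          exact this) (hest n).1 (hest n).2.1 r f C hC L hL
      refine this.trans (le_of_eq ?_)
      push_cast
      ring
    have h3 := h2.add h1
    simp only [sub_add_cancel, zero_add] at h3
    exact h3
  intro g
  exact (ProbabilityMeasure.tendsto_iff_forall_integral_tendsto.1 hτ) g

/-- **Theorem 2 (Elek–Tardos).** Every dendron is the sampling limit of a convergent
sequence of nontrivial finite trees. -/
theorem statement1 (D : LongDendron) (hD : D.IsDendron) :
    ∃ (V : ℕ → Type) (instF : ∀ n, Fintype (V n)) (G : ∀ n, SimpleGraph (V n)),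
      (∀ n, (G n).IsTree ∧ 1 < @Fintype.card (V n) (instF n)) ∧
      ∀ r : ℕ, 1 ≤ r →
        WeakTendsto (fun n => @treeSamp (V n) (instF n) (G n) r) (D.samp r) := by
  exact final D hD

end
end

section
/- If two long dendrons D=(T,d,ν) and D'=(T',d',ν') satisfy τ_r(D)=τ_r(D') for every integer r ≥ 1, then D and D' are isomorphic: there exists a bijective isometry f from (T,d) onto (T',d') such that the map f' : A_D → A_{D'} defined by f'(p,a)=(f(p),a) pushes ν forward to ν'. -/
open scoped NNReal ENNReal

open MeasureTheory Metric Filter Topology Set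
open scoped NNReal ENNReal

noncomputable section

section TreePart

variable {T : Type*} [MetricSpace T]

lemma rt_arc (hT : IsRealTree T) (p q : T) (hpq : p ≠ q) :
    ∃ α : ℝ → T, (∀ s ∈ Set.Icc 0 (dist p q), ∀ t ∈ Set.Icc 0 (dist p q),
      dist (α s) (α t) = |s - t|) ∧ α 0 = p ∧ α (dist p q) = q ∧
      ∀ c : ℝ, 0 < c → c < dist p q →
        connectedComponentIn ({α c}ᶜ) p ≠ connectedComponentIn ({α c}ᶜ) q := by
  obtain ⟨a, b, hab, α, h1, h2, h3, h4⟩ := hT.2.2 p q hpq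
  have hd : dist p q = b - a := by
    rw [← h2, ← h3, h1 a ⟨le_rfl, hab.le⟩ b ⟨hab.le, le_rfl⟩, abs_sub_comm, abs_of_pos (by linarith)]
  refine ⟨fun t => α (a + t), ?_, by simpa using h2, by simp [hd, h3], ?_⟩
  · intro s hs t ht
    rw [hd] at hs ht
    rw [h1 _ ⟨by linarith [hs.1], by linarith [hs.2]⟩ _ ⟨by linarith [ht.1], by linarith [ht.2]⟩]
    congr 1; ring
  · intro c hc hc'
    rw [hd] at hc'
    exact h4 _ (by linarith) (by linarith)

lemma rt_seg (hT : IsRealTree T) (p q : T) :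
    ∃ S : Set T, IsPreconnected S ∧ p ∈ S ∧ q ∈ S ∧ ∀ x ∈ S, dist p x + dist x q = dist p q := by
  by_cases hpq : p = q
  · subst hpq
    exact ⟨{p}, isPreconnected_singleton, rfl, rfl, by simp⟩
  obtain ⟨α, h1, h2, h3, -⟩ := rt_arc hT p q hpq
  have h0 : (0:ℝ) ∈ Set.Icc 0 (dist p q) := ⟨le_rfl, dist_nonneg⟩
  have h0' : dist p q ∈ Set.Icc 0 (dist p q) := ⟨dist_nonneg, le_rfl⟩
  have hc : ContinuousOn α (Set.Icc 0 (dist p q)) := by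
    have : LipschitzOnWith 1 α (Set.Icc 0 (dist p q)) := by
      apply LipschitzOnWith.of_dist_le_mul
      intro x hx y hy
      rw [h1 x hx y hy]; simp [Real.dist_eq]
    exact this.continuousOn
  refine ⟨α '' Set.Icc 0 (dist p q), isPreconnected_Icc.image _ hc, ⟨0, h0, h2⟩, ⟨_, h0', h3⟩, ?_⟩
  rintro x ⟨t, ht, rfl⟩
  have e1 := h1 0 h0 t ht
  have e2 := h1 t ht _ h0'
  rw [h2] at e1
  rw [h3] at e2
  rw [e1, e2, abs_of_nonpos (by linarith [ht.1]), abs_of_nonpos (by linarith [ht.2])]; ring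

lemma rt_F1 (hT : IsRealTree T) (p q : T) (t : ℝ) (h0 : 0 ≤ t) (ht : t ≤ dist p q) :
    ∃ x, dist p x = t ∧ dist x q = dist p q - t := by
  by_cases hpq : p = q
  · subst hpq
    have : t = 0 := le_antisymm (by simpa using ht) h0
    exact ⟨p, by simp [this], by simp [this]⟩
  obtain ⟨α, h1, h2, h3, -⟩ := rt_arc hT p q hpq
  have hh0 : (0:ℝ) ∈ Set.Icc 0 (dist p q) := ⟨le_rfl, dist_nonneg⟩
  have h0' : dist p q ∈ Set.Icc 0 (dist p q) := ⟨dist_nonneg, le_rfl⟩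
  have e1 := h1 0 hh0 t ⟨h0, ht⟩
  have e2 := h1 t ⟨h0, ht⟩ _ h0'
  rw [h2] at e1
  rw [h3] at e2
  exact ⟨α t, by rw [e1, abs_of_nonpos (by linarith)]; ring,
    by rw [e2, abs_of_nonpos (by linarith)]; ring⟩

lemma rt_comp (hT : IsRealTree T) (w p x : T) (h : dist w p + dist p x ≠ dist w x) :
    connectedComponentIn ({p}ᶜ) w = connectedComponentIn ({p}ᶜ) x := by
  obtain ⟨S, hS, hw, hx, hb⟩ := rt_seg hT w x
  have hsub : S ⊆ {p}ᶜ := by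
    intro y hy hyp
    rw [mem_singleton_iff] at hyp
    subst hyp
    exact h (hb _ hy)
  exact connectedComponentIn_eq (hS.subset_connectedComponentIn hw hsub hx)

lemma rt_sep (hT : IsRealTree T) (u p v : T) (h : dist u p + dist p v = dist u v)
    (hu : u ≠ p) (hv : v ≠ p) :
    connectedComponentIn ({p}ᶜ) u ≠ connectedComponentIn ({p}ᶜ) v := by
  have hup : 0 < dist u p := dist_pos.2 hu
  have hvp : 0 < dist p v := dist_pos.2 hv.symm
  have huv : u ≠ v := dist_pos.1 (by linarith)
  obtain ⟨α, h1, h2, h3, h4⟩ := rt_arc hT u v huv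
  have hh0 : (0:ℝ) ∈ Set.Icc 0 (dist u v) := ⟨le_rfl, dist_nonneg⟩
  have h0' : dist u v ∈ Set.Icc 0 (dist u v) := ⟨dist_nonneg, le_rfl⟩
  have ht : dist u p ∈ Set.Icc 0 (dist u v) := ⟨hup.le, by linarith⟩
  have e1 := h1 0 hh0 _ ht
  have e2 := h1 _ ht _ h0'
  rw [h2, abs_of_nonpos (by linarith)] at e1
  rw [h3, abs_of_nonpos (by linarith)] at e2
  have key := h4 _ hup (by linarith)
  have : α (dist u p) = p := by
    by_contra hne
    have hpos := dist_pos.2 hne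
    apply key
    rw [rt_comp hT u (α (dist u p)) p, rt_comp hT p (α (dist u p)) v]
    · rw [dist_comm p]; intro h'; linarith
    · intro h'; linarith
  rwa [this] at key

lemma rt_F2 (hT : IsRealTree T) (u p v w : T) (h : dist u p + dist p v = dist u v) :
    dist u p + dist p w = dist u w ∨ dist v p + dist p w = dist v w := by
  by_cases hu : u = p
  · subst hu; left; simp
  by_cases hv : v = p
  · subst hv; right; simp
  by_contra hc
  push Not at hc
  exact rt_sep hT u p v h hu hv ((rt_comp hT _ _ _ hc.1).trans (rt_comp hT _ _ _ hc.2).symm)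

lemma rt_open (hT : IsRealTree T) (p x : T) : IsOpen (connectedComponentIn ({p}ᶜ) x) := by
  rw [Metric.isOpen_iff]
  intro w hw
  have hwp : w ≠ p := connectedComponentIn_subset _ _ hw
  refine ⟨dist w p, dist_pos.2 hwp, fun z hz => ?_⟩
  rw [mem_ball] at hz
  have hzp : z ≠ p := by rintro rfl; rw [dist_comm] at hz; exact lt_irrefl _ hz
  rw [connectedComponentIn_eq hw, ← rt_comp hT z p w]
  · exact mem_connectedComponentIn hzp
  · intro h'
    have := dist_pos.2 hzp
    rw [dist_comm w p] at hz
    linarith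

/-- hull of a sequence is dense -/
lemma rt_hull (hT : IsRealTree T) (u : ℕ → T)
    (hu : ∀ B : Set T, IsBranch B → ∃ i, u i ∈ B) (p : T) (ε : ℝ) (hε : 0 < ε) :
    ∃ q i j, dist p q < ε ∧ dist (u i) q + dist q (u j) = dist (u i) (u j) := by
  by_cases h0 : p = u 0
  · exact ⟨u 0, 0, 0, by simpa [h0] using hε, by simp⟩
  have hpos := dist_pos.2 h0
  obtain ⟨q, h1, h2⟩ := rt_F1 hT p (u 0) (min (ε / 2) (dist p (u 0) / 2)) (by positivity)
    ((min_le_right _ _).trans (by linarith))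
  have hm1 := min_le_left (ε / 2) (dist p (u 0) / 2)
  have hm2 := min_le_right (ε / 2) (dist p (u 0) / 2)
  have hm3 : 0 < min (ε / 2) (dist p (u 0) / 2) := by positivity
  have hpq : p ≠ q := dist_pos.1 (by linarith)
  have huq : u 0 ≠ q := (dist_pos.1 (by linarith : 0 < dist q (u 0))).symm
  have hs := rt_sep hT p q (u 0) (by linarith) hpq huq
  obtain ⟨i, hi⟩ := hu _ ⟨q, p, hpq, rfl⟩
  obtain ⟨j, hj⟩ := hu _ ⟨q, u 0, huq, rfl⟩
  refine ⟨q, i, j, by linarith, ?_⟩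
  by_contra hc
  apply hs
  rw [connectedComponentIn_eq hi, connectedComponentIn_eq hj]
  exact rt_comp hT _ _ _ hc

lemma rt_L (hT : IsRealTree T) (u : ℕ → T)
    (hu : ∀ B : Set T, IsBranch B → ∃ i, u i ∈ B) (p q : T) (ε : ℝ) (hε : 0 < ε) :
    ∃ k, dist p q ≤ dist q (u k) - dist p (u k) + ε := by
  obtain ⟨x, i, j, h1, h2⟩ := rt_hull hT u hu p (ε / 2) (by linarith)
  rcases rt_F2 hT _ _ _ q h2 with h | h
  · refine ⟨i, ?_⟩
    have a1 := dist_triangle p x q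
    have a2 := dist_triangle p x (u i)
    rw [dist_comm q, dist_comm x (u i)] at *
    linarith
  · refine ⟨j, ?_⟩
    have a1 := dist_triangle p x q
    have a2 := dist_triangle p x (u j)
    rw [dist_comm q, dist_comm x (u j)] at *
    linarith

variable {T' : Type*} [MetricSpace T']

lemma rt_F2max (hT : IsRealTree T) (u p v w : T) (h : dist u p + dist p v = dist u v) :
    dist p w = max (dist u w - dist u p) (dist v w - dist v p) := by
  have a1 := dist_triangle u p w
  have a2 := dist_triangle v p w
  apply le_antisymm
  · rcases rt_F2 hT u p v w h with h | h
    · exact le_max_of_le_left (by linarith)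
    · exact le_max_of_le_right (by linarith)
  · exact max_le (by linarith) (by linarith)

lemma rt_point (hT : IsRealTree T) (hT' : IsRealTree T') (u : ℕ → T) (u' : ℕ → T')
    (hd : ∀ i j, dist (u i) (u j) = dist (u' i) (u' j))
    (hu : ∀ B : Set T, IsBranch B → ∃ i, u i ∈ B)
    (p : T) : ∃ p' : T', ∀ k, dist p (u k) = dist p' (u' k) := by
  have hex : ∀ n : ℕ, ∃ q i j, dist p q < 1 / ((n:ℝ) + 1) ∧
      dist (u i) q + dist q (u j) = dist (u i) (u j) :=
    fun n => rt_hull hT u hu p _ (by positivity)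
  choose q i j hq hb using hex
  have hex' : ∀ n, ∃ x : T', dist (u' (i n)) x = dist (u (i n)) (q n) ∧
      dist x (u' (j n)) = dist (q n) (u (j n)) := by
    intro n
    obtain ⟨x, h1, h2⟩ := rt_F1 hT' (u' (i n)) (u' (j n)) (dist (u (i n)) (q n)) dist_nonneg
      (by rw [← hd, ← hb n]; linarith [dist_nonneg (x := q n) (y := u (j n))])
    exact ⟨x, h1, by rw [h2, ← hd, ← hb n]; ring⟩
  choose x hx1 hx2 using hex'
  have hbx : ∀ n, dist (u' (i n)) (x n) + dist (x n) (u' (j n)) = dist (u' (i n)) (u' (j n)) := by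
    intro n; rw [hx1, hx2, ← hd, hb]
  have hk : ∀ n k, dist (x n) (u' k) = dist (q n) (u k) := by
    intro n k
    rw [rt_F2max hT _ _ _ (u k) (hb n), rt_F2max hT' _ _ _ (u' k) (hbx n), hx1,
      dist_comm (u' (j n)) (x n), hx2, dist_comm (q n) (u (j n)), hd, hd]
  have hqq : ∀ n m, dist (x n) (x m) = dist (q n) (q m) := by
    intro n m
    rw [rt_F2max hT _ _ _ (q m) (hb n), rt_F2max hT' _ _ _ (x m) (hbx n), hx1,
      dist_comm (u' (j n)) (x n), hx2, dist_comm (q n) (u (j n)), dist_comm _ (x m),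
      dist_comm _ (x m), hk, hk, dist_comm (q m), dist_comm (q m)]
  have hqt : Tendsto q atTop (𝓝 p) := by
    rw [tendsto_iff_dist_tendsto_zero]
    refine squeeze_zero (fun _ => dist_nonneg) (fun n => ?_) tendsto_one_div_add_atTop_nhds_zero_nat
    rw [dist_comm]; exact (hq n).le
  have hc : CauchySeq x := by
    have := hqt.cauchySeq
    rw [Metric.cauchySeq_iff] at this ⊢
    simpa only [hqq] using this
  have := hT'.2.1
  obtain ⟨p', hp'⟩ := cauchySeq_tendsto_of_complete hc
  refine ⟨p', fun k => ?_⟩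
  have t1 : Tendsto (fun n => dist (q n) (u k)) atTop (𝓝 (dist p (u k))) :=
    hqt.dist tendsto_const_nhds
  have t2 : Tendsto (fun n => dist (x n) (u' k)) atTop (𝓝 (dist p' (u' k))) :=
    hp'.dist tendsto_const_nhds
  simp only [hk] at t2
  exact tendsto_nhds_unique t1 t2

lemma rt_eq (hT : IsRealTree T) (u : ℕ → T)
    (hu : ∀ B : Set T, IsBranch B → ∃ i, u i ∈ B) (p q : T)
    (h : ∀ k, dist p (u k) = dist q (u k)) : p = q := by
  apply dist_le_zero.1
  apply le_of_forall_pos_le_add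
  intro ε hε
  obtain ⟨k, hk⟩ := rt_L hT u hu p q ε hε
  rw [h k] at hk
  linarith

lemma rt_iso (hT : IsRealTree T) (hT' : IsRealTree T') (u : ℕ → T) (u' : ℕ → T')
    (hd : ∀ i j, dist (u i) (u j) = dist (u' i) (u' j))
    (hu : ∀ B : Set T, IsBranch B → ∃ i, u i ∈ B)
    (hu' : ∀ B : Set T', IsBranch B → ∃ i, u' i ∈ B) :
    ∃ f : T → T', Isometry f ∧ Function.Bijective f ∧ ∀ i, f (u i) = u' i := by
  choose f hf using rt_point hT hT' u u' hd hu
  choose g hg using rt_point hT' hT u' u (fun i j => (hd i j).symm) hu'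
  have hle : ∀ p q, dist p q ≤ dist (f p) (f q) := by
    intro p q
    apply le_of_forall_pos_le_add
    intro ε hε
    obtain ⟨k, hk⟩ := rt_L hT u hu p q ε hε
    rw [hf, hf] at hk
    have := dist_triangle (f q) (f p) (u' k)
    rw [dist_comm (f q) (f p)] at this
    linarith
  have hge : ∀ p q, dist (f p) (f q) ≤ dist p q := by
    intro p q
    apply le_of_forall_pos_le_add
    intro ε hε
    obtain ⟨k, hk⟩ := rt_L hT' u' hu' (f p) (f q) ε hε
    rw [← hf, ← hf] at hk
    have := dist_triangle q p (u k)
    rw [dist_comm q p] at this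
    linarith
  have hiso : Isometry f := Isometry.of_dist_eq fun p q => le_antisymm (hge p q) (hle p q)
  refine ⟨f, hiso, ⟨hiso.injective, fun y => ⟨g y, ?_⟩⟩, fun i => ?_⟩
  · exact rt_eq hT' u' hu' _ _ fun k => by rw [← hf, ← hg]
  · exact rt_eq hT' u' hu' _ _ fun k => by rw [← hf, hd]

lemma rt_countable [MeasurableSpace T] [BorelSpace T] (hT : IsRealTree T)
    (ν : Measure (T × ℝ≥0)) [IsProbabilityMeasure ν]
    (hB : ∀ B : Set T, IsBranch B → 0 < ν (B ×ˢ Set.univ)) (o : T) (t : ℝ) :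
    {p : T | dist o p = t ∧ ∃ x, x ≠ p ∧ dist o p + dist p x = dist o x}.Countable := by
  set S := {p : T | dist o p = t ∧ ∃ x, x ≠ p ∧ dist o p + dist p x = dist o x}
  have hex : ∀ p : S, ∃ x : T, x ≠ p ∧ dist o (p:T) + dist (p:T) x = dist o x := fun p => p.2.2
  choose x hx hb using hex
  let B : S → Set (T × ℝ≥0) := fun p => connectedComponentIn ({(p:T)}ᶜ) (x p) ×ˢ Set.univ
  have hpos : ∀ p, 0 < ν (B p) := fun p => hB _ ⟨p, x p, hx p, rfl⟩
  have hop : ∀ p, MeasurableSet (B p) := fun p =>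
    ((rt_open hT _ _).prod isOpen_univ).measurableSet
  have hbw : ∀ (p : S) w, w ∈ connectedComponentIn ({(p:T)}ᶜ) (x p) →
      dist o (p:T) + dist (p:T) w = dist o w := by
    intro p w hw
    by_cases hop : o = p
    · rw [hop]; simp
    by_contra hc
    exact rt_sep hT _ _ _ (hb p) hop (hx p)
      ((rt_comp hT _ _ _ hc).trans (connectedComponentIn_eq hw).symm)
  have hdis : Pairwise (Function.onFun Disjoint B) := by
    intro p q hpq
    rw [Function.onFun, Set.disjoint_left]
    rintro ⟨w, a⟩ ⟨hw, -⟩ ⟨hw', -⟩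
    apply hpq
    have h1 := hbw p w hw
    have h2 := hbw q w hw'
    have hpt := p.2.1
    have hqt := q.2.1
    apply Subtype.ext
    apply dist_le_zero.1
    rcases rt_F2 hT _ _ _ (q:T) h1 with h | h
    · linarith
    · rw [dist_comm w, dist_comm w] at h
      linarith
  have := Measure.countable_meas_pos_of_disjoint_iUnion (μ := ν) hop hdis
  have hu : {i | 0 < ν (B i)} = Set.univ := Set.eq_univ_of_forall hpos
  rw [hu, Set.countable_univ_iff] at this
  exact Set.countable_coe_iff.1 this

lemma rt_separable [MeasurableSpace T] [BorelSpace T] (hT : IsRealTree T)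
    (ν : Measure (T × ℝ≥0)) [IsProbabilityMeasure ν]
    (hB : ∀ B : Set T, IsBranch B → 0 < ν (B ×ˢ Set.univ)) :
    TopologicalSpace.SeparableSpace T := by
  obtain ⟨o⟩ := hT.1
  refine ⟨insert o (⋃ t : ℚ, {p : T | dist o p = t ∧ ∃ x, x ≠ p ∧ dist o p + dist p x = dist o x}),
    (Set.countable_iUnion fun t : ℚ => rt_countable hT ν hB o (t : ℝ)).insert _, ?_⟩
  rw [Metric.dense_iff]
  intro x ε hε
  by_cases hxo : x = o
  · exact ⟨o, by simpa [hxo] using hε, by simp⟩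
  have hpos : 0 < dist o x := dist_pos.2 (Ne.symm hxo)
  obtain ⟨t, h1, h2⟩ := exists_rat_btwn (show max 0 (dist o x - ε) < dist o x by
    apply max_lt <;> linarith)
  have h3 := (le_max_left _ _).trans_lt h1
  have h4 := (le_max_right _ _).trans_lt h1
  obtain ⟨p, hp1, hp2⟩ := rt_F1 hT o x t h3.le h2.le
  refine ⟨p, by rw [mem_ball]; linarith, Or.inr ?_⟩
  rw [mem_iUnion]
  exact ⟨t, hp1, x, (dist_pos.1 (by linarith : 0 < dist p x)).symm, by linarith⟩

end TreePart

section ProbPart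

variable {A : Type*} [MeasurableSpace A]

lemma emp_isProb (x : ℕ → A) (n : ℕ) :
    IsProbabilityMeasure ((((n + 1 : ℕ) : ℝ≥0∞)⁻¹) •
      ∑ i ∈ Finset.range (n + 1), Measure.dirac (x i)) := by
  constructor
  simp only [Measure.smul_apply, Measure.coe_finsetSum, Finset.sum_apply, measure_univ,
    Finset.sum_const, Finset.card_range, smul_eq_mul, nsmul_eq_mul, mul_one]
  exact ENNReal.inv_mul_cancel (by simp) (by simp)

/-- empirical measure -/
def emp (x : ℕ → A) (n : ℕ) : ProbabilityMeasure A := ⟨_, emp_isProb x n⟩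

lemma emp_apply (x : ℕ → A) (n : ℕ) (s : Set A) (hs : MeasurableSet s) :
    ((emp x n : Measure A) s) = ENNReal.ofReal
      ((∑ i ∈ Finset.range (n + 1), s.indicator (fun _ => (1:ℝ)) (x i)) / ((n + 1 : ℕ) : ℝ)) := by
  have h1 : ∀ i, Measure.dirac (x i) s = ENNReal.ofReal (s.indicator (fun _ => (1:ℝ)) (x i)) := by
    intro i
    rw [Measure.dirac_apply' _ hs]
    by_cases h : x i ∈ s <;> simp [h]
  rw [ENNReal.ofReal_div_of_pos (by positivity), ENNReal.ofReal_sum_of_nonneg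
    (fun i _ => Set.indicator_nonneg (fun _ _ => zero_le_one) _), ENNReal.ofReal_natCast,
    ENNReal.div_eq_inv_mul]
  simp only [emp, ProbabilityMeasure.coe_mk, Measure.smul_apply, Measure.coe_finsetSum,
    Finset.sum_apply, smul_eq_mul, h1]

lemma emp_map {A' : Type*} [MeasurableSpace A'] (x : ℕ → A) (n : ℕ) (F : A → A')
    (hF : Measurable F) :
    Measure.map F (emp x n : Measure A) = (emp (fun i => F (x i)) n : Measure A') := by
  ext s hs
  rw [Measure.map_apply hF hs, emp_apply _ _ _ hs, emp_apply _ _ _ (hF hs)]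
  rfl

variable [TopologicalSpace A] [SecondCountableTopology A] [BorelSpace A]

lemma ae_emp_apply (ν : Measure A) [IsProbabilityMeasure ν] (s : Set A) (hs : MeasurableSet s) :
    ∀ᵐ x ∂(Measure.infinitePi fun _ : ℕ => ν),
      Tendsto (fun n => (emp x n : Measure A) s) atTop (𝓝 (ν s)) := by
  set P := Measure.infinitePi fun _ : ℕ => ν
  let g : A → ℝ := s.indicator (fun _ => (1:ℝ))
  have hg : Measurable g := measurable_const.indicator hs
  let X : ℕ → (ℕ → A) → ℝ := fun i x => g (x i)
  have hmp : ∀ i, MeasurePreserving (fun x : ℕ → A => x i) P ν := fun i =>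
    measurePreserving_eval_infinitePi (fun _ : ℕ => ν) i
  have hgi : Integrable g ν := (integrable_const (1:ℝ)).indicator hs
  have hint : Integrable (X 0) P := (hmp 0).integrable_comp_of_integrable hgi
  have hind : Pairwise (Function.onFun (fun f g => ProbabilityTheory.IndepFun f g P) X) := by
    intro i j hij
    exact (ProbabilityTheory.iIndepFun_infinitePi (P := fun _ : ℕ => ν)
      (X := fun _ => g) (fun _ => hg)).indepFun hij
  have hid : ∀ i, ProbabilityTheory.IdentDistrib (X i) (X 0) P P := by
    intro i
    refine ⟨(hg.comp (measurable_pi_apply i)).aemeasurable,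
      (hg.comp (measurable_pi_apply 0)).aemeasurable, ?_⟩
    have e : ∀ i, Measure.map (X i) P = Measure.map g ν := by
      intro i
      rw [← (hmp i).map_eq, Measure.map_map hg (measurable_pi_apply i)]; rfl
    rw [e, e]
  have hE : ∫ x, X 0 x ∂P = ν.real s := by
    rw [← integral_indicator_one hs, ← (hmp 0).map_eq, integral_map (measurable_pi_apply 0).aemeasurable]
    · rfl
    · exact (measurable_one.indicator hs).aestronglyMeasurable
  filter_upwards [ProbabilityTheory.strong_law_ae_real X hint hind hid] with x hx
  rw [hE] at hx
  have h2 := (ENNReal.continuous_ofReal.tendsto _).comp ((tendsto_add_atTop_iff_nat 1).2 hx)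
  rw [ofReal_measureReal] at h2
  refine h2.congr fun n => ?_
  rw [emp_apply _ _ _ hs]
  rfl

lemma exists_pi (A : Type*) [TopologicalSpace A] [SecondCountableTopology A] :
    ∃ S : Set (Set A), S.Countable ∧ IsPiSystem S ∧ (∀ s ∈ S, IsOpen s) ∧
      ∀ u : Set A, IsOpen u → ∀ x ∈ u, ∃ s ∈ S, s ∈ 𝓝 x ∧ s ⊆ u := by
  refine ⟨(fun F => ⋂₀ F) '' {F : Set (Set A) | F.Finite ∧ F ⊆ TopologicalSpace.countableBasis A},
    (Set.countable_ofPred_finite_subset (TopologicalSpace.countable_countableBasis A)).image _,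
    ?_, ?_, ?_⟩
  · rintro _ ⟨F, ⟨hF, hF'⟩, rfl⟩ _ ⟨G, ⟨hG, hG'⟩, rfl⟩ -
    exact ⟨F ∪ G, ⟨hF.union hG, union_subset hF' hG'⟩, sInter_union _ _⟩
  · rintro _ ⟨F, ⟨hF, hF'⟩, rfl⟩
    exact hF.isOpen_sInter fun s hs => TopologicalSpace.isOpen_of_mem_countableBasis (hF' hs)
  · intro u hu x hx
    obtain ⟨v, hv, hxv, hvu⟩ :=
      (TopologicalSpace.isBasis_countableBasis A).exists_subset_of_mem_open hx hu
    refine ⟨v, ⟨{v}, ⟨finite_singleton v, by simpa using hv⟩, by simp⟩, ?_, hvu⟩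
    exact (TopologicalSpace.isOpen_of_mem_countableBasis hv).mem_nhds hxv

lemma ae_emp (ν : Measure A) [hν : IsProbabilityMeasure ν] :
    ∀ᵐ x ∂(Measure.infinitePi fun _ : ℕ => ν),
      Tendsto (emp x) atTop (𝓝 (⟨ν, hν⟩ : ProbabilityMeasure A)) := by
  obtain ⟨S, hS, hpi, hop, hnh⟩ := exists_pi A
  have : ∀ᵐ x ∂(Measure.infinitePi fun _ : ℕ => ν), ∀ s ∈ S,
      Tendsto (fun n => (emp x n : Measure A) s) atTop (𝓝 (ν s)) :=
    (ae_ball_iff hS).2 fun s hs => ae_emp_apply ν s (hop s hs).measurableSet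
  filter_upwards [this] with x hx
  refine hpi.tendsto_probabilityMeasure_of_tendsto_of_mem (fun s hs => (hop s hs).measurableSet)
    hnh fun s hs => ?_
  exact (ENNReal.tendsto_toNNReal (measure_ne_top ν s)).comp (hx s hs)

/-- good sample sequences -/
def Good (ν : Measure A) [hν : IsProbabilityMeasure ν] (x : ℕ → A) : Prop :=
  Tendsto (emp x) atTop (𝓝 (⟨ν, hν⟩ : ProbabilityMeasure A)) ∧ ∀ i, x i ∈ ν.support

lemma ae_good (ν : Measure A) [hν : IsProbabilityMeasure ν] :
    ∀ᵐ x ∂(Measure.infinitePi fun _ : ℕ => ν), Good ν x := by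
  refine (ae_emp ν).and (ae_all_iff.2 fun i => ?_)
  exact (measurePreserving_eval_infinitePi (fun _ : ℕ => ν) i).quasiMeasurePreserving.ae
    (Measure.support_mem_ae (μ := ν))

/-- open sets of positive measure are hit infinitely often -/
lemma Good.frequently [HasOuterApproxClosed A] {ν : Measure A} [hν : IsProbabilityMeasure ν]
    {x : ℕ → A} (hx : Good ν x) (O : Set A) (hO : IsOpen O) (hpos : 0 < ν O) (N : ℕ) :
    ∃ i, N ≤ i ∧ x i ∈ O := by
  by_contra hc
  push Not at hc
  have h1 := ProbabilityMeasure.le_liminf_measure_open_of_tendsto hx.1 hO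
  have h2 : Tendsto (fun n => (emp x n : Measure A) O) atTop (𝓝 0) := by
    have h3 : Tendsto (fun n : ℕ => ENNReal.ofReal ((N : ℝ) / ((n + 1 : ℕ) : ℝ))) atTop (𝓝 0) := by
      have h4 : Tendsto (fun n : ℕ => (N : ℝ) / ((n + 1 : ℕ) : ℝ)) atTop (𝓝 0) :=
        (tendsto_add_atTop_iff_nat (f := fun n : ℕ => (N : ℝ) / (n : ℝ)) 1).2
          (tendsto_const_div_atTop_nhds_zero_nat (N : ℝ))
      simpa [Function.comp_def] using (ENNReal.continuous_ofReal.tendsto _).comp h4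
    refine tendsto_of_tendsto_of_tendsto_of_le_of_le tendsto_const_nhds h3 (fun _ => zero_le) ?_
    intro n
    beta_reduce
    rw [emp_apply _ _ _ hO.measurableSet]
    apply ENNReal.ofReal_le_ofReal
    gcongr
    calc ∑ i ∈ Finset.range (n + 1), O.indicator (fun _ => (1:ℝ)) (x i)
        ≤ ∑ i ∈ Finset.range (n + 1), (if i < N then (1:ℝ) else 0) := by
          apply Finset.sum_le_sum
          intro i _
          by_cases hi : i < N
          · simp only [hi, if_true]
            exact Set.indicator_le_self' (fun _ _ => zero_le_one) _
          · simp [hi, hc i (not_lt.1 hi)]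
      _ = ((Finset.range (n + 1)).filter (· < N)).card := by simp
      _ ≤ N := by
          norm_cast
          calc _ ≤ (Finset.range N).card := Finset.card_le_card (by intro i; simp)
            _ = N := by simp
  rw [h2.liminf_eq] at h1
  exact absurd hpos (not_lt.2 h1)

end ProbPart

section MainPart

instance (D : LongDendron) : IsProbabilityMeasure D.ν := D.isProb

lemma LongDendron.secondCountable (D : LongDendron) : SecondCountableTopology D.carrier := by
  have := rt_separable D.isRealTree D.ν D.branch_pos
  exact UniformSpace.secondCountable_of_separable D.carrier

/-- infinite distance matrix -/
def infMat (D : LongDendron) (x : ℕ → D.carrier × ℝ≥0) : ℕ × ℕ → ℝ :=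
  fun e => if e.1 = e.2 then 0 else D.dD (x e.1) (x e.2)

lemma dD_meas (D : LongDendron) {X : Type*} [MeasurableSpace X]
    (f g : X → D.carrier × ℝ≥0) (hf : Measurable f) (hg : Measurable g) :
    Measurable fun x => D.dD (f x) (g x) := by
  have := D.secondCountable
  unfold LongDendron.dD
  exact ((hf.fst.dist hg.fst).add hf.snd.coe_nnreal_real).add hg.snd.coe_nnreal_real

lemma infMat_meas (D : LongDendron) : Measurable (infMat D) := by
  refine measurable_pi_lambda _ fun e => ?_
  unfold infMat
  by_cases h : e.1 = e.2
  · simp [h]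
  · simp only [h, if_false]
    exact dD_meas D _ _ (measurable_pi_apply _) (measurable_pi_apply _)

lemma rho_meas (D : LongDendron) (r : ℕ) : Measurable (rho D.dD r) := by
  refine measurable_pi_lambda _ fun i => measurable_pi_lambda _ fun j => ?_
  unfold rho
  by_cases h : i = j
  · simp [h]
  · simp only [h, if_false]
    exact dD_meas D _ _ (measurable_pi_apply _) (measurable_pi_apply _)

/-- the law of the infinite sample -/
def LongDendron.P (D : LongDendron) : Measure (ℕ → D.carrier × ℝ≥0) :=
  Measure.infinitePi fun _ : ℕ => D.ν

instance (D : LongDendron) : IsProbabilityMeasure D.P := by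
  unfold LongDendron.P; infer_instance

lemma samp_eq (D : LongDendron) (r : ℕ) :
    D.samp r = Measure.map (fun x : ℕ → D.carrier × ℝ≥0 => rho D.dD r (fun i : Fin r => x i)) D.P := by
  have h := Measure.map_infinitePi_infinitePi_of_inj (P := fun _ : ℕ => D.ν)
    (f := fun i : Fin r => (i : ℕ)) Fin.val_injective
  have hm : Measurable (fun (x : ℕ → D.carrier × ℝ≥0) (i : Fin r) => x i) :=
    measurable_pi_lambda _ fun i => measurable_pi_apply _
  rw [LongDendron.samp, samplingMeasure, ← Measure.infinitePi_eq_pi, ← h, Measure.map_map (rho_meas D r) hm]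
  rfl

lemma mat_fin (D : LongDendron) (I : Finset (ℕ × ℕ)) (r : ℕ) (hr : ∀ e ∈ I, e.1 < r ∧ e.2 < r) :
    Measure.map I.restrict (Measure.map (infMat D) D.P) =
      Measure.map (fun (M : Fin r → Fin r → ℝ) (e : I) =>
        M ⟨e.1.1, (hr e.1 e.2).1⟩ ⟨e.1.2, (hr e.1 e.2).2⟩) (D.samp r) := by
  have hG : Measurable (fun (M : Fin r → Fin r → ℝ) (e : I) =>
        M ⟨e.1.1, (hr e.1 e.2).1⟩ ⟨e.1.2, (hr e.1 e.2).2⟩) :=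
    measurable_pi_lambda _ fun e => (measurable_pi_apply _).comp (measurable_pi_apply _)
  have hm : Measurable (fun (x : ℕ → D.carrier × ℝ≥0) (i : Fin r) => x i) :=
    measurable_pi_lambda _ fun i => measurable_pi_apply _
  rw [samp_eq, Measure.map_map (Finset.measurable_restrict _) (infMat_meas D),
    Measure.map_map hG (show Measurable (fun x : ℕ → D.carrier × ℝ≥0 =>
      rho D.dD r (fun i : Fin r => x i)) from (rho_meas D r).comp hm)]
  congr 1
  ext x e
  simp [infMat, rho]

lemma mat_law (D D' : LongDendron) (h : ∀ r : ℕ, 1 ≤ r → D.samp r = D'.samp r) :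
    Measure.map (infMat D) D.P = Measure.map (infMat D') D'.P := by
  have h1 := Measure.isProbabilityMeasure_map (μ := D'.P) (infMat_meas D').aemeasurable
  have h2 : ∀ I : Finset (ℕ × ℕ), IsFiniteMeasure
      (Measure.map I.restrict (Measure.map (infMat D') D'.P)) := fun I => inferInstance
  refine IsProjectiveLimit.unique
    (P := fun I : Finset (ℕ × ℕ) => Measure.map I.restrict (Measure.map (infMat D') D'.P))
    ?_ (fun I => rfl)
  intro I
  have hr : ∀ e ∈ I, e.1 < (I.sup (fun e => e.1 + e.2)) + 1 ∧
      e.2 < (I.sup (fun e => e.1 + e.2)) + 1 := by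
    intro e he
    have := Finset.le_sup (f := fun e : ℕ × ℕ => e.1 + e.2) he
    omega
  beta_reduce
  rw [mat_fin D I _ hr, mat_fin D' I _ hr, h _ (by omega)]

lemma exists_match (D D' : LongDendron) (h : ∀ r : ℕ, 1 ≤ r → D.samp r = D'.samp r)
    (p : (ℕ → D.carrier × ℝ≥0) → Prop) (p' : (ℕ → D'.carrier × ℝ≥0) → Prop)
    (hp : ∀ᵐ x ∂D.P, p x) (hp' : ∀ᵐ x ∂D'.P, p' x) :
    ∃ x y, p x ∧ p' y ∧ infMat D x = infMat D' y := by
  have := D.secondCountable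
  have := D'.secondCountable
  have := D.isRealTree.2.1
  have := D'.isRealTree.2.1
  obtain ⟨t, ht, htm, ht0⟩ := exists_measurable_superset_of_null (ae_iff.1 hp)
  obtain ⟨t', ht', htm', ht0'⟩ := exists_measurable_superset_of_null (ae_iff.1 hp')
  have ha := htm.compl.analyticSet_image (infMat_meas D)
  have ha' := htm'.compl.analyticSet_image (infMat_meas D')
  by_cases hd : Disjoint (infMat D '' tᶜ) (infMat D' '' t'ᶜ)
  · exfalso
    obtain ⟨w, hw, hw', hwm⟩ := ha.measurablySeparable ha' hd
    have e1 : Measure.map (infMat D) D.P w = Measure.map (infMat D') D'.P w := by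
      rw [mat_law D D' h]
    rw [Measure.map_apply (infMat_meas D) hwm, Measure.map_apply (infMat_meas D') hwm] at e1
    have e2 : D'.P (infMat D' ⁻¹' w) = 0 := by
      refine measure_mono_null (fun y hy => ?_) ht0'
      by_contra hyt
      exact Set.disjoint_left.1 hw' ⟨y, hyt, rfl⟩ hy
    have e3 : 1 ≤ D.P (infMat D ⁻¹' w) := by
      rw [← prob_compl_eq_one_iff htm] at ht0
      rw [← ht0]
      exact measure_mono fun y hy => hw ⟨y, hy, rfl⟩
    rw [e1, e2] at e3
    simp at e3
  · rw [Set.not_disjoint_iff] at hd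
    obtain ⟨_, ⟨x, hx, rfl⟩, ⟨y, hy, hxy⟩⟩ := hd
    refine ⟨x, y, ?_, ?_, hxy.symm⟩
    · by_contra hc; exact hx (ht hc)
    · by_contra hc; exact hy (ht' hc)

lemma good_branch (D : LongDendron) (x : ℕ → D.carrier × ℝ≥0) (hx : Good D.ν x)
    (B : Set D.carrier) (hB : IsBranch B) : ∃ i, (x i).1 ∈ B := by
  have := D.secondCountable
  have h0 := D.branch_pos B hB
  obtain ⟨p, q, hq, rfl⟩ := hB
  obtain ⟨i, -, hi⟩ := hx.frequently _ ((rt_open D.isRealTree p q).prod isOpen_univ) h0 0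
  exact ⟨i, hi.1⟩

lemma good_le (D D' : LongDendron) (x : ℕ → D.carrier × ℝ≥0) (y : ℕ → D'.carrier × ℝ≥0)
    (hy : Good D'.ν y) (hxy : infMat D x = infMat D' y) (i : ℕ) :
    ((x i).2 : ℝ) ≤ (y i).2 := by
  have := D'.secondCountable
  apply le_of_forall_pos_le_add
  intro ε hε
  have hO : IsOpen (ball (y i).1 ε ×ˢ (Set.univ : Set ℝ≥0)) := isOpen_ball.prod isOpen_univ
  have hpos : 0 < D'.ν (ball (y i).1 ε ×ˢ (Set.univ : Set ℝ≥0)) :=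
    (Measure.mem_support_iff_forall _).1 (hy.2 i) _ (hO.mem_nhds ⟨mem_ball_self hε, mem_univ _⟩)
  obtain ⟨j, hj, hjO⟩ := hy.frequently _ hO hpos (i + 1)
  obtain ⟨k, hk, hkO⟩ := hy.frequently _ hO hpos (j + 1)
  have m1 := congrFun hxy (i, j)
  have m2 := congrFun hxy (i, k)
  have m3 := congrFun hxy (j, k)
  simp only [infMat, LongDendron.dD, show i ≠ j by omega, show i ≠ k by omega,
    show j ≠ k by omega, if_false] at m1 m2 m3
  have b1 := mem_ball.1 hjO.1
  have b2 := mem_ball.1 hkO.1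
  rw [dist_comm] at b1 b2
  have t1 := dist_triangle (x j).1 (x i).1 (x k).1
  rw [dist_comm (x j).1 (x i).1] at t1
  have t2 := dist_nonneg (x := (y j).1) (y := (y k).1)
  linarith

end MainPart

/-- **Theorem 3 (Elek–Tardos).** Long dendrons with the same sampling measures are
isomorphic. -/
theorem statement2 (D D' : LongDendron)
    (h : ∀ r : ℕ, 1 ≤ r → D.samp r = D'.samp r) :
    ∃ f : D.carrier → D'.carrier, Isometry f ∧ Function.Bijective f ∧
      Measure.map (fun x : D.carrier × ℝ≥0 => (f x.1, x.2)) D.ν = D'.ν := by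
  have := D.secondCountable
  have := D'.secondCountable
  obtain ⟨x, y, hx, hy, hxy⟩ := exists_match D D' h (Good D.ν) (Good D'.ν)
    (ae_good D.ν) (ae_good D'.ν)
  have ha : ∀ i, (x i).2 = (y i).2 := fun i => NNReal.coe_injective
    (le_antisymm (good_le D D' x y hy hxy i) (good_le D' D y x hx hxy.symm i))
  have hd : ∀ i j, dist (x i).1 (x j).1 = dist (y i).1 (y j).1 := by
    intro i j
    by_cases hij : i = j
    · simp [hij]
    have m := congrFun hxy (i, j)
    simp only [infMat, LongDendron.dD, hij, if_false, ha] at m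
    linarith
  obtain ⟨f, hf, hb, hfu⟩ := rt_iso D.isRealTree D'.isRealTree (fun i => (x i).1)
    (fun i => (y i).1) hd (good_branch D x hx) (good_branch D' y hy)
  refine ⟨f, hf, hb, ?_⟩
  have hF : Continuous (fun x : D.carrier × ℝ≥0 => (f x.1, x.2)) :=
    (hf.continuous.comp continuous_fst).prodMk continuous_snd
  have hFx : (fun i => (f (x i).1, (x i).2)) = y := by
    funext i
    exact Prod.ext (hfu i) (ha i)
  have t1 := ProbabilityMeasure.tendsto_map_of_tendsto_of_continuous _ _ hx.1 hF
  have e : ∀ n, (emp x n).map hF.measurable.aemeasurable = emp y n := by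
    intro n
    apply Subtype.ext
    have := emp_map x n _ hF.measurable
    rw [hFx] at this
    exact this
  simp only [e] at t1
  have := tendsto_nhds_unique t1 hy.1
  exact congrArg (fun μ : ProbabilityMeasure (D'.carrier × ℝ≥0) => (μ : Measure (D'.carrier × ℝ≥0))) this

end
end
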